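/- Assume the Riemann Hypothesis. Let ℓ ≥ 1 be an integer, N a sufficiently large integer and L = log N. Then ∫_{−ξ}^{ξ} | S̃_ℓ(α) − Γ(1/ℓ)/(ℓ z^{1/ℓ}) |² dα ≪_ℓ N^{1/ℓ} ξ L², uniformly for 0 ≤ ξ ≤ 1/2. -/

import Mathlib

open Complex MeasureTheory

/-- `S̃_ℓ(α) = ∑_{n=1}^∞ Λ(n) e^{−n^ℓ/N} e(n^ℓ α)`, with `e(x) = exp(2πix)`. -/
noncomputable def Stilde (N ℓ : ℕ) (α : ℝ) : ℂ :=
  ∑' n : ℕ, (ArithmeticFunction.vonMangoldt n : ℂ) *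
    Complex.exp (-(n : ℂ) ^ ℓ / N) *
    Complex.exp (2 * Real.pi * Complex.I * (n : ℂ) ^ ℓ * α)

/-- One term of the comparison between `∑ Re 1/(s+j)` and a logarithm. -/
lemma abs_div_sub_half_log_le {a : ℝ} (ha : 0 < a) (τ : ℝ) :
    |a / (a ^ 2 + τ ^ 2) -
      (Real.log ((a + 1) ^ 2 + τ ^ 2) / 2 - Real.log (a ^ 2 + τ ^ 2) / 2)| ≤ 1 / a ^ 2 := by
  have hpos : ∀ x, a ≤ x → 0 < x ^ 2 + τ ^ 2 := fun x hx => by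
    have : 0 < x := ha.trans_le hx
    positivity
  have hd : ∀ x, a ≤ x → HasDerivAt (fun x => Real.log (x ^ 2 + τ ^ 2) / 2)
      (x / (x ^ 2 + τ ^ 2)) x := fun x hx => by
    have h1 : HasDerivAt (fun x : ℝ => x ^ 2 + τ ^ 2) (2 * x) x := by
      simpa using (hasDerivAt_pow 2 x).add_const (τ ^ 2)
    convert! (h1.log (hpos x hx).ne').div_const 2 using 1
    field_simp
  have hd2 : ∀ x, a ≤ x → HasDerivAt (fun x => x / (x ^ 2 + τ ^ 2))
      ((τ ^ 2 - x ^ 2) / (x ^ 2 + τ ^ 2) ^ 2) x := fun x hx => by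
    have h1 : HasDerivAt (fun x : ℝ => x ^ 2 + τ ^ 2) (2 * x) x := by
      simpa using (hasDerivAt_pow 2 x).add_const (τ ^ 2)
    convert! (hasDerivAt_id x).div h1 (hpos x hx).ne' using 1
    simp only [id]
    ring
  have hb : ∀ x, a ≤ x → ‖(τ ^ 2 - x ^ 2) / (x ^ 2 + τ ^ 2) ^ 2‖ ≤ 1 / a ^ 2 := fun x hx => by
    have hx0 := hpos x hx
    rw [Real.norm_eq_abs, abs_div, abs_of_pos (by positivity : 0 < (x ^ 2 + τ ^ 2) ^ 2),
      div_le_div_iff₀ (by positivity) (by positivity), one_mul]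
    have h1 : |τ ^ 2 - x ^ 2| ≤ x ^ 2 + τ ^ 2 := by
      rw [abs_le]; constructor <;> nlinarith [sq_nonneg x, sq_nonneg τ]
    have h2 : a ^ 2 ≤ x ^ 2 + τ ^ 2 := by nlinarith [sq_nonneg τ]
    calc |τ ^ 2 - x ^ 2| * a ^ 2 ≤ (x ^ 2 + τ ^ 2) * (x ^ 2 + τ ^ 2) := by gcongr
      _ = _ := by ring
  obtain ⟨c, hc, hc'⟩ := exists_hasDerivAt_eq_slope (fun x => Real.log (x ^ 2 + τ ^ 2) / 2)
    (fun x => x / (x ^ 2 + τ ^ 2)) (show a < a + 1 by linarith)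
    (fun x hx => (hd x hx.1).continuousAt.continuousWithinAt) (fun x hx => hd x hx.1.le)
  simp only [add_sub_cancel_left, div_one] at hc'
  rw [← hc', ← Real.norm_eq_abs, norm_sub_rev]
  have := (convex_Icc a (a + 1)).norm_image_sub_le_of_norm_hasDerivWithin_le
    (fun x hx => (hd2 x hx.1).hasDerivWithinAt) (fun x hx => hb x hx.1)
    (Set.left_mem_Icc.2 (by linarith)) (Set.Ioo_subset_Icc_self hc)
  refine this.trans ?_
  have h3 : ‖c - a‖ ≤ 1 := by
    rw [Real.norm_eq_abs, abs_le]; constructor <;> linarith [hc.1, hc.2]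
  calc _ ≤ 1 / a ^ 2 * 1 := by gcongr
    _ = _ := mul_one _

lemma abs_sum_div_sub_half_log_le {a₀ a : ℝ} (ha₀ : 0 < a₀) (ha : a₀ ≤ a) (τ : ℝ) (n : ℕ) :
    |∑ j ∈ Finset.range n, (a + j) / ((a + j) ^ 2 + τ ^ 2) -
      (Real.log ((a + n) ^ 2 + τ ^ 2) / 2 - Real.log (a ^ 2 + τ ^ 2) / 2)| ≤
      ∑' j : ℕ, 1 / (j + a₀) ^ 2 := by
  have hs : Summable fun j : ℕ => 1 / ((j : ℝ) + a₀) ^ 2 := by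
    have := (Real.summable_one_div_nat_add_rpow a₀ 2).2 (by norm_num)
    refine this.congr fun j => ?_
    rw [abs_of_pos (by positivity)]
    norm_cast
  have h1 : ∑ j ∈ Finset.range n, (a + j) / ((a + j) ^ 2 + τ ^ 2) -
      (Real.log ((a + n) ^ 2 + τ ^ 2) / 2 - Real.log (a ^ 2 + τ ^ 2) / 2) =
      ∑ j ∈ Finset.range n, ((a + j) / ((a + j) ^ 2 + τ ^ 2) -
        (Real.log ((a + j + 1) ^ 2 + τ ^ 2) / 2 - Real.log ((a + j) ^ 2 + τ ^ 2) / 2)) := by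
    rw [Finset.sum_sub_distrib]
    congr 1
    have := Finset.sum_range_sub (fun j : ℕ => Real.log ((a + j) ^ 2 + τ ^ 2) / 2) n
    simp only [Nat.cast_add, Nat.cast_one, Nat.cast_zero, add_zero, ← add_assoc] at this
    exact this.symm
  rw [h1]
  refine (Finset.abs_sum_le_sum_abs _ _).trans ?_
  refine le_trans (Finset.sum_le_sum fun j _ => ?_) (hs.sum_le_tsum _ fun j _ => by positivity)
  have hj : (0 : ℝ) ≤ j := j.cast_nonneg
  refine (abs_div_sub_half_log_le (by linarith : 0 < a + j) τ).trans ?_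
  exact one_div_le_one_div_of_le (by positivity)
    (pow_le_pow_left₀ (by positivity) (by linarith) 2)

lemma log_norm_eq_half_log (s : ℂ) : Real.log ‖s‖ = Real.log (s.re ^ 2 + s.im ^ 2) / 2 := by
  rw [Complex.norm_eq_sqrt_sq_add_sq, Real.log_sqrt (by positivity)]

lemma log_norm_GammaSeq {s : ℂ} (hs : 0 < s.re) {n : ℕ} (hn : n ≠ 0) :
    Real.log ‖GammaSeq s n‖ = s.re * Real.log n + Real.log n.factorial -
      ∑ j ∈ Finset.range (n + 1), Real.log ((s.re + j) ^ 2 + s.im ^ 2) / 2 := by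
  have hne : ∀ j : ℕ, s + j ≠ 0 := fun j h => by
    have := congrArg Complex.re h
    simp at this
    have : (0 : ℝ) ≤ j := by positivity
    linarith
  have hn' : (n : ℝ) ≠ 0 := by exact_mod_cast hn
  rw [GammaSeq, norm_div, norm_mul, norm_prod, Real.log_div, Real.log_mul,
    Complex.norm_natCast_cpow_of_pos (Nat.pos_of_ne_zero hn), Real.log_rpow (by positivity),
    Complex.norm_natCast, Real.log_prod]
  · congr 1
    refine Finset.sum_congr rfl fun j _ => ?_
    rw [log_norm_eq_half_log]
    simp
  · intro j _
    exact norm_ne_zero_iff.2 (hne j)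
  · rw [Complex.norm_natCast_cpow_of_pos (Nat.pos_of_ne_zero hn)]; positivity
  · rw [Complex.norm_natCast]; positivity
  · rw [Complex.norm_natCast_cpow_of_pos (Nat.pos_of_ne_zero hn), Complex.norm_natCast]; positivity
  · exact Finset.prod_ne_zero_iff.2 fun j _ => norm_ne_zero_iff.2 (hne j)

/-- The logarithmic increment of `|Γ|` along a horizontal segment, up to a bounded multiple of
the length. -/
lemma exists_abs_log_norm_Gamma_add_sub_le {a₀ a₁ : ℝ} (ha₀ : 0 < a₀) :
    ∃ C > 0, ∀ s : ℂ, ∀ h : ℝ, 0 ≤ h → a₀ ≤ s.re → s.re + h ≤ a₁ →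
      |Real.log ‖Gamma (s + h)‖ - Real.log ‖Gamma s‖ - h * Real.log (1 + |s.im|)| ≤ C * h := by
  set S := ∑' j : ℕ, 1 / ((j : ℝ) + a₀) ^ 2 with hS
  have hS0 : 0 ≤ S := tsum_nonneg fun j => by positivity
  refine ⟨S + 1 + (|a₁| + 1 + 1 / a₀), by positivity, fun s h hh hs hsh => ?_⟩
  have hs0 : 0 < s.re := ha₀.trans_le hs
  have hlogw : ∀ x : ℝ, a₀ ≤ x → x ≤ a₁ →
      |Real.log (x ^ 2 + s.im ^ 2) / 2 - Real.log (1 + |s.im|)| ≤ |a₁| + 1 + 1 / a₀ := by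
    intro x hx hx1
    have hx0 : 0 < x := ha₀.trans_le hx
    set y := √(x ^ 2 + s.im ^ 2) with hy
    have hy1 : Real.log (x ^ 2 + s.im ^ 2) / 2 = Real.log y := by
      rw [hy, Real.log_sqrt (by positivity)]
    have hy0 : 0 < y := Real.sqrt_pos.2 (by positivity)
    have hxy : x ≤ y := Real.le_sqrt_of_sq_le (by nlinarith [sq_nonneg s.im])
    have hty : |s.im| ≤ y := Real.le_sqrt_of_sq_le (by rw [sq_abs]; nlinarith)
    have hyx : y ≤ x + |s.im| := by
      rw [hy, Real.sqrt_le_left (by positivity)]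
      nlinarith [sq_abs s.im, mul_nonneg hx0.le (abs_nonneg s.im)]
    rw [hy1, ← Real.log_div hy0.ne' (by positivity), abs_le]
    constructor
    · refine le_trans ?_ (Real.one_sub_inv_le_log_of_pos (by positivity))
      rw [inv_div]
      have : (1 + |s.im|) / y ≤ 1 / a₀ + 1 := by
        rw [add_div]
        exact add_le_add (one_div_le_one_div_of_le ha₀ (hx.trans hxy)) ((div_le_one hy0).2 hty)
      have := abs_nonneg a₁
      linarith
    · refine (Real.log_le_sub_one_of_pos (by positivity)).trans ?_
      have : y / (1 + |s.im|) ≤ |a₁| + 1 := by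
        rw [div_le_iff₀ (by positivity)]
        nlinarith [abs_nonneg s.im, le_abs_self a₁, abs_nonneg a₁,
          mul_nonneg (abs_nonneg a₁) (abs_nonneg s.im)]
      have : 0 < 1 / a₀ := by positivity
      linarith
  have hev : ∀ᶠ n : ℕ in Filter.atTop,
      |Real.log ‖GammaSeq (s + h) n‖ - Real.log ‖GammaSeq s n‖ - h * Real.log (1 + |s.im|)| ≤
        (S + 1 + (|a₁| + 1 + 1 / a₀)) * h := by
    filter_upwards [Filter.eventually_ge_atTop (⌈|a₁| + 1 + |s.im|⌉₊ + 1)] with n hn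
    have hn1 : n ≠ 0 := by omega
    have hnK : |a₁| + 1 + |s.im| ≤ n :=
      (Nat.le_ceil _).trans (by exact_mod_cast (Nat.le_succ _).trans hn)
    have hn0 : (0 : ℝ) < n := by exact_mod_cast Nat.pos_of_ne_zero hn1
    set F : ℝ → ℝ := fun x => x * Real.log n - x * Real.log (1 + |s.im|) -
      ∑ j ∈ Finset.range (n + 1), Real.log ((x + j) ^ 2 + s.im ^ 2) / 2 with hF
    have hFd : ∀ x, a₀ ≤ x → HasDerivAt F (Real.log n - Real.log (1 + |s.im|) -
        ∑ j ∈ Finset.range (n + 1), (x + j) / ((x + j) ^ 2 + s.im ^ 2)) x := by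
      intro x hx
      have hx0 : 0 < x := ha₀.trans_le hx
      refine HasDerivAt.sub (HasDerivAt.sub ?_ ?_) (HasDerivAt.fun_sum fun j _ => ?_)
      · simpa using (hasDerivAt_id x).mul_const (Real.log n)
      · simpa using (hasDerivAt_id x).mul_const (Real.log (1 + |s.im|))
      · have hj : (0 : ℝ) ≤ j := j.cast_nonneg
        have hp : 0 < (x + j) ^ 2 + s.im ^ 2 := by positivity
        have h1 : HasDerivAt (fun x : ℝ => (x + j) ^ 2 + s.im ^ 2) (2 * (x + j)) x := by
          simpa using (((hasDerivAt_id x).add_const (j : ℝ)).pow 2).add_const (s.im ^ 2)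
        convert! (h1.log hp.ne').div_const 2 using 1
        field_simp
    have hFb : ∀ x, a₀ ≤ x → x ≤ a₁ → ‖Real.log n - Real.log (1 + |s.im|) -
        ∑ j ∈ Finset.range (n + 1), (x + j) / ((x + j) ^ 2 + s.im ^ 2)‖ ≤
        S + 1 + (|a₁| + 1 + 1 / a₀) := by
      intro x hx hx1
      have hx0 : 0 < x := ha₀.trans_le hx
      have e1 := abs_sum_div_sub_half_log_le ha₀ hx s.im (n + 1)
      have e2 := hlogw x hx hx1
      have e3 : |Real.log ((x + (n + 1 : ℕ)) ^ 2 + s.im ^ 2) / 2 - Real.log n| ≤ 1 := by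
        push_cast
        have l1 : Real.log ((n : ℝ) ^ 2) ≤ Real.log ((x + (n + 1)) ^ 2 + s.im ^ 2) :=
          Real.log_le_log (by positivity) (by nlinarith [sq_nonneg s.im])
        have l2 : Real.log ((x + (n + 1)) ^ 2 + s.im ^ 2) ≤ Real.log ((2 * (n : ℝ)) ^ 2) := by
          refine Real.log_le_log (by positivity) ?_
          have : x + (n + 1) + |s.im| ≤ 2 * n := by linarith [le_abs_self a₁]
          calc (x + (n + 1)) ^ 2 + s.im ^ 2 ≤ (x + (n + 1) + |s.im|) ^ 2 := by
                have := mul_nonneg (show 0 ≤ x + ((n : ℝ) + 1) by positivity) (abs_nonneg s.im)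
                nlinarith [sq_abs s.im]
            _ ≤ _ := pow_le_pow_left₀ (by positivity) this 2
        rw [Real.log_pow] at l1 l2
        rw [Real.log_mul (by norm_num) hn0.ne'] at l2
        have := Real.log_two_lt_d9
        push_cast at l1 l2
        rw [abs_le]
        constructor <;> linarith
      rw [Real.norm_eq_abs, abs_le]
      rw [abs_le] at e1 e2 e3
      constructor <;> linarith [e1.1, e1.2, e2.1, e2.2, e3.1, e3.2]
    have hmv := (convex_Icc a₀ a₁).norm_image_sub_le_of_norm_hasDerivWithin_le
      (fun x hx => (hFd x hx.1).hasDerivWithinAt) (fun x hx => hFb x hx.1 hx.2)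
      (show s.re ∈ Set.Icc a₀ a₁ from ⟨hs, by linarith⟩)
      (show s.re + h ∈ Set.Icc a₀ a₁ from ⟨by linarith, hsh⟩)
    rw [add_sub_cancel_left, Real.norm_eq_abs, Real.norm_eq_abs, abs_of_nonneg hh] at hmv
    refine le_trans (le_of_eq ?_) hmv
    rw [log_norm_GammaSeq (by simpa using by linarith) hn1, log_norm_GammaSeq hs0 hn1]
    congr 1
    simp only [hF, add_re, ofReal_re, add_im, ofReal_im, add_zero]
    ring
  have hg0 : Gamma s ≠ 0 := Gamma_ne_zero_of_re_pos hs0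
  have hg1 : Gamma (s + h) ≠ 0 := Gamma_ne_zero_of_re_pos (by simpa using by linarith)
  refine le_of_tendsto ?_ hev
  refine ((Filter.Tendsto.sub ?_ ?_).sub_const _).abs
  · exact ((GammaSeq_tendsto_Gamma _).norm).log (norm_ne_zero_iff.2 hg1)
  · exact ((GammaSeq_tendsto_Gamma _).norm).log (norm_ne_zero_iff.2 hg0)

lemma norm_Gamma_half_add_sq (τ : ℝ) :
    ‖Gamma (1 / 2 + τ * I)‖ ^ 2 = Real.pi / Real.cosh (Real.pi * τ) := by
  have h1 := Complex.Gamma_mul_Gamma_one_sub (1 / 2 + τ * I)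
  have h2 : (1 : ℂ) - (1 / 2 + τ * I) = (starRingEnd ℂ) (1 / 2 + τ * I) := by
    apply Complex.ext
    · simp
      norm_num
    · simp
  rw [h2, Gamma_conj, mul_conj, Complex.normSq_eq_norm_sq] at h1
  have h3 : (Real.pi : ℂ) * (1 / 2 + τ * I) = Real.pi / 2 - (-(Real.pi * τ : ℝ) * I) := by
    push_cast; ring
  rw [h3, Complex.sin_pi_div_two_sub, Complex.cos_mul_I, Complex.cosh_neg] at h1
  exact_mod_cast h1

lemma abs_log_norm_Gamma_half_add_le (τ : ℝ) :
    |Real.log ‖Gamma (1 / 2 + τ * I)‖ + Real.pi * |τ| / 2| ≤ 2 := by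
  have h0 : 0 < ‖Gamma (1 / 2 + τ * I)‖ :=
    norm_pos_iff.2 (Gamma_ne_zero_of_re_pos (by simp))
  have h1 := congrArg Real.log (norm_Gamma_half_add_sq τ)
  rw [Real.log_pow, Real.log_div Real.pi_ne_zero (Real.cosh_pos _).ne'] at h1
  push_cast at h1
  have hp : Real.pi * |τ| = |Real.pi * τ| := by rw [abs_mul, abs_of_pos Real.pi_pos]
  have h2 : Real.log (Real.cosh (Real.pi * τ)) ≤ Real.pi * |τ| := by
    rw [Real.log_le_iff_le_exp (Real.cosh_pos _), hp, ← Real.cosh_abs, Real.cosh_eq]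
    have : Real.exp (-|Real.pi * τ|) ≤ Real.exp (|Real.pi * τ|) :=
      Real.exp_le_exp.2 (by linarith [abs_nonneg (Real.pi * τ)])
    linarith
  have h3 : Real.pi * |τ| - Real.log 2 ≤ Real.log (Real.cosh (Real.pi * τ)) := by
    rw [Real.le_log_iff_exp_le (Real.cosh_pos _), Real.exp_sub, Real.exp_log (by norm_num), hp,
      ← Real.cosh_abs (Real.pi * τ), Real.cosh_eq]
    have : 0 < Real.exp (-|Real.pi * τ|) := Real.exp_pos _
    linarith
  have h4 : Real.log Real.pi ≤ 3 := by
    have := Real.log_le_sub_one_of_pos Real.pi_pos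
    linarith [Real.pi_lt_four]
  have h5 : 0 ≤ Real.log Real.pi := Real.log_nonneg (by linarith [Real.pi_gt_three])
  have := Real.log_two_lt_d9
  rw [abs_le]
  constructor <;> linarith

/-- Stirling's formula in vertical strips, up to a bounded factor. -/
lemma exists_abs_log_norm_Gamma_sub_le {a₀ a₁ : ℝ} (ha₀ : 0 < a₀) (h₀ : a₀ ≤ 1 / 2)
    (h₁ : 1 / 2 ≤ a₁) :
    ∃ C > 0, ∀ s : ℂ, a₀ ≤ s.re → s.re ≤ a₁ →
      |Real.log ‖Gamma s‖ - (s.re - 1 / 2) * Real.log (1 + |s.im|) + Real.pi * |s.im| / 2| ≤ C := by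
  obtain ⟨C, hC, h⟩ := exists_abs_log_norm_Gamma_add_sub_le (a₁ := a₁) ha₀
  refine ⟨2 + C * (a₁ + 1), by positivity, fun s hs hs' => ?_⟩
  have h2 := abs_log_norm_Gamma_half_add_le s.im
  rw [abs_le] at h2 ⊢
  rcases le_total s.re (1 / 2) with hle | hle
  · have h3 := h s (1 / 2 - s.re) (by linarith) hs (by linarith)
    have : s + ((1 / 2 - s.re : ℝ) : ℂ) = 1 / 2 + s.im * I := by
      apply Complex.ext <;> simp
    rw [this, abs_le] at h3
    have : C * (1 / 2 - s.re) ≤ C * (a₁ + 1) := by gcongr; linarith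
    constructor <;> linarith [h2.1, h2.2, h3.1, h3.2]
  · have h3 := h (1 / 2 + s.im * I) (s.re - 1 / 2) (by linarith) (by simpa using h₀) (by simpa)
    have : (1 / 2 + s.im * I) + ((s.re - 1 / 2 : ℝ) : ℂ) = s := by
      apply Complex.ext <;> simp
    rw [this, abs_le] at h3
    simp at h3
    have : C * (s.re - 1 / 2) ≤ C * (a₁ + 1) := by gcongr; linarith
    constructor <;> linarith [h2.1, h2.2, h3.1, h3.2]

lemma exists_norm_Gamma_le {a₀ a₁ : ℝ} (ha₀ : 0 < a₀) (h₀ : a₀ ≤ 1 / 2) (h₁ : 1 / 2 ≤ a₁) :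
    ∃ C > 0, ∀ s : ℂ, a₀ ≤ s.re → s.re ≤ a₁ →
      ‖Gamma s‖ ≤ C * (1 + |s.im|) ^ (s.re - 1 / 2) * Real.exp (-(Real.pi * |s.im| / 2)) := by
  obtain ⟨C, hC, h⟩ := exists_abs_log_norm_Gamma_sub_le ha₀ h₀ h₁
  refine ⟨Real.exp C, Real.exp_pos _, fun s hs hs' => ?_⟩
  have h0 : 0 < ‖Gamma s‖ := norm_pos_iff.2 (Gamma_ne_zero_of_re_pos (ha₀.trans_le hs))
  rw [Real.rpow_def_of_pos (by positivity), ← Real.exp_add, ← Real.exp_add,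
    ← Real.log_le_iff_le_exp h0]
  have := (abs_le.1 (h s hs hs')).2
  linarith

lemma exists_norm_completedRiemannZeta₀_le (a b : ℝ) :
    ∃ C > 0, ∀ s : ℂ, a ≤ s.re → s.re ≤ b → ‖completedRiemannZeta₀ s‖ ≤ C := by
  set P := HurwitzZeta.hurwitzEvenFEPair 0 with hP
  have hconv : ∀ s : ℂ, MellinConvergent P.f_modif s := fun s =>
    (P.isStrongFEPair_toStrongFEPair.hasMellin s).1
  have hn : ∀ σ : ℝ, IntegrableOn (fun t : ℝ => t ^ (σ - 1) * ‖P.f_modif t‖) (Set.Ioi 0) := by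
    intro σ
    refine (hconv σ).norm.congr ?_
    filter_upwards [ae_restrict_mem measurableSet_Ioi] with t ht
    rw [norm_smul, norm_cpow_eq_rpow_re_of_pos ht]
    simp
  refine ⟨(∫ t in Set.Ioi (0 : ℝ), (t ^ (a / 2 - 1) * ‖P.f_modif t‖ +
    t ^ (b / 2 - 1) * ‖P.f_modif t‖)) / 2 + 1, ?_, fun s hs hs' => ?_⟩
  · have : 0 ≤ ∫ t in Set.Ioi (0 : ℝ), (t ^ (a / 2 - 1) * ‖P.f_modif t‖ +
        t ^ (b / 2 - 1) * ‖P.f_modif t‖) := by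
      refine setIntegral_nonneg measurableSet_Ioi fun t (ht : 0 < t) => ?_
      positivity
    positivity
  · have h1 : completedRiemannZeta₀ s = mellin P.f_modif (s / 2) / 2 := rfl
    rw [h1, norm_div]
    simp only [Complex.norm_ofNat]
    suffices ‖mellin P.f_modif (s / 2)‖ ≤ ∫ t in Set.Ioi (0 : ℝ),
        (t ^ (a / 2 - 1) * ‖P.f_modif t‖ + t ^ (b / 2 - 1) * ‖P.f_modif t‖) by linarith
    refine norm_integral_le_of_norm_le ((hn _).add (hn _)) ?_
    filter_upwards [ae_restrict_mem measurableSet_Ioi] with t (ht : 0 < t)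
    rw [norm_smul, norm_cpow_eq_rpow_re_of_pos ht, ← add_mul]
    gcongr
    have h2 : (s / 2 - 1).re = s.re / 2 - 1 := by simp
    rw [h2]
    rcases le_total t 1 with h | h
    · have : t ^ (s.re / 2 - 1) ≤ t ^ (a / 2 - 1) :=
        Real.rpow_le_rpow_of_exponent_ge ht h (by linarith)
      have : 0 ≤ t ^ (b / 2 - 1) := by positivity
      linarith
    · have : t ^ (s.re / 2 - 1) ≤ t ^ (b / 2 - 1) :=
        Real.rpow_le_rpow_of_exponent_le h (by linarith)
      have : 0 ≤ t ^ (a / 2 - 1) := by positivity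
      linarith

/-- The entire function `s (s - 1) Λ(s)`. -/
noncomputable def riemannXi (s : ℂ) : ℂ := s * (s - 1) * completedRiemannZeta₀ s + 1

lemma differentiable_riemannXi : Differentiable ℂ riemannXi := by
  unfold riemannXi
  have := differentiable_completedZeta₀
  fun_prop

lemma riemannXi_one_sub (s : ℂ) : riemannXi (1 - s) = riemannXi s := by
  unfold riemannXi
  rw [completedRiemannZeta₀_one_sub]
  ring

/-- The function `(s - 1) ζ(s)`, with its value at `1` filled in, for `0 < re s`. -/
noncomputable def zetaMulSubOne (s : ℂ) : ℂ := riemannXi s * (s⁻¹ * (Gammaℝ s)⁻¹)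

lemma zetaMulSubOne_eq {s : ℂ} (hs : 0 < s.re) (h1 : s ≠ 1) :
    zetaMulSubOne s = (s - 1) * riemannZeta s := by
  have h0 : s ≠ 0 := fun h => by simp [h] at hs
  have hG := Gammaℝ_ne_zero_of_re_pos hs
  have h2 : 1 - s ≠ 0 := sub_ne_zero.2 h1.symm
  rw [zetaMulSubOne, riemannXi, riemannZeta_def_of_ne_zero h0, completedRiemannZeta_eq]
  field_simp
  ring

lemma zetaMulSubOne_one : zetaMulSubOne 1 = 1 := by
  simp [zetaMulSubOne, riemannXi, Gammaℝ_one]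

lemma differentiableAt_zetaMulSubOne {s : ℂ} (hs : 0 < s.re) :
    DifferentiableAt ℂ zetaMulSubOne s := by
  have h0 : s ≠ 0 := fun h => by simp [h] at hs
  unfold zetaMulSubOne
  exact (differentiable_riemannXi s).mul ((differentiableAt_inv h0).mul
    (differentiable_Gammaℝ_inv s))

lemma zetaMulSubOne_ne_zero (hRH : RiemannHypothesis) {s : ℂ} (hs : 1 / 2 < s.re) :
    zetaMulSubOne s ≠ 0 := by
  by_cases h1 : s = 1
  · rw [h1, zetaMulSubOne_one]; exact one_ne_zero
  rw [zetaMulSubOne_eq (by linarith) h1]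
  refine mul_ne_zero (sub_ne_zero.2 h1) fun h => ?_
  have := hRH s h ?_ h1
  · linarith
  · rintro ⟨n, rfl⟩
    have : (0 : ℝ) ≤ n := n.cast_nonneg
    simp at hs
    linarith

lemma zetaMulSubOne_conj {s : ℂ} (hs : 0 < s.re) :
    zetaMulSubOne ((starRingEnd ℂ) s) = (starRingEnd ℂ) (zetaMulSubOne s) := by
  by_cases h1 : s = 1
  · simp [h1, zetaMulSubOne_one]
  rw [zetaMulSubOne_eq hs h1, zetaMulSubOne_eq (by simpa) ((map_ne_one_iff _ (starRingEnd ℂ).injective).mpr h1),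
    riemannZeta_conj]
  simp

lemma riemannXi_eq {s : ℂ} (hs : 0 < s.re) :
    riemannXi s = zetaMulSubOne s * (s * Gammaℝ s) := by
  have h0 : s ≠ 0 := fun h => by simp [h] at hs
  have hG := Gammaℝ_ne_zero_of_re_pos hs
  rw [zetaMulSubOne]
  field_simp

lemma Gammaℝ_conj (s : ℂ) : Gammaℝ ((starRingEnd ℂ) s) = (starRingEnd ℂ) (Gammaℝ s) := by
  have h : (starRingEnd ℂ) s / 2 = (starRingEnd ℂ) (s / 2) := by
    rw [map_div₀, Complex.conj_ofNat]
  have h' : -(starRingEnd ℂ) s / 2 = (starRingEnd ℂ) (-s / 2) := by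
    rw [map_div₀, map_neg, Complex.conj_ofNat]
  rw [Gammaℝ, Gammaℝ, h, h', Gamma_conj, map_mul, cpow_conj]
  · simp
  · rw [arg_ofReal_of_nonneg Real.pi_pos.le]; exact Real.pi_pos.ne

lemma norm_riemannXi_conj {s : ℂ} (hs : 0 < s.re) :
    ‖riemannXi ((starRingEnd ℂ) s)‖ = ‖riemannXi s‖ := by
  rw [riemannXi_eq hs, riemannXi_eq (by simpa), zetaMulSubOne_conj hs, Gammaℝ_conj, ← map_mul,
    ← map_mul, RCLike.norm_conj]

lemma exists_norm_riemannZeta_inv_le :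
    ∃ C > 0, ∀ s : ℂ, 2 ≤ s.re → ‖riemannZeta s‖⁻¹ ≤ C := by
  have hsum : Summable fun n : ℕ => 1 / (n : ℝ) ^ 2 := Real.summable_one_div_nat_pow.2 (by norm_num)
  refine ⟨∑' n : ℕ, 1 / (n : ℝ) ^ 2 + 1, ?_, fun s hs => ?_⟩
  · have : 0 ≤ ∑' n : ℕ, 1 / (n : ℝ) ^ 2 := tsum_nonneg fun n => by positivity
    positivity
  have h1 : 1 < s.re := by linarith
  have h2 := ArithmeticFunction.LSeries_zeta_mul_Lseries_moebius h1
  rw [ArithmeticFunction.LSeries_zeta_eq_riemannZeta h1] at h2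
  rw [← norm_inv, inv_eq_of_mul_eq_one_right h2, LSeries]
  refine (tsum_of_norm_bounded hsum.hasSum fun n => ?_).trans (by linarith)
  rw [LSeries.norm_term_eq]
  split_ifs with h
  · positivity
  · have hn : (1 : ℝ) ≤ n := by exact_mod_cast Nat.pos_of_ne_zero h
    refine div_le_div₀ zero_le_one ?_ (by positivity) ?_
    · have := ArithmeticFunction.abs_moebius_le_one (n := n)
      rw [Complex.norm_intCast]
      exact_mod_cast this
    · rw [← Real.rpow_natCast]
      exact Real.rpow_le_rpow_of_exponent_le hn (by simpa using hs)

lemma exists_norm_zetaMulSubOne_inv_le :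
    ∃ C > 0, ∀ s : ℂ, 2 ≤ s.re → ‖zetaMulSubOne s‖⁻¹ ≤ C := by
  obtain ⟨C, hC, h⟩ := exists_norm_riemannZeta_inv_le
  refine ⟨C, hC, fun s hs => ?_⟩
  have h1 : s ≠ 1 := fun h => by norm_num [h] at hs
  rw [zetaMulSubOne_eq (by linarith) h1, norm_mul, mul_inv]
  have h3 : 1 ≤ ‖s - 1‖ := by
    refine le_trans ?_ (Complex.abs_re_le_norm _)
    simp only [sub_re, one_re]
    rw [abs_of_nonneg] <;> linarith
  calc _ ≤ 1 * ‖riemannZeta s‖⁻¹ := by gcongr; exact inv_le_one_of_one_le₀ h3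
    _ ≤ C := by rw [one_mul]; exact h s hs

/-- The function `-ζ'/ζ(s) - 1/(s - 1)`, regular at `s = 1`. -/
noncomputable def negZetaLogDeriv (s : ℂ) : ℂ := -(deriv zetaMulSubOne s / zetaMulSubOne s)

lemma negZetaLogDeriv_eq {s : ℂ} (hs : 1 < s.re) :
    negZetaLogDeriv s =
      LSeries (fun n => (ArithmeticFunction.vonMangoldt n : ℂ)) s - 1 / (s - 1) := by
  have h1 : s ≠ 1 := fun h => by norm_num [h] at hs
  have h2 : zetaMulSubOne =ᶠ[nhds s] fun s => (s - 1) * riemannZeta s := by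
    filter_upwards [(isOpen_lt continuous_const continuous_re).mem_nhds hs] with w (hw : 1 < w.re)
    exact zetaMulSubOne_eq (by linarith) fun h => by norm_num [h] at hw
  have h3 : HasDerivAt (fun s => (s - 1) * riemannZeta s)
      (1 * riemannZeta s + (s - 1) * deriv riemannZeta s) s :=
    ((hasDerivAt_id s).sub_const 1).mul (differentiableAt_riemannZeta h1).hasDerivAt
  have h4 : riemannZeta s ≠ 0 := riemannZeta_ne_zero_of_one_lt_re hs
  have h5 : s - 1 ≠ 0 := sub_ne_zero.2 h1
  rw [negZetaLogDeriv, h2.deriv_eq, h3.deriv, h2.eq_of_nhds,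
    ArithmeticFunction.LSeries_vonMangoldt_eq_deriv_riemannZeta_div hs]
  field_simp
  ring

lemma exists_norm_negZetaLogDeriv_le_of_two_le :
    ∃ C > 0, ∀ s : ℂ, 2 ≤ s.re → ‖negZetaLogDeriv s‖ ≤ C := by
  set g : ℕ → ℂ := fun n => (ArithmeticFunction.vonMangoldt n : ℂ) with hg
  have hsum : Summable fun n => ‖LSeries.term g 2 n‖ :=
    (ArithmeticFunction.LSeriesSummable_vonMangoldt (s := 2) (by norm_num)).norm
  refine ⟨∑' n, ‖LSeries.term g 2 n‖ + 1, ?_, fun s hs => ?_⟩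
  · have : 0 ≤ ∑' n, ‖LSeries.term g 2 n‖ := tsum_nonneg fun n => by positivity
    positivity
  rw [negZetaLogDeriv_eq (by linarith)]
  refine (norm_sub_le _ _).trans (add_le_add ?_ ?_)
  · exact tsum_of_norm_bounded hsum.hasSum fun n =>
      LSeries.norm_term_le_of_re_le_re _ (by simpa using hs) n
  · have h3 : 1 ≤ ‖s - 1‖ := by
      refine le_trans ?_ (Complex.abs_re_le_norm _)
      simp only [sub_re, one_re]
      rw [abs_of_nonneg] <;> linarith
    rw [norm_div, norm_one, one_div]
    exact inv_le_one_of_one_le₀ h3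

/-- Crude growth of `(s - 1) ζ(s)` in vertical strips. -/
lemma exists_norm_zetaMulSubOne_le :
    ∃ C > 0, ∀ s : ℂ, 1 / 4 ≤ s.re → s.re ≤ 10 →
      ‖zetaMulSubOne s‖ ≤ Real.exp (C * (1 + |s.im|)) := by
  obtain ⟨M, hM, hΛ⟩ := exists_norm_completedRiemannZeta₀_le (1 / 4) 10
  obtain ⟨C, hC, hΓ⟩ := exists_abs_log_norm_Gamma_sub_le (a₀ := 1 / 8) (a₁ := 5)
    (by norm_num) (by norm_num) (by norm_num)
  refine ⟨240 * M + 100 + C, by positivity, fun s hs hs' => ?_⟩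
  have hsn : ‖s‖ ≤ 10 + |s.im| := (Complex.norm_le_abs_re_add_abs_im s).trans (by
    rw [abs_of_nonneg (by linarith)]; linarith)
  have hs1 : ‖s - 1‖ ≤ 11 + |s.im| := (norm_sub_le _ _).trans (by rw [norm_one]; linarith)
  have ht := abs_nonneg s.im
  have hX : ‖riemannXi s‖ ≤ Real.exp ((240 * M + 10) * (1 + |s.im|)) := by
    have h1 : ‖riemannXi s‖ ≤ (10 + |s.im|) * (11 + |s.im|) * M + 1 := by
      unfold riemannXi
      refine (norm_add_le _ _).trans ?_
      rw [norm_mul, norm_mul, norm_one]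
      gcongr
      exact hΛ s hs hs'
    have h2 : (10 + |s.im|) * (11 + |s.im|) ≤ 120 * (1 + |s.im|) ^ 2 := by nlinarith
    have h3 : (1 + |s.im|) ^ 2 ≤ Real.exp (2 * (1 + |s.im|)) := by
      rw [mul_comm, Real.exp_mul]
      norm_cast
      exact pow_le_pow_left₀ (by positivity) (by linarith [Real.add_one_le_exp (1 + |s.im|)]) 2
    have h4 : 120 * M + 1 ≤ Real.exp (120 * M) := by linarith [Real.add_one_le_exp (120 * M)]
    calc ‖riemannXi s‖ ≤ (10 + |s.im|) * (11 + |s.im|) * M + 1 := h1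
      _ ≤ 120 * (1 + |s.im|) ^ 2 * M + (1 + |s.im|) ^ 2 := by
        gcongr; nlinarith
      _ = (120 * M + 1) * (1 + |s.im|) ^ 2 := by ring
      _ ≤ Real.exp (120 * M) * Real.exp (2 * (1 + |s.im|)) := by gcongr
      _ ≤ _ := by
        rw [← Real.exp_add]
        apply Real.exp_le_exp.2
        nlinarith [mul_nonneg hM.le ht]
  have hs0 : s ≠ 0 := fun h => by norm_num [h] at hs
  have hsi : ‖s⁻¹‖ ≤ Real.exp 3 := by
    have h1 : 1 / 4 ≤ ‖s‖ := by
      refine le_trans ?_ (Complex.abs_re_le_norm s)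
      rw [abs_of_nonneg] <;> linarith
    rw [norm_inv]
    calc ‖s‖⁻¹ ≤ (1 / 4)⁻¹ := inv_anti₀ (by norm_num) h1
      _ ≤ _ := by linarith [Real.add_one_le_exp 3]
  have hG : ‖(Gammaℝ s)⁻¹‖ ≤ Real.exp ((80 + C) * (1 + |s.im|)) := by
    have h0 : 0 < ‖Gamma (s / 2)‖ := norm_pos_iff.2 (Gamma_ne_zero_of_re_pos (by simp; linarith))
    have h1 := hΓ (s / 2) (by simp; linarith) (by simp; linarith)
    have hre : (s / 2).re = s.re / 2 := by simp
    have him : (s / 2).im = s.im / 2 := by simp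
    rw [hre, him, abs_div, abs_two] at h1
    rw [norm_inv, Gammaℝ_def, norm_mul, norm_cpow_eq_rpow_re_of_pos Real.pi_pos,
      Real.rpow_def_of_pos Real.pi_pos, ← Real.exp_log h0, ← Real.exp_add, ← Real.exp_neg]
    apply Real.exp_le_exp.2
    have h2 : (-s / 2).re = -s.re / 2 := by simp
    rw [h2]
    have h3 : Real.log (1 + |s.im| / 2) ≤ |s.im| / 2 := by
      have := Real.log_le_sub_one_of_pos (show 0 < 1 + |s.im| / 2 by positivity)
      linarith
    have h4 : 0 ≤ Real.log (1 + |s.im| / 2) := Real.log_nonneg (by linarith)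
    have h5 : Real.log Real.pi ≤ 3 := by
      have := Real.log_le_sub_one_of_pos Real.pi_pos
      linarith [Real.pi_lt_four]
    have h6 : 0 ≤ Real.log Real.pi := Real.log_nonneg (by linarith [Real.pi_gt_three])
    have h7 := (abs_le.1 h1).1
    have h8 : Real.pi * (|s.im| / 2) ≤ 4 * (|s.im| / 2) := by
      gcongr; exact Real.pi_lt_four.le
    have h9 : Real.log Real.pi * s.re ≤ 3 * 10 := by gcongr
    have h10 : -(s.re / 2 - 1 / 2) * Real.log (1 + |s.im| / 2) ≤ 1 / 2 * (|s.im| / 2) := by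
      nlinarith
    nlinarith [mul_nonneg hC.le ht]
  unfold zetaMulSubOne
  rw [norm_mul, norm_mul]
  calc _ ≤ Real.exp ((240 * M + 10) * (1 + |s.im|)) *
        (Real.exp 3 * Real.exp ((80 + C) * (1 + |s.im|))) := by gcongr
    _ ≤ _ := by
      rw [← Real.exp_add, ← Real.exp_add]
      apply Real.exp_le_exp.2
      nlinarith

/-- Comparison of `(s - 1) ζ(s)` at points symmetric about the critical line. -/
lemma exists_norm_zetaMulSubOne_sub_le_of_re_eq_half :
    ∃ C > 0, ∀ h : ℝ, 0 < h → h ≤ 1 / 8 → ∀ s : ℂ, s.re = 1 / 2 →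
      ‖zetaMulSubOne (s - h)‖ ≤
        Real.exp (h * (C + Real.log (1 + |s.im|))) * ‖zetaMulSubOne (s + h)‖ := by
  obtain ⟨C, hC, hΓ⟩ := exists_abs_log_norm_Gamma_add_sub_le (a₀ := 1 / 8) (a₁ := 5)
    (by norm_num)
  refine ⟨C + 6, by positivity, fun h hh hh' s hs => ?_⟩
  have hr1 : (s - h).re = 1 / 2 - h := by simp [hs]
  have hr2 : (s + h).re = 1 / 2 + h := by simp [hs]
  have hi1 : (s - h).im = s.im := by simp
  have e1 : 1 - (s - h) = (starRingEnd ℂ) (s + h) := by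
    apply Complex.ext <;> simp [hs]; ring
  have e2 : ‖riemannXi (s - h)‖ = ‖riemannXi (s + h)‖ := by
    rw [← riemannXi_one_sub, e1, norm_riemannXi_conj (by rw [hr2]; linarith)]
  have hn1 : s - h ≠ 0 := fun h0 => by rw [h0] at hr1; simp at hr1; linarith
  have hG1 : Gammaℝ (s - h) ≠ 0 := Gammaℝ_ne_zero_of_re_pos (by rw [hr1]; linarith)
  have hN : ‖s + h‖ ≤ Real.exp (6 * h) * ‖s - h‖ := by
    have h1 : 1 / 3 ≤ ‖s - h‖ := by
      refine le_trans ?_ (Complex.abs_re_le_norm _)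
      rw [hr1, abs_of_nonneg] <;> linarith
    have h2 : ‖s + h‖ ≤ ‖s - h‖ + 2 * h := by
      have : s + h = (s - h) + ((2 * h : ℝ) : ℂ) := by push_cast; ring
      rw [this]
      refine (norm_add_le _ _).trans (le_of_eq ?_)
      rw [Complex.norm_real, Real.norm_of_nonneg (by linarith)]
    have h3 := Real.add_one_le_exp (6 * h)
    nlinarith
  have hG : ‖Gammaℝ (s + h)‖ ≤
      Real.exp (h * (C + Real.log (1 + |s.im|))) * ‖Gammaℝ (s - h)‖ := by
    have hre : ((s - h) / 2).re = (1 / 2 - h) / 2 := by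
      rw [← hr1]; simp
    have him : ((s - h) / 2).im = s.im / 2 := by simp
    have h1 := hΓ ((s - h) / 2) h hh.le (by rw [hre]; linarith) (by rw [hre]; linarith)
    have e3 : (s - h) / 2 + h = (s + h) / 2 := by ring
    have hp1 : 0 < ‖Gamma ((s - h) / 2)‖ :=
      norm_pos_iff.2 (Gamma_ne_zero_of_re_pos (by rw [hre]; linarith))
    have hp2 : 0 < ‖Gamma ((s + h) / 2)‖ :=
      norm_pos_iff.2 (Gamma_ne_zero_of_re_pos (by simp [hs]; linarith))
    rw [e3, him, abs_div, abs_two] at h1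
    rw [Gammaℝ_def, Gammaℝ_def, norm_mul, norm_mul, norm_cpow_eq_rpow_re_of_pos Real.pi_pos,
      norm_cpow_eq_rpow_re_of_pos Real.pi_pos, mul_left_comm]
    have e4 : (-(s + h) / 2).re ≤ (-(s - h) / 2).re := by simp; linarith
    have hlog : Real.log (1 + |s.im| / 2) ≤ Real.log (1 + |s.im|) :=
      Real.log_le_log (by positivity) (by linarith [abs_nonneg s.im])
    gcongr
    · exact (by linarith [Real.pi_gt_three] : (1 : ℝ) ≤ Real.pi)
    · rw [← Real.exp_log hp1, ← Real.exp_log hp2, ← Real.exp_add]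
      apply Real.exp_le_exp.2
      have := (abs_le.1 h1).2
      nlinarith
  rw [zetaMulSubOne, norm_mul, e2, riemannXi_eq (by rw [hr2]; linarith), norm_mul, norm_mul,
    norm_mul, norm_inv, norm_inv]
  have hp1 : 0 < ‖s - h‖ := norm_pos_iff.2 hn1
  have hp2 : 0 < ‖Gammaℝ (s - h)‖ := norm_pos_iff.2 hG1
  calc ‖zetaMulSubOne (s + h)‖ * (‖s + h‖ * ‖Gammaℝ (s + h)‖) *
        (‖s - h‖⁻¹ * ‖Gammaℝ (s - h)‖⁻¹)
      ≤ ‖zetaMulSubOne (s + h)‖ * ((Real.exp (6 * h) * ‖s - h‖) *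
        (Real.exp (h * (C + Real.log (1 + |s.im|))) * ‖Gammaℝ (s - h)‖)) *
        (‖s - h‖⁻¹ * ‖Gammaℝ (s - h)‖⁻¹) := by gcongr
    _ = Real.exp (6 * h) * Real.exp (h * (C + Real.log (1 + |s.im|))) *
        ‖zetaMulSubOne (s + h)‖ := by field_simp
    _ = _ := by rw [← Real.exp_add]; congr 2; ring

lemma differentiableOn_log_of_ball {F : ℂ → ℂ} {c : ℂ} {R : ℝ} (hR : 0 < R)
    (hF : DifferentiableOn ℂ F (Metric.ball c R)) (h0 : ∀ w ∈ Metric.ball c R, F w ≠ 0) :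
    ∃ g : ℂ → ℂ, g c = 0 ∧ (∀ w ∈ Metric.ball c R, HasDerivAt g (deriv F w / F w) w) ∧
      ∀ w ∈ Metric.ball c R, F w = F c * exp (g w) := by
  have hd : ∀ w ∈ Metric.ball c R, HasDerivAt F (deriv F w) w := fun w hw =>
    (hF.differentiableAt (Metric.isOpen_ball.mem_nhds hw)).hasDerivAt
  have h1 : DifferentiableOn ℂ (fun w => deriv F w / F w) (Metric.ball c R) :=
    (hF.deriv Metric.isOpen_ball).div hF h0
  obtain ⟨g₀, hg₀⟩ := h1.isExactOn_ball
  refine ⟨fun w => g₀ w - g₀ c, sub_self _, fun w hw => (hg₀ w hw).sub_const _, ?_⟩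
  have hc : c ∈ Metric.ball c R := Metric.mem_ball_self hR
  have hk : ∀ w ∈ Metric.ball c R, HasDerivAt (fun w => F w * exp (-(g₀ w - g₀ c))) 0 w := by
    intro w hw
    convert! (hd w hw).mul ((hg₀ w hw).sub_const (g₀ c)).neg.cexp using 1
    have := h0 w hw
    field_simp
    ring
  intro w hw
  have h2 := Metric.isOpen_ball.is_const_of_deriv_eq_zero
    (convex_ball c R).isPreconnected
    (fun w hw => (hk w hw).differentiableAt.differentiableWithinAt)
    (fun w hw => (hk w hw).deriv) hw hc
  simp only [sub_self, neg_zero, exp_zero, mul_one] at h2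
  rw [← h2, mul_assoc, ← exp_add]
  simp

/-- Lower bound for `(s - 1) ζ(s)` and bound for its logarithmic derivative, both crude. -/
lemma exists_crude_bounds (hRH : RiemannHypothesis) {c : ℝ} (hc : 1 / 2 < c) (hc1 : c ≤ 1) :
    ∃ K > 0, ∀ w : ℂ, c ≤ w.re → w.re ≤ 4 →
      ‖zetaMulSubOne w‖⁻¹ ≤ Real.exp (K * (1 + |w.im|)) ∧
      ‖negZetaLogDeriv w‖ ≤ K * (1 + |w.im|) := by
  obtain ⟨A, hA, hup⟩ := exists_norm_zetaMulSubOne_le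
  obtain ⟨B, hB, hlow⟩ := exists_norm_zetaMulSubOne_inv_le
  set ε := c - 1 / 2 with hε
  have hε0 : 0 < ε := by linarith
  have hε1 : ε ≤ 1 / 2 := by linarith
  set D := 2 * (6 * A + B) * (7 / 2) / (ε / 2) with hD
  have hD0 : 0 < D := by positivity
  refine ⟨B + D + D / (ε / 2), by positivity, fun w hw hw4 => ?_⟩
  set t := w.im with ht
  have ht0 := abs_nonneg t
  set c0 : ℂ := 4 + t * I with hc0
  have hc0re : c0.re = 4 := by simp [hc0]
  have hc0im : c0.im = t := by simp [hc0]
  have hmem : ∀ u ∈ Metric.ball c0 (7 / 2), 1 / 2 < u.re ∧ u.re ≤ 8 ∧ |u.im| ≤ |t| + 4 := by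
    intro u hu
    rw [Metric.mem_ball, dist_eq] at hu
    have h1 := (Complex.abs_re_le_norm (u - c0)).trans_lt hu
    have h2 := (Complex.abs_im_le_norm (u - c0)).trans_lt hu
    rw [sub_re, hc0re, abs_lt] at h1
    rw [sub_im, hc0im] at h2
    refine ⟨by linarith, by linarith, ?_⟩
    have := abs_sub_abs_le_abs_sub u.im t
    linarith
  have hZd : DifferentiableOn ℂ zetaMulSubOne (Metric.ball c0 (7 / 2)) := fun u hu =>
    (differentiableAt_zetaMulSubOne (by linarith [(hmem u hu).1])).differentiableWithinAt
  have hZ0 : ∀ u ∈ Metric.ball c0 (7 / 2), zetaMulSubOne u ≠ 0 := fun u hu =>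
    zetaMulSubOne_ne_zero hRH (hmem u hu).1
  obtain ⟨g, hg0, hgd, hg⟩ := differentiableOn_log_of_ball (by norm_num) hZd hZ0
  have hc0Z : zetaMulSubOne c0 ≠ 0 := hZ0 c0 (Metric.mem_ball_self (by norm_num))
  have hc0n : 0 < ‖zetaMulSubOne c0‖ := norm_pos_iff.2 hc0Z
  have hlow0 : ‖zetaMulSubOne c0‖⁻¹ ≤ Real.exp B :=
    (hlow c0 (by rw [hc0re]; norm_num)).trans (by linarith [Real.add_one_le_exp B])
  set M := (6 * A + B) * (1 + |t|) with hM
  have hM0 : 0 < M := by positivity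
  have hre : ∀ u ∈ Metric.ball c0 (7 / 2), (g u).re ≤ M := by
    intro u hu
    have h1 := congrArg norm (hg u hu)
    rw [norm_mul, norm_exp] at h1
    have h2 := hmem u hu
    have h3 := hup u (by linarith) (by linarith)
    rw [← Real.exp_le_exp]
    have h4 : Real.exp (g u).re = ‖zetaMulSubOne c0‖⁻¹ * ‖zetaMulSubOne u‖ := by
      rw [h1]; field_simp
    rw [h4]
    calc _ ≤ Real.exp B * Real.exp (A * (1 + |u.im|)) := by gcongr
      _ ≤ _ := by
        rw [← Real.exp_add]
        apply Real.exp_le_exp.2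
        nlinarith [mul_le_mul_of_nonneg_left h2.2.2 hA.le, mul_nonneg hA.le ht0,
          mul_nonneg hB.le ht0]
  have hgb : ∀ u, dist u c0 ≤ 7 / 2 - ε / 2 → ‖g u‖ ≤ D * (1 + |t|) := by
    intro u hu
    have hball : ∀ v ∈ Metric.ball (0 : ℂ) (7 / 2), c0 + v ∈ Metric.ball c0 (7 / 2) := by
      intro v hv; simpa [dist_eq] using hv
    have hu' : u - c0 ∈ Metric.ball (0 : ℂ) (7 / 2) := by
      rw [Metric.mem_ball, dist_zero_right, ← dist_eq]; linarith
    have h1 := borelCaratheodory_zero (f := fun v => g (c0 + v)) hM0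
      (fun v hv => (((hgd _ (hball v hv)).comp_const_add c0 v).differentiableAt
        ).differentiableWithinAt)
      (fun v hv => hre _ (hball v hv)) (by norm_num) hu' (by simpa using hg0)
    simp only [add_sub_cancel] at h1
    rw [← dist_eq] at h1
    refine h1.trans ?_
    have h2 : dist u c0 ≤ 7 / 2 := by linarith
    have h3 : ε / 2 ≤ 7 / 2 - dist u c0 := by linarith
    calc 2 * M * dist u c0 / (7 / 2 - dist u c0) ≤ 2 * M * (7 / 2) / (ε / 2) := by
          gcongr
      _ = D * (1 + |t|) := by rw [hD, hM]; ring
  have hwc : dist w c0 ≤ 7 / 2 - ε := by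
    rw [dist_eq]
    have : w - c0 = ((w.re - 4 : ℝ) : ℂ) := by
      apply Complex.ext <;> simp [hc0, ht]
    rw [this, Complex.norm_real, Real.norm_eq_abs, abs_le]
    constructor <;> linarith
  have hwb : w ∈ Metric.ball c0 (7 / 2) := by rw [Metric.mem_ball]; linarith
  have hDt : 0 ≤ D * |t| := by positivity
  have hBt : 0 ≤ B * |t| := by positivity
  have hDε : 0 ≤ D / (ε / 2) * (1 + |t|) := by positivity
  constructor
  · have h1 := hgb w (by linarith)
    rw [hg w hwb, norm_mul, mul_inv, norm_exp, ← Real.exp_neg]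
    calc _ ≤ Real.exp B * Real.exp (D * (1 + |t|)) := by
          gcongr
          linarith [abs_le.1 ((Complex.abs_re_le_norm (g w)).trans h1)]
      _ ≤ _ := by
        rw [← Real.exp_add]
        apply Real.exp_le_exp.2
        nlinarith
  · rw [negZetaLogDeriv, norm_neg, ← (hgd w hwb).deriv]
    have hsub : ∀ v, dist v w ≤ ε / 2 → dist v c0 ≤ 7 / 2 - ε / 2 := fun v hv =>
      (dist_triangle v w c0).trans (by linarith)
    have h1 := norm_deriv_le_of_forall_mem_sphere_norm_le (f := g) (c := w) (R := ε / 2)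
      (C := D * (1 + |t|)) (by positivity) ?_ ?_
    · refine h1.trans ?_
      rw [mul_div_right_comm]
      nlinarith
    · refine DifferentiableOn.diffContOnCl_ball (U := Metric.ball c0 (7 / 2)) (fun v hv =>
        (hgd v hv).differentiableAt.differentiableWithinAt) fun v hv => ?_
      rw [Metric.mem_closedBall] at hv
      rw [Metric.mem_ball]
      linarith [hsub v hv]
    · intro v hv
      exact hgb v (hsub v (by rw [Metric.mem_sphere] at hv; exact hv.le))

lemma norm_zetaMulSubOne_sub_le (hRH : RiemannHypothesis) :
    ∃ C > 0, ∀ h : ℝ, 0 < h → h ≤ 1 / 8 → ∀ s : ℂ, 1 / 2 ≤ s.re → s.re ≤ 3 →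
      ‖zetaMulSubOne (s - h)‖ ≤ Real.exp (h * (C + Real.log ‖s + 1‖)) * ‖zetaMulSubOne (s + h)‖ := by
  obtain ⟨A, hA, hup⟩ := exists_norm_zetaMulSubOne_le
  obtain ⟨C₁, hC₁, hhalf⟩ := exists_norm_zetaMulSubOne_sub_le_of_re_eq_half
  obtain ⟨M, hM, hf⟩ := exists_norm_negZetaLogDeriv_le_of_two_le
  refine ⟨C₁ + 1 + 2 * M, by positivity, fun h hh hh8 s hs hs3 => ?_⟩
  have hre1 : ∀ w : ℂ, (w - h).re = w.re - h := by simp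
  have hre2 : ∀ w : ℂ, (w + h).re = w.re + h := by simp
  have hne1 : ∀ w : ℂ, 1 / 2 ≤ w.re → 3 / 2 ≤ ‖w + 1‖ := fun w hw => by
    refine le_trans ?_ (Complex.abs_re_le_norm _)
    simp only [add_re, one_re]
    rw [abs_of_nonneg] <;> linarith
  have hZ0 : ∀ w : ℂ, 1 / 2 ≤ w.re → zetaMulSubOne (w + h) ≠ 0 := fun w hw =>
    zetaMulSubOne_ne_zero hRH (by rw [hre2]; linarith)
  set Q : ℂ → ℂ := fun w => zetaMulSubOne (w - h) / zetaMulSubOne (w + h) * (w + 1) ^ (((-h : ℝ)) : ℂ)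
    with hQ
  have hQn : ∀ w : ℂ, ‖Q w‖ =
      ‖zetaMulSubOne (w - h)‖ * ‖zetaMulSubOne (w + h)‖⁻¹ * ‖w + 1‖ ^ (-h) := fun w => by
    rw [hQ]; simp only; rw [norm_mul, norm_div, norm_cpow_real, div_eq_mul_inv]
  have hQd : ∀ w : ℂ, 1 / 2 ≤ w.re → DifferentiableAt ℂ Q w := by
    intro w hw
    have d1 : DifferentiableAt ℂ (fun w : ℂ => zetaMulSubOne (w - h)) w :=
      ((differentiableAt_zetaMulSubOne (by rw [hre1]; linarith)).hasDerivAt.comp_sub_const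
        w (h : ℂ)).differentiableAt
    have d2 : DifferentiableAt ℂ (fun w : ℂ => zetaMulSubOne (w + h)) w :=
      ((differentiableAt_zetaMulSubOne (by rw [hre2]; linarith)).hasDerivAt.comp_add_const
        w (h : ℂ)).differentiableAt
    have d3 : DifferentiableAt ℂ (fun w : ℂ => (w + 1) ^ (((-h : ℝ)) : ℂ)) w := by
      refine DifferentiableAt.cpow_const (by fun_prop) (Or.inl ?_)
      simp only [add_re, one_re]
      linarith
    exact (d1.fun_div d2 (hZ0 w hw)).fun_mul d3
  have hle1 : ∀ w : ℂ, 1 / 2 ≤ w.re → ‖w + 1‖ ^ (-h) ≤ 1 := fun w hw =>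
    Real.rpow_le_one_of_one_le_of_nonpos (by linarith [hne1 w hw]) (by linarith)
  have hbound : ‖Q s‖ ≤ Real.exp (h * (C₁ + 1 + 2 * M)) := by
    refine PhragmenLindelof.vertical_strip (a := 1 / 2) (b := 3) ?_ ?_ ?_ ?_ hs hs3
    · have : DifferentiableOn ℂ Q (re ⁻¹' Set.Icc (1 / 2) 3) := fun w hw =>
        (hQd w hw.1).differentiableWithinAt
      refine DifferentiableOn.diffContOnCl (this.mono ?_)
      refine closure_minimal (fun w hw => ⟨hw.1.le, hw.2.le⟩) (isClosed_Icc.preimage continuous_re)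
    · obtain ⟨K, hK, hcr⟩ := exists_crude_bounds hRH (c := 1 / 2 + h) (by linarith) (by linarith)
      refine ⟨1, ?_, A + K, ?_⟩
      · rw [lt_div_iff₀ (by norm_num)]; linarith [Real.pi_gt_three]
      · refine Asymptotics.IsBigO.of_bound 1 (Filter.mem_inf_of_right ?_)
        rintro w ⟨hw1, hw2⟩
        simp only [Set.mem_ofPred_eq, one_mul]
        have h1 := hup (w - h) (by rw [hre1]; linarith) (by rw [hre1]; linarith)
        have h2 := (hcr (w + h) (by rw [hre2]; linarith) (by rw [hre2]; linarith)).1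
        have i1 : (w - h).im = w.im := by simp
        have i2 : (w + h).im = w.im := by simp
        rw [i1] at h1
        rw [i2] at h2
        rw [hQn, Real.norm_of_nonneg (Real.exp_pos _).le]
        calc _ ≤ Real.exp (A * (1 + |w.im|)) * Real.exp (K * (1 + |w.im|)) * 1 := by
              gcongr; exact hle1 w hw1.le
          _ ≤ _ := by
            rw [mul_one, ← Real.exp_add, ← add_mul]
            apply Real.exp_le_exp.2
            gcongr
            linarith [Real.add_one_le_exp |w.im|]
    · intro w hw
      have h1 := hhalf h hh hh8 w hw
      have h2 : 0 < ‖zetaMulSubOne (w + h)‖ := norm_pos_iff.2 (hZ0 w hw.ge)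
      have h3 := hne1 w hw.ge
      rw [hQn, Real.rpow_def_of_pos (by linarith)]
      have h4 : Real.log (1 + |w.im|) ≤ 1 + Real.log ‖w + 1‖ := by
        have h5 : 1 + |w.im| ≤ 2 * ‖w + 1‖ := by
          have := Complex.abs_im_le_norm (w + 1)
          simp at this
          linarith
        have := Real.log_le_log (by positivity) h5
        rw [Real.log_mul (by norm_num) (by positivity)] at this
        linarith [Real.log_two_lt_d9]
      calc _ ≤ Real.exp (h * (C₁ + Real.log (1 + |w.im|))) * ‖zetaMulSubOne (w + h)‖ *
            ‖zetaMulSubOne (w + h)‖⁻¹ * Real.exp (Real.log ‖w + 1‖ * -h) := by gcongr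
        _ = Real.exp (h * (C₁ + Real.log (1 + |w.im|)) + Real.log ‖w + 1‖ * -h) := by
          rw [mul_inv_cancel_right₀ h2.ne', Real.exp_add]
        _ ≤ _ := by
          apply Real.exp_le_exp.2
          nlinarith [mul_pos hh hM]
    · intro w hw
      have hball : ∀ u ∈ Metric.ball (w + h) (1 / 2 : ℝ), 2 ≤ u.re := by
        intro u hu
        rw [Metric.mem_ball, dist_eq] at hu
        have := (abs_le.1 ((Complex.abs_re_le_norm _).trans hu.le)).1
        rw [sub_re, hre2, hw] at this
        linarith
      obtain ⟨g, hg0, hgd, hg⟩ := differentiableOn_log_of_ball (F := zetaMulSubOne)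
        (c := w + h) (R := 1 / 2) (by norm_num)
        (fun u hu => (differentiableAt_zetaMulSubOne
          (by linarith [hball u hu])).differentiableWithinAt)
        (fun u hu => zetaMulSubOne_ne_zero hRH (by linarith [hball u hu]))
      have hm1 : w + h ∈ Metric.ball (w + h) (1 / 2 : ℝ) := Metric.mem_ball_self (by norm_num)
      have hd : (w - h) - (w + h) = ((-(2 * h) : ℝ) : ℂ) := by push_cast; ring
      have hdn : ‖(w - h) - (w + h)‖ = 2 * h := by
        rw [hd, Complex.norm_real, norm_neg, Real.norm_of_nonneg (by linarith)]
      have hm2 : w - h ∈ Metric.ball (w + h) (1 / 2 : ℝ) := by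
        rw [Metric.mem_ball, dist_eq, hdn]; linarith
      have h1 := (convex_ball (w + h) (1 / 2 : ℝ)).norm_image_sub_le_of_norm_hasDerivWithin_le
        (fun u hu => (hgd u hu).hasDerivWithinAt) (C := M)
        (fun u hu => by simpa [negZetaLogDeriv] using hf u (hball u hu)) hm1 hm2
      rw [hg0, sub_zero, hdn] at h1
      have h2 : 0 < ‖zetaMulSubOne (w + h)‖ := norm_pos_iff.2 (hZ0 w (by linarith))
      rw [hQn, hg _ hm2, norm_mul, norm_exp]
      calc _ ≤ ‖zetaMulSubOne (w + h)‖ * Real.exp (M * (2 * h)) * ‖zetaMulSubOne (w + h)‖⁻¹ * 1 := by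
            gcongr
            · exact (Complex.re_le_norm _).trans h1
            · exact hle1 w (by linarith)
        _ = Real.exp (M * (2 * h)) := by field_simp
        _ ≤ _ := by
          apply Real.exp_le_exp.2
          nlinarith [mul_pos hh hM, mul_pos hh hC₁]
  have h2 : 0 < ‖zetaMulSubOne (s + h)‖ := norm_pos_iff.2 (hZ0 s hs)
  have h3 : 0 < ‖s + 1‖ := by linarith [hne1 s hs]
  rw [hQn, Real.rpow_def_of_pos h3] at hbound
  have h4 : ‖zetaMulSubOne (s - h)‖ = ‖zetaMulSubOne (s - h)‖ * ‖zetaMulSubOne (s + h)‖⁻¹ *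
      Real.exp (Real.log ‖s + 1‖ * -h) * (Real.exp (h * Real.log ‖s + 1‖) *
        ‖zetaMulSubOne (s + h)‖) := by
    rw [mul_assoc, ← mul_assoc (Real.exp _) (Real.exp _), ← Real.exp_add]
    rw [show Real.log ‖s + 1‖ * -h + h * Real.log ‖s + 1‖ = 0 by ring, Real.exp_zero]
    field_simp
  rw [h4]
  calc _ ≤ Real.exp (h * (C₁ + 1 + 2 * M)) * (Real.exp (h * Real.log ‖s + 1‖) *
        ‖zetaMulSubOne (s + h)‖) := by gcongr
    _ = _ := by rw [← mul_assoc, ← Real.exp_add]; congr 2; ring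

/-- On RH, `Re (-ζ'/ζ(s) - 1/(s-1))` is bounded above, uniformly up to the critical line. -/
lemma exists_re_negZetaLogDeriv_le (hRH : RiemannHypothesis) :
    ∃ C > 0, ∀ s : ℂ, 1 / 2 < s.re → s.re ≤ 3 →
      (negZetaLogDeriv s).re ≤ (C + Real.log ‖s + 1‖) / 2 := by
  obtain ⟨C, hC, hle⟩ := norm_zetaMulSubOne_sub_le hRH
  refine ⟨C, hC, fun s hs hs3 => ?_⟩
  set R := s.re - 1 / 2 with hR
  have hR0 : 0 < R := by linarith
  have hball : ∀ u ∈ Metric.ball s R, 1 / 2 < u.re := by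
    intro u hu
    rw [Metric.mem_ball, dist_eq] at hu
    have := (abs_lt.1 ((Complex.abs_re_le_norm _).trans_lt hu)).1
    rw [sub_re] at this
    linarith
  obtain ⟨g, hg0, hgd, hg⟩ := differentiableOn_log_of_ball (F := zetaMulSubOne) hR0
    (fun u hu => (differentiableAt_zetaMulSubOne
      (by linarith [hball u hu])).differentiableWithinAt)
    (fun u hu => zetaMulSubOne_ne_zero hRH (hball u hu))
  have hZs : 0 < ‖zetaMulSubOne s‖ := norm_pos_iff.2 (zetaMulSubOne_ne_zero hRH hs)
  have hs0 := hgd s (Metric.mem_ball_self hR0)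
  have hdc : HasDerivAt (fun x : ℂ => g (s - x) - g (s + x)) (2 * negZetaLogDeriv s) 0 := by
    have h1 : HasDerivAt (fun x : ℂ => g (s - x)) (-(deriv zetaMulSubOne s / zetaMulSubOne s)) 0 := by
      have : HasDerivAt g (deriv zetaMulSubOne s / zetaMulSubOne s) (s - 0) := by simpa using hs0
      exact this.comp_const_sub s 0
    have h2 : HasDerivAt (fun x : ℂ => g (s + x)) (deriv zetaMulSubOne s / zetaMulSubOne s) 0 := by
      have : HasDerivAt g (deriv zetaMulSubOne s / zetaMulSubOne s) (s + 0) := by simpa using hs0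
      exact this.comp_const_add s 0
    convert! h1.sub h2 using 1
    rw [negZetaLogDeriv]; ring
  have hdr := HasDerivAt.real_of_complex (z := 0) (by simpa using hdc)
  have hsl := (hasDerivWithinAt_iff_tendsto_slope' (s := Set.Ioi 0) (by simp)).1
    hdr.hasDerivWithinAt
  have hre : (2 * negZetaLogDeriv s).re = 2 * (negZetaLogDeriv s).re := by simp
  rw [hre] at hsl
  suffices 2 * (negZetaLogDeriv s).re ≤ C + Real.log ‖s + 1‖ by linarith
  refine le_of_tendsto hsl ?_
  filter_upwards [Ioo_mem_nhdsGT (show (0 : ℝ) < min R (1 / 8) by positivity)] with h hh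
  have hh0 : 0 < h := hh.1
  have hhR : h < R := hh.2.trans_le (min_le_left _ _)
  have hh8 : h < 1 / 8 := hh.2.trans_le (min_le_right _ _)
  have hm1 : s - h ∈ Metric.ball s R := by
    rw [Metric.mem_ball, dist_eq, sub_sub_cancel_left, norm_neg, Complex.norm_real,
      Real.norm_of_nonneg hh0.le]
    exact hhR
  have hm2 : s + h ∈ Metric.ball s R := by
    rw [Metric.mem_ball, dist_eq, add_sub_cancel_left, Complex.norm_real,
      Real.norm_of_nonneg hh0.le]
    exact hhR
  have h1 := hle h hh0 hh8.le s hs.le hs3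
  rw [hg _ hm1, hg _ hm2, norm_mul, norm_mul, norm_exp, norm_exp, mul_left_comm,
    mul_le_mul_iff_right₀ hZs, ← Real.exp_add, Real.exp_le_exp] at h1
  rw [slope_def_field]
  simp only [ofReal_zero, sub_zero, add_zero, sub_self, zero_re, sub_re]
  rw [div_le_iff₀ hh0]
  linarith

lemma continuous_vertical_of_differentiableAt {F : ℂ → ℂ} {a : ℝ}
    (hF : ∀ w : ℂ, w.re = a → DifferentiableAt ℂ F w) : Continuous fun t : ℝ => F (a + t * I) := by
  rw [continuous_iff_continuousAt]
  intro t
  exact (hF (a + t * I) (by simp)).continuousAt.comp (f := fun t : ℝ => (a + t * I : ℂ))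
    (by fun_prop)

lemma integrable_of_norm_le_div_one_add_sq {E : Type*} [NormedAddCommGroup E] {g : ℝ → E}
    (hg : AEStronglyMeasurable g) {C : ℝ}
    (hb : ∀ t, ‖g t‖ ≤ C / (1 + t ^ 2)) : Integrable g :=
  Integrable.mono' (integrable_inv_one_add_sq.const_mul C) hg
    (Filter.Eventually.of_forall fun t => (hb t).trans_eq (div_eq_mul_inv _ _))

/-- Shifting a vertical line of integration. -/
lemma integral_vertical_eq {F : ℂ → ℂ} {a b C : ℝ} (hab : a ≤ b)
    (hF : ∀ w : ℂ, a ≤ w.re → w.re ≤ b → DifferentiableAt ℂ F w)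
    (hb : ∀ w : ℂ, a ≤ w.re → w.re ≤ b → ‖F w‖ ≤ C / (1 + w.im ^ 2)) :
    ∫ t : ℝ, F (a + t * I) = ∫ t : ℝ, F (b + t * I) := by
  have hia : Integrable fun t : ℝ => F (a + t * I) :=
    integrable_of_norm_le_div_one_add_sq (continuous_vertical_of_differentiableAt
      fun w hw => hF w hw.ge (hw.le.trans hab)).aestronglyMeasurable
      (fun t => by simpa using hb (a + t * I) (by simp) (by simpa using hab))
  have hib : Integrable fun t : ℝ => F (b + t * I) :=
    integrable_of_norm_le_div_one_add_sq (continuous_vertical_of_differentiableAt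
      fun w hw => hF w (hab.trans hw.ge) hw.le).aestronglyMeasurable
      (fun t => by simpa using hb (b + t * I) (by simpa using hab) (by simp))
  have hT : ∀ T : ℝ, 0 ≤ T → ‖(∫ y in (-T)..T, F (b + y * I)) - ∫ y in (-T)..T, F (a + y * I)‖ ≤
      2 * (C / (1 + T ^ 2) * (b - a)) := by
    intro T hT
    have h1 := Complex.integral_boundary_rect_eq_zero_of_differentiableOn F
      ((a : ℂ) + (-T : ℝ) * I) ((b : ℂ) + (T : ℝ) * I) (fun w hw => by
        rw [mem_reProdIm] at hw
        simp only [add_re, ofReal_re, mul_re, I_re, mul_zero, ofReal_im, I_im, mul_one, sub_self,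
          add_zero, Set.uIcc_of_le hab] at hw
        exact (hF w hw.1.1 hw.1.2).differentiableWithinAt)
    simp only [add_re, ofReal_re, mul_re, I_re, mul_zero, ofReal_im, I_im, mul_one, sub_self,
      add_zero, add_im, mul_im, zero_add] at h1
    have hh : ∀ s : ℝ, s ^ 2 = T ^ 2 → ‖∫ x in a..b, F (x + s * I)‖ ≤ C / (1 + T ^ 2) * (b - a) := by
      intro s hs
      have := intervalIntegral.norm_integral_le_of_norm_le_const (a := a) (b := b)
        (f := fun x : ℝ => F (x + s * I)) (C := C / (1 + T ^ 2)) (fun x hx => by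
          rw [Set.uIoc_of_le hab] at hx
          have := hb (x + s * I) (by simpa using hx.1.le) (by simpa using hx.2)
          simpa [hs] using this)
      rwa [abs_of_nonneg (sub_nonneg.2 hab)] at this
    have h2 : I * ((∫ y in (-T)..T, F (b + y * I)) - ∫ y in (-T)..T, F (a + y * I)) =
        (∫ x in a..b, F (x + T * I)) - ∫ x in a..b, F (x + (-T : ℝ) * I) := by
      simp only [smul_eq_mul] at h1
      linear_combination h1
    have h3 := congrArg norm h2
    rw [norm_mul, norm_I, one_mul] at h3
    rw [h3]
    refine (norm_sub_le _ _).trans ?_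
    rw [two_mul]
    exact add_le_add (hh T rfl) (hh (-T) (by ring))
  have hlim : Filter.Tendsto (fun T : ℝ => (∫ y in (-T)..T, F (b + y * I)) -
      ∫ y in (-T)..T, F (a + y * I)) Filter.atTop
      (nhds ((∫ t : ℝ, F (b + t * I)) - ∫ t : ℝ, F (a + t * I))) :=
    (intervalIntegral_tendsto_integral hib Filter.tendsto_neg_atTop_atBot Filter.tendsto_id).sub
      (intervalIntegral_tendsto_integral hia Filter.tendsto_neg_atTop_atBot Filter.tendsto_id)
  have hz : Filter.Tendsto (fun T : ℝ => 2 * (C / (1 + T ^ 2) * (b - a))) Filter.atTop (nhds 0) := by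
    have h1 : Filter.Tendsto (fun T : ℝ => C / (1 + T ^ 2)) Filter.atTop (nhds 0) :=
      Filter.Tendsto.div_atTop tendsto_const_nhds
        (Filter.tendsto_atTop_add_const_left _ _ (Filter.tendsto_pow_atTop two_ne_zero))
    simpa using (h1.mul_const (b - a)).const_mul 2
  have h0 : Filter.Tendsto (fun T : ℝ => (∫ y in (-T)..T, F (b + y * I)) -
      ∫ y in (-T)..T, F (a + y * I)) Filter.atTop (nhds 0) :=
    squeeze_zero_norm' (by filter_upwards [Filter.eventually_ge_atTop 0] with T h using hT T h) hz
  exact (sub_eq_zero.1 (tendsto_nhds_unique hlim h0)).symm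

/-- A smoothing kernel. -/
noncomputable def smoothKernel (x : ℝ) : ℝ := ((x ^ 2 + 9) ^ 2)⁻¹

lemma smoothKernel_pos (x : ℝ) : 0 < smoothKernel x := by unfold smoothKernel; positivity

lemma smoothKernel_neg (x : ℝ) : smoothKernel (-x) = smoothKernel x := by simp [smoothKernel]

lemma continuous_smoothKernel : Continuous smoothKernel := by
  unfold smoothKernel
  refine Continuous.inv₀ (by fun_prop) fun x => by positivity

lemma smoothKernel_mul_le (x : ℝ) : smoothKernel x * (1 + |x|) ≤ (1 + x ^ 2)⁻¹ := by
  unfold smoothKernel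
  rw [inv_mul_eq_div, ← one_div, div_le_div_iff₀ (by positivity) (by positivity)]
  have h1 : 1 + |x| ≤ x ^ 2 + 9 := by nlinarith [sq_abs x, abs_nonneg x, sq_nonneg (|x| - 1)]
  nlinarith [sq_nonneg x, abs_nonneg x]

lemma integrable_smoothKernel_mul (t : ℝ) :
    Integrable fun s => smoothKernel (s - t) * (1 + |s - t|) :=
  Integrable.comp_sub_right (f := fun x => smoothKernel x * (1 + |x|))
    (integrable_of_norm_le_div_one_add_sq (C := 1)
      (Continuous.aestronglyMeasurable (continuous_smoothKernel.mul (by fun_prop)))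
      (fun x => by
        rw [Real.norm_of_nonneg (mul_nonneg (smoothKernel_pos x).le (by positivity)), one_div]
        exact smoothKernel_mul_le x)) t

lemma integral_smoothKernel_mul_le (t : ℝ) :
    ∫ s, smoothKernel (s - t) * (1 + |s - t|) ≤ Real.pi := by
  rw [integral_sub_right_eq_self (fun x => smoothKernel x * (1 + |x|)), ← integral_univ_inv_one_add_sq]
  exact integral_mono (by simpa using integrable_smoothKernel_mul 0) integrable_inv_one_add_sq
    smoothKernel_mul_le

lemma differentiableAt_negZetaLogDeriv (hRH : RiemannHypothesis) {s : ℂ} (hs : 1 / 2 < s.re) :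
    DifferentiableAt ℂ negZetaLogDeriv s := by
  have hopen : IsOpen {w : ℂ | 1 / 2 < w.re} := isOpen_lt continuous_const continuous_re
  have h1 : DifferentiableOn ℂ zetaMulSubOne {w : ℂ | 1 / 2 < w.re} := fun w (hw : 1 / 2 < w.re) =>
    (differentiableAt_zetaMulSubOne (by linarith)).differentiableWithinAt
  have h2 := ((h1.deriv hopen).div h1 fun w hw => zetaMulSubOne_ne_zero hRH hw).neg
  exact h2.differentiableAt (hopen.mem_nhds hs)

lemma log_abs_add_three_pos (t : ℝ) : 1 ≤ Real.log (|t| + 3) := by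
  rw [Real.le_log_iff_exp_le (by positivity)]
  linarith [Real.exp_one_lt_d9, abs_nonneg t]

lemma log_abs_add_three_le (s t : ℝ) :
    Real.log (|s| + 3) ≤ Real.log (|t| + 3) * (1 + |s - t|) := by
  have h1 : |s| + 3 ≤ (|t| + 3) * (1 + |s - t|) := by
    have := abs_sub_abs_le_abs_sub s t
    nlinarith [abs_nonneg (s - t), abs_nonneg t, mul_nonneg (abs_nonneg t) (abs_nonneg (s - t))]
  have h2 := Real.log_le_log (by positivity) h1
  rw [Real.log_mul (by positivity) (by positivity)] at h2
  have h3 := Real.log_le_sub_one_of_pos (show 0 < 1 + |s - t| by positivity)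
  have h4 := log_abs_add_three_pos t
  nlinarith [abs_nonneg (s - t)]

/-- `Re (-ζ'/ζ - 1/(s-1))` is logarithmically bounded on average over short vertical segments,
uniformly up to the critical line. -/
lemma exists_integral_abs_re_negZetaLogDeriv_mul_le (hRH : RiemannHypothesis) :
    ∃ K > 0, ∀ c : ℝ, 1 / 2 < c → c ≤ 1 → ∀ t : ℝ,
      Integrable (fun s : ℝ => |(negZetaLogDeriv (c + s * I)).re| * smoothKernel (s - t)) ∧
      ∫ s : ℝ, |(negZetaLogDeriv (c + s * I)).re| * smoothKernel (s - t) ≤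
        K * Real.log (|t| + 3) := by
  obtain ⟨C, hC, hre⟩ := exists_re_negZetaLogDeriv_le hRH
  obtain ⟨M, hM, hf2⟩ := exists_norm_negZetaLogDeriv_le_of_two_le
  refine ⟨(C + 1 + M) * Real.pi, by positivity, fun c hc hc1 t => ?_⟩
  obtain ⟨B, hB, hcr⟩ := exists_crude_bounds hRH hc hc1
  set F : ℂ → ℂ := fun w => negZetaLogDeriv w * (((-I * (w - c) - t) ^ 2 + 9) ^ 2)⁻¹ with hF
  have hker : ∀ w : ℂ, c ≤ w.re → w.re ≤ 2 → (w.im - t) ^ 2 + 6 ≤ ‖(-I * (w - c) - t) ^ 2 + 9‖ := by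
    intro w h1 h2
    refine le_trans ?_ (Complex.re_le_norm _)
    have : ((-I * (w - c) - t) ^ 2 + 9 : ℂ).re = (w.im - t) ^ 2 - (w.re - c) ^ 2 + 9 := by
      simp [pow_two]; ring
    rw [this]
    nlinarith
  have hkerle : ∀ w : ℂ, c ≤ w.re → w.re ≤ 2 →
      ‖(((-I * (w - c) - t) ^ 2 + 9) ^ 2)⁻¹‖ ≤ (((w.im - t) ^ 2 + 6) ^ 2)⁻¹ := fun w h1 h2 => by
    rw [norm_inv, norm_pow]
    exact inv_anti₀ (by positivity) (pow_le_pow_left₀ (by positivity) (hker w h1 h2) 2)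
  have hFd : ∀ w : ℂ, c ≤ w.re → w.re ≤ 2 → DifferentiableAt ℂ F w := fun w h1 h2 => by
    refine (differentiableAt_negZetaLogDeriv hRH (by linarith)).fun_mul
      (DifferentiableAt.fun_inv (by fun_prop) ?_)
    have h3 := hker w h1 h2
    exact pow_ne_zero _ (norm_pos_iff.1 (by nlinarith [sq_nonneg (w.im - t)]))
  have hFb : ∀ w : ℂ, c ≤ w.re → w.re ≤ 2 →
      ‖F w‖ ≤ B * (1 + |t|) * (2 * (1 + t ^ 2)) / (1 + w.im ^ 2) := fun w h1 h2 => by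
    rw [hF, norm_mul]
    have h3 := (hcr w h1 (by linarith)).2
    have h4 : 1 + |w.im| ≤ (1 + |t|) * (1 + |w.im - t|) := by
      have := abs_sub_abs_le_abs_sub w.im t
      nlinarith [abs_nonneg (w.im - t), abs_nonneg t,
        mul_nonneg (abs_nonneg t) (abs_nonneg (w.im - t))]
    set x := w.im - t with hx
    have h5 : (1 + |x|) * ((x ^ 2 + 6) ^ 2)⁻¹ ≤ (1 + x ^ 2)⁻¹ := by
      rw [← div_eq_mul_inv, ← one_div, div_le_div_iff₀ (by positivity) (by positivity)]
      have h1 : 1 + |x| ≤ x ^ 2 + 6 := by nlinarith [sq_abs x, abs_nonneg x, sq_nonneg (|x| - 1)]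
      nlinarith [sq_nonneg x, abs_nonneg x]
    have h6 : (1 + x ^ 2)⁻¹ ≤ 2 * (1 + t ^ 2) / (1 + w.im ^ 2) := by
      rw [← one_div, div_le_div_iff₀ (by positivity) (by positivity)]
      have : w.im = x + t := by rw [hx]; ring
      rw [this]
      nlinarith [sq_nonneg (x - t), sq_nonneg (x * t)]
    calc _ ≤ B * ((1 + |t|) * (1 + |x|)) * ((x ^ 2 + 6) ^ 2)⁻¹ := by
          gcongr
          · exact h3.trans (by gcongr)
          · exact hkerle w h1 h2
      _ = B * (1 + |t|) * ((1 + |x|) * ((x ^ 2 + 6) ^ 2)⁻¹) := by ring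
      _ ≤ B * (1 + |t|) * (2 * (1 + t ^ 2) / (1 + w.im ^ 2)) := by
          gcongr; exact h5.trans h6
      _ = _ := by ring
  have hshift := integral_vertical_eq (by linarith : c ≤ 2) hFd hFb
  have hFc : ∀ s : ℝ, F (c + s * I) = negZetaLogDeriv (c + s * I) * (smoothKernel (s - t) : ℝ) := by
    intro s
    simp only [hF, smoothKernel]
    congr 1
    push_cast
    rw [add_sub_cancel_left, show -I * (s * I) = -(I * I) * s by ring, I_mul_I]
    simp
  have hFre : ∀ s : ℝ, (F (c + s * I)).re =
      (negZetaLogDeriv (c + s * I)).re * smoothKernel (s - t) := fun s => by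
    rw [hFc, re_mul_ofReal]
  have hFint : Integrable fun s : ℝ => F (c + s * I) :=
    integrable_of_norm_le_div_one_add_sq (continuous_vertical_of_differentiableAt
      fun w hw => hFd w hw.ge (by linarith)).aestronglyMeasurable
      (fun s => by simpa using hFb (c + s * I) (by simp) (by simp; linarith))
  have hmint : Integrable fun s : ℝ => (negZetaLogDeriv (c + s * I)).re * smoothKernel (s - t) := by
    refine hFint.re.congr (Filter.Eventually.of_forall fun s => ?_)
    exact hFre s
  have hlow : -(M * Real.pi) ≤ ∫ s : ℝ, (negZetaLogDeriv (c + s * I)).re * smoothKernel (s - t) := by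
    have h1 : ∫ s : ℝ, (negZetaLogDeriv (c + s * I)).re * smoothKernel (s - t) =
        (∫ s : ℝ, F (c + s * I)).re := by
      rw [← RCLike.re_eq_complex_re, ← integral_re hFint]
      exact integral_congr_ae (Filter.Eventually.of_forall fun s => (hFre s).symm)
    rw [h1, hshift]
    refine (abs_le.1 ((Complex.abs_re_le_norm _).trans ?_)).1
    have h2 : ∫ s : ℝ, M * (1 + (s - t) ^ 2)⁻¹ = M * Real.pi := by
      rw [integral_const_mul, integral_sub_right_eq_self (fun x : ℝ => (1 + x ^ 2)⁻¹),
        integral_univ_inv_one_add_sq]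
    rw [← h2]
    refine norm_integral_le_of_norm_le ((integrable_inv_one_add_sq.comp_sub_right t).const_mul M)
      (Filter.Eventually.of_forall fun s => ?_)
    rw [hF, norm_mul]
    gcongr
    · exact hf2 _ (by simp)
    · have := hkerle ((2 : ℝ) + s * I) (by simp; linarith) (by simp)
      refine this.trans (inv_anti₀ (by positivity) ?_)
      simp
      nlinarith [sq_nonneg (s - t), sq_nonneg ((s - t) ^ 2)]
  refine ⟨?_, ?_⟩
  · refine hmint.norm.congr (Filter.Eventually.of_forall fun s => ?_)
    simp only [Real.norm_eq_abs, abs_mul, abs_of_pos (smoothKernel_pos _)]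
  · set G : ℝ → ℝ := fun s => (C + 1) * Real.log (|t| + 3) * (smoothKernel (s - t) * (1 + |s - t|))
      with hG
    have hpt : ∀ s : ℝ, |(negZetaLogDeriv (c + s * I)).re| * smoothKernel (s - t) ≤
        G s - (negZetaLogDeriv (c + s * I)).re * smoothKernel (s - t) := by
      intro s
      have hk := (smoothKernel_pos (s - t)).le
      have h1 := hre (c + s * I) (by simpa using hc) (by simp; linarith)
      have h2 : Real.log ‖(c + s * I : ℂ) + 1‖ ≤ Real.log (|s| + 3) := by
        refine Real.log_le_log (norm_pos_iff.2 fun h => ?_) ?_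
        · have := congrArg re h
          simp at this
          linarith
        · refine (Complex.norm_le_abs_re_add_abs_im _).trans ?_
          simp
          rw [abs_of_nonneg (by linarith)]
          linarith
      have h3 := log_abs_add_three_le s t
      have h4 := log_abs_add_three_pos t
      have h5 : C ≤ C * (Real.log (|t| + 3) * (1 + |s - t|)) := by
        refine le_mul_of_one_le_right hC.le (one_le_mul_of_one_le_of_one_le h4 ?_)
        linarith [abs_nonneg (s - t)]
      have h6 : |(negZetaLogDeriv (c + s * I)).re| ≤
          (C + 1) * Real.log (|t| + 3) * (1 + |s - t|) - (negZetaLogDeriv (c + s * I)).re := by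
        have : 0 ≤ Real.log (|t| + 3) * (1 + |s - t|) := by positivity
        rw [abs_le]
        constructor <;> nlinarith
      calc _ ≤ ((C + 1) * Real.log (|t| + 3) * (1 + |s - t|) - (negZetaLogDeriv (c + s * I)).re) *
            smoothKernel (s - t) := by gcongr
        _ = _ := by rw [hG]; ring
    have hGint : Integrable G := (integrable_smoothKernel_mul t).const_mul _
    calc _ ≤ ∫ s : ℝ, (G s - (negZetaLogDeriv (c + s * I)).re * smoothKernel (s - t)) :=
          integral_mono_of_nonneg (Filter.Eventually.of_forall fun s =>
            mul_nonneg (abs_nonneg _) (smoothKernel_pos _).le) (hGint.sub hmint)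
            (Filter.Eventually.of_forall hpt)
      _ = (∫ s, G s) - ∫ s : ℝ, (negZetaLogDeriv (c + s * I)).re * smoothKernel (s - t) :=
          integral_sub hGint hmint
      _ ≤ (C + 1) * Real.log (|t| + 3) * Real.pi + M * Real.pi := by
          rw [hG, integral_const_mul]
          have h4 := log_abs_add_three_pos t
          have := mul_le_mul_of_nonneg_left (integral_smoothKernel_mul_le t)
            (by positivity : 0 ≤ (C + 1) * Real.log (|t| + 3))
          linarith
      _ ≤ _ := by
          have h4 := log_abs_add_three_pos t
          nlinarith [mul_pos hM Real.pi_pos]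

lemma integrableOn_cpow_mul_exp_neg_mul {a r : ℂ} (ha : 0 < a.re) (hr : 0 < r.re) :
    IntegrableOn (fun t : ℝ => (t : ℂ) ^ (a - 1) * exp (-(r * t))) (Set.Ioi 0) := by
  have h := (integrableOn_rpow_mul_exp_neg_mul_rpow (s := a.re - 1) (p := 1) (b := r.re)
    (by linarith) one_pos hr)
  refine Integrable.mono' h ?_ ?_
  · refine ContinuousOn.aestronglyMeasurable ?_ measurableSet_Ioi
    intro t ht
    refine ContinuousAt.continuousWithinAt (ContinuousAt.mul ?_ (by fun_prop))
    exact continuousAt_ofReal_cpow_const _ _ (Or.inr (ne_of_gt ht))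
  · refine (ae_restrict_iff' measurableSet_Ioi).2 (Filter.Eventually.of_forall fun t ht => ?_)
    rw [norm_mul, norm_exp, norm_cpow_eq_rpow_re_of_pos ht]
    simp

lemma differentiableAt_integral_cpow_mul_exp_neg_mul {a r : ℂ} (ha : 0 < a.re) (hr : 0 < r.re) :
    DifferentiableAt ℂ (fun r : ℂ => ∫ t in Set.Ioi (0 : ℝ), (t : ℂ) ^ (a - 1) * exp (-(r * t)))
      r := by
  have hs : {w : ℂ | r.re / 2 < w.re} ∈ nhds r :=
    (isOpen_lt continuous_const continuous_re).mem_nhds (by simp; linarith)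
  have hb := integrableOn_rpow_mul_exp_neg_mul_rpow (s := a.re) (p := 1) (b := r.re / 2)
    (by linarith) one_pos (by linarith)
  refine (hasDerivAt_integral_of_dominated_loc_of_deriv_le
    (F := fun w (t : ℝ) => (t : ℂ) ^ (a - 1) * exp (-(w * t)))
    (F' := fun w (t : ℝ) => (t : ℂ) ^ (a - 1) * (exp (-(w * t)) * (-t)))
    (μ := volume.restrict (Set.Ioi 0)) hs ?_ (integrableOn_cpow_mul_exp_neg_mul ha hr)
    ?_ ?_ hb ?_).2.differentiableAt
  · filter_upwards [hs] with w hw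
    exact (integrableOn_cpow_mul_exp_neg_mul ha (r := w)
      ((by linarith : (0:ℝ) < r.re / 2).trans hw)).aestronglyMeasurable
  · refine ContinuousOn.aestronglyMeasurable ?_ measurableSet_Ioi
    intro t ht
    refine ContinuousAt.continuousWithinAt (ContinuousAt.mul ?_ (by fun_prop))
    exact continuousAt_ofReal_cpow_const _ _ (Or.inr (ne_of_gt ht))
  · refine (ae_restrict_iff' measurableSet_Ioi).2 (Filter.Eventually.of_forall fun t ht w hw => ?_)
    have ht : 0 < t := ht
    rw [norm_mul, norm_mul, norm_exp, norm_cpow_eq_rpow_re_of_pos ht, norm_neg, norm_real,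
      Real.norm_of_nonneg ht.le]
    have : t ^ a.re = t ^ (a - 1).re * t := by
      rw [← Real.rpow_add_one ht.ne']
      simp
    rw [this, Real.rpow_one]
    have h3 : Real.exp (-(w * t)).re ≤ Real.exp (-(r.re / 2) * t) := by
      refine Real.exp_le_exp.2 ?_
      have : r.re / 2 * t ≤ w.re * t := mul_le_mul_of_nonneg_right (le_of_lt hw) ht.le
      simpa using this
    calc _ = t ^ (a - 1).re * t * Real.exp (-(w * t)).re := by ring
      _ ≤ _ := by gcongr
  · refine Filter.Eventually.of_forall fun t w _ => ?_
    refine HasDerivAt.const_mul _ ?_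
    have : HasDerivAt (fun w : ℂ => -(w * t)) (-t) w := by
      simpa using ((hasDerivAt_id w).mul_const (t : ℂ)).fun_neg
    exact this.cexp

/-- Euler's integral for `Γ`, rotated to a complex parameter in the right half plane. -/
lemma integral_cpow_mul_exp_neg_mul_of_re_pos {a r : ℂ} (ha : 0 < a.re) (hr : 0 < r.re) :
    ∫ t in Set.Ioi (0 : ℝ), (t : ℂ) ^ (a - 1) * exp (-(r * t)) = r ^ (-a) * Gamma a := by
  have hU : IsOpen {w : ℂ | 0 < w.re} := isOpen_lt continuous_const continuous_re
  have hc : IsPreconnected {w : ℂ | 0 < w.re} := (convex_halfSpace_re_gt 0).isPreconnected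
  have h1 : AnalyticOnNhd ℂ (fun r : ℂ => ∫ t in Set.Ioi (0 : ℝ),
      (t : ℂ) ^ (a - 1) * exp (-(r * t))) {w : ℂ | 0 < w.re} :=
    DifferentiableOn.analyticOnNhd (fun w hw =>
      (differentiableAt_integral_cpow_mul_exp_neg_mul ha hw).differentiableWithinAt) hU
  have h2 : AnalyticOnNhd ℂ (fun r : ℂ => r ^ (-a) * Gamma a) {w : ℂ | 0 < w.re} := by
    refine DifferentiableOn.analyticOnNhd (fun w hw => ?_) hU
    exact ((differentiableAt_id.cpow (differentiableAt_const _)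
      (Or.inl hw)).mul_const _).differentiableWithinAt
  refine h1.eqOn_of_preconnected_of_frequently_eq h2 hc (z₀ := 1) (by simp) ?_ hr
  have htend : Filter.Tendsto (fun n : ℕ => (((1 : ℝ) + 1 / ((n : ℝ) + 1) : ℝ) : ℂ)) Filter.atTop
      (nhdsWithin 1 {1}ᶜ) := by
    refine tendsto_nhdsWithin_iff.2 ⟨?_, Filter.Eventually.of_forall fun n => ?_⟩
    · have := (tendsto_one_div_add_atTop_nhds_zero_nat (𝕜 := ℝ)).const_add 1
      rw [add_zero] at this
      exact_mod_cast (continuous_ofReal.tendsto 1).comp this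
    · have : (0 : ℝ) < 1 / ((n : ℝ) + 1) := by positivity
      simp only [Set.mem_compl_iff, Set.mem_singleton_iff]
      intro h
      have h' : (1 : ℝ) + 1 / ((n : ℝ) + 1) = 1 := by exact_mod_cast h
      linarith
  refine htend.frequently (Filter.Frequently.of_forall fun n => ?_)
  have hp : (0 : ℝ) < 1 + 1 / ((n : ℝ) + 1) := by positivity
  generalize (1 : ℝ) + 1 / ((n : ℝ) + 1) = x at hp
  rw [integral_cpow_mul_exp_neg_mul_Ioi ha hp, one_div, inv_cpow, cpow_neg]
  rw [arg_ofReal_of_nonneg hp.le]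
  exact Real.pi_pos.ne

/-- The Mellin transform `Γ(w/ℓ) z^{-w/ℓ} / ℓ` of `x ↦ exp (-z x^ℓ)`. -/
noncomputable def gammaKernel (ℓ : ℕ) (z w : ℂ) : ℂ := Gamma (w / ℓ) * z ^ (-(w / ℓ)) / ℓ

lemma mellinConvergent_exp_neg_mul_pow {ℓ : ℕ} (hℓ : 1 ≤ ℓ) {z w : ℂ} (hz : 0 < z.re)
    (hw : 0 < w.re) : MellinConvergent (fun x : ℝ => exp (-(z * (x : ℂ) ^ ℓ))) w := by
  have hℓ' : (ℓ : ℝ) ≠ 0 := by positivity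
  have h := (MellinConvergent.comp_rpow (f := fun x : ℝ => exp (-(z * x))) (s := w)
    (a := (ℓ : ℝ)) hℓ').2 (by
      refine integrableOn_cpow_mul_exp_neg_mul ?_ hz
      rw [div_ofReal_re]
      positivity)
  simpa using h

lemma mellin_exp_neg_mul_pow {ℓ : ℕ} (hℓ : 1 ≤ ℓ) {z w : ℂ} (hz : 0 < z.re) (hw : 0 < w.re) :
    mellin (fun x : ℝ => exp (-(z * (x : ℂ) ^ ℓ))) w = gammaKernel ℓ z w := by
  have h := mellin_comp_rpow (fun x : ℝ => exp (-(z * x))) w (ℓ : ℝ)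
  have h2 : mellin (fun x : ℝ => exp (-(z * x))) (w / ((ℓ : ℝ) : ℂ)) =
      z ^ (-(w / ((ℓ : ℝ) : ℂ))) * Gamma (w / ((ℓ : ℝ) : ℂ)) := by
    refine integral_cpow_mul_exp_neg_mul_of_re_pos ?_ hz
    rw [div_ofReal_re]
    positivity
  rw [h2] at h
  rw [gammaKernel]
  simp only [Real.rpow_natCast, ofReal_pow, ofReal_natCast, Nat.abs_cast, real_smul, ofReal_inv] at h
  rw [h]
  ring

lemma differentiableAt_gammaKernel {ℓ : ℕ} (hℓ : 1 ≤ ℓ) {z w : ℂ} (hz : 0 < z.re)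
    (hw : 0 < w.re) : DifferentiableAt ℂ (gammaKernel ℓ z) w := by
  have hre : 0 < (w / ℓ).re := by
    rw [← ofReal_natCast, div_ofReal_re]
    positivity
  have hz0 : z ≠ 0 := by
    rintro rfl
    simp at hz
  have h1 : DifferentiableAt ℂ (fun w : ℂ => Gamma (w / ℓ)) w := by
    refine DifferentiableAt.comp (g := Gamma) w (differentiableAt_Gamma _ fun m hm => ?_)
      (by fun_prop)
    rw [hm, neg_re, natCast_re] at hre
    have := Nat.cast_nonneg (α := ℝ) m
    linarith
  have h2 : DifferentiableAt ℂ (fun w : ℂ => z ^ (-(w / ℓ))) w :=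
    DifferentiableAt.const_cpow (by fun_prop) (Or.inl hz0)
  exact (h1.mul h2).div_const _

lemma exists_norm_gammaKernel_le {ℓ : ℕ} (hℓ : 1 ≤ ℓ) {a₀ : ℝ} (ha₀ : 0 < a₀) (a₁ : ℝ) :
    ∃ C > 0, ∀ z w : ℂ, 0 < z.re → a₀ ≤ w.re → w.re ≤ a₁ →
      ‖gammaKernel ℓ z w‖ ≤ C * ‖z‖ ^ (-(w.re / ℓ)) * (1 + |w.im|) ^ (w.re / ℓ - 1 / 2) *
        Real.exp (-((Real.pi / 2 - |z.arg|) / ℓ * |w.im|)) := by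
  have hℓ0 : (0 : ℝ) < ℓ := by positivity
  have hℓ1 : (1 : ℝ) ≤ ℓ := by exact_mod_cast hℓ
  obtain ⟨C, hC, h⟩ := exists_norm_Gamma_le (a₀ := min (a₀ / ℓ) (1 / 2))
    (a₁ := max (a₁ / ℓ) (1 / 2)) (lt_min (by positivity) (by norm_num))
    (min_le_right _ _) (le_max_right _ _)
  refine ⟨C * (ℓ : ℝ), by positivity, fun z w hz h0 h1 => ?_⟩
  have hz0 : z ≠ 0 := by
    rintro rfl
    simp at hz
  have hre : (w / ℓ).re = w.re / ℓ := by rw [← ofReal_natCast, div_ofReal_re]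
  have him : (w / ℓ).im = w.im / ℓ := by rw [← ofReal_natCast, div_ofReal_im]
  have hG := h (w / ℓ) ((min_le_left _ _).trans (by rw [hre]; gcongr))
    (le_trans (by rw [hre]; gcongr) (le_max_left _ _))
  rw [hre, him, abs_div, Nat.abs_cast] at hG
  set T := |w.im| with hT
  have hT0 : 0 ≤ T := abs_nonneg _
  have hpow : (1 + T / ℓ) ^ (w.re / ℓ - 1 / 2) ≤ ℓ * (1 + T) ^ (w.re / ℓ - 1 / 2) := by
    rcases le_total (w.re / ℓ - 1 / 2) 0 with hneg | hpos
    · have hle : (1 + T) / ℓ ≤ 1 + T / ℓ := by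
        rw [add_div]
        have : 1 / (ℓ : ℝ) ≤ 1 := by rw [div_le_one hℓ0]; exact hℓ1
        linarith
      calc (1 + T / ℓ) ^ (w.re / ℓ - 1 / 2) ≤ ((1 + T) / ℓ) ^ (w.re / ℓ - 1 / 2) :=
            Real.rpow_le_rpow_of_nonpos (by positivity) hle hneg
        _ = (ℓ : ℝ) ^ (-(w.re / ℓ - 1 / 2)) * (1 + T) ^ (w.re / ℓ - 1 / 2) := by
            rw [Real.div_rpow (by positivity) hℓ0.le, Real.rpow_neg hℓ0.le]
            field_simp
        _ ≤ (ℓ : ℝ) ^ (1 : ℝ) * (1 + T) ^ (w.re / ℓ - 1 / 2) := by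
            gcongr
            have : 0 ≤ w.re / ℓ := div_nonneg (ha₀.le.trans h0) hℓ0.le
            linarith
        _ = _ := by rw [Real.rpow_one]
    · calc (1 + T / ℓ) ^ (w.re / ℓ - 1 / 2) ≤ (1 + T) ^ (w.re / ℓ - 1 / 2) := by
            gcongr
            exact div_le_self hT0 hℓ1
        _ ≤ _ := le_mul_of_one_le_left (by positivity) hℓ1
  have hexp : Real.exp (-(Real.pi * (T / ℓ) / 2)) * (Real.exp (z.arg * -(w.im / ℓ)))⁻¹ ≤
      Real.exp (-((Real.pi / 2 - |z.arg|) / ℓ * T)) := by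
    rw [← Real.exp_neg, ← Real.exp_add]
    refine Real.exp_le_exp.2 ?_
    have : z.arg * w.im ≤ |z.arg| * T := by
      rw [hT, ← abs_mul]
      exact le_abs_self _
    have h2 : z.arg * w.im / ℓ ≤ |z.arg| * T / ℓ := by gcongr
    have e1 : -(Real.pi * (T / ℓ) / 2) + -(z.arg * -(w.im / ℓ)) =
        -(Real.pi / 2 / ℓ * T) + z.arg * w.im / ℓ := by ring
    have e2 : -((Real.pi / 2 - |z.arg|) / ℓ * T) =
        -(Real.pi / 2 / ℓ * T) + |z.arg| * T / ℓ := by ring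
    rw [e1, e2]
    linarith
  rw [gammaKernel, norm_div, norm_mul, norm_cpow_of_ne_zero hz0, neg_re, neg_im, hre, him,
    Complex.norm_natCast]
  calc ‖Gamma (w / ℓ)‖ * (‖z‖ ^ (-(w.re / ℓ)) / Real.exp (z.arg * -(w.im / ℓ))) / ℓ
      ≤ ‖Gamma (w / ℓ)‖ * (‖z‖ ^ (-(w.re / ℓ)) / Real.exp (z.arg * -(w.im / ℓ))) :=
        div_le_self (by positivity) hℓ1
    _ ≤ (C * (ℓ * (1 + T) ^ (w.re / ℓ - 1 / 2)) * Real.exp (-(Real.pi * (T / ℓ) / 2))) *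
        (‖z‖ ^ (-(w.re / ℓ)) / Real.exp (z.arg * -(w.im / ℓ))) := by
        gcongr
        refine hG.trans ?_
        gcongr
    _ = (C * ℓ) * ‖z‖ ^ (-(w.re / ℓ)) * (1 + T) ^ (w.re / ℓ - 1 / 2) *
        (Real.exp (-(Real.pi * (T / ℓ) / 2)) * (Real.exp (z.arg * -(w.im / ℓ)))⁻¹) := by ring
    _ ≤ _ := by gcongr

lemma exists_pow_mul_exp_neg_le (n : ℕ) {κ : ℝ} (hκ : 0 < κ) :
    ∃ C > 0, ∀ x : ℝ, 0 ≤ x → (1 + x) ^ n * Real.exp (-(κ * x)) ≤ C := by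
  refine ⟨n.factorial * κ⁻¹ ^ n * Real.exp κ, by positivity, fun x hx => ?_⟩
  have h := Real.pow_div_factorial_le_exp (κ * (1 + x)) (by positivity) n
  rw [div_le_iff₀ (by positivity), mul_pow] at h
  calc (1 + x) ^ n * Real.exp (-(κ * x))
      = κ⁻¹ ^ n * (κ ^ n * (1 + x) ^ n) * Real.exp (-(κ * x)) := by
        rw [← mul_assoc, ← mul_pow, inv_mul_cancel₀ hκ.ne', one_pow, one_mul]
    _ ≤ κ⁻¹ ^ n * (Real.exp (κ * (1 + x)) * n.factorial) * Real.exp (-(κ * x)) := by gcongr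
    _ = n.factorial * κ⁻¹ ^ n * (Real.exp (κ * (1 + x)) * Real.exp (-(κ * x))) := by ring
    _ = _ := by
      rw [← Real.exp_add]
      congr 2
      ring

/-- For fixed `z`, the kernel decays rapidly on vertical strips. -/
lemma exists_norm_gammaKernel_mul_le {ℓ : ℕ} (hℓ : 1 ≤ ℓ) {a₀ : ℝ} (ha₀ : 0 < a₀) (a₁ : ℝ) {z : ℂ}
    (hz : 0 < z.re) : ∃ C > 0, ∀ w : ℂ, a₀ ≤ w.re → w.re ≤ a₁ →
      ‖gammaKernel ℓ z w‖ * (1 + |w.im|) ≤ C / (1 + w.im ^ 2) := by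
  have hℓ0 : (0 : ℝ) < ℓ := by positivity
  have hz0 : z ≠ 0 := by
    rintro rfl
    simp at hz
  obtain ⟨C, hC, h⟩ := exists_norm_gammaKernel_le hℓ ha₀ a₁
  have hφ : 0 < Real.pi / 2 - |z.arg| := by
    have := abs_arg_lt_pi_div_two_iff.2 (Or.inl hz)
    linarith
  obtain ⟨n, hn⟩ := exists_nat_ge (a₁ / ℓ - 1 / 2)
  obtain ⟨D, hD, hD'⟩ := exists_pow_mul_exp_neg_le (n + 3)
    (κ := (Real.pi / 2 - |z.arg|) / ℓ) (by positivity)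
  have hcpt : ∃ M > 0, ∀ x ∈ Set.Icc a₀ a₁, ‖z‖ ^ (-(x / ℓ)) ≤ M := by
    have hcont : Continuous fun x : ℝ => ‖z‖ ^ (-(x / ℓ)) :=
      Real.continuous_const_rpow (norm_ne_zero_iff.2 hz0) |>.comp (by fun_prop)
    obtain ⟨M, hM⟩ := (isCompact_Icc (a := a₀) (b := a₁)).bddAbove_image hcont.continuousOn
    exact ⟨max M 1, by positivity, fun x hx => (hM ⟨x, hx, rfl⟩).trans (le_max_left _ _)⟩
  obtain ⟨M, hM, hM'⟩ := hcpt
  refine ⟨C * M * D, by positivity, fun w h0 h1 => ?_⟩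
  rw [le_div_iff₀ (by positivity)]
  have hT0 : 0 ≤ |w.im| := abs_nonneg _
  have h3 : (1 + |w.im|) ^ (w.re / ℓ - 1 / 2) ≤ (1 + |w.im|) ^ n := by
    rw [← Real.rpow_natCast]
    refine Real.rpow_le_rpow_of_exponent_le (by linarith) (le_trans ?_ hn)
    gcongr
  have h4 : 1 + w.im ^ 2 ≤ (1 + |w.im|) ^ 2 := by
    rw [← sq_abs]
    nlinarith
  calc ‖gammaKernel ℓ z w‖ * (1 + |w.im|) * (1 + w.im ^ 2)
      ≤ (C * M * (1 + |w.im|) ^ n * Real.exp (-((Real.pi / 2 - |z.arg|) / ℓ * |w.im|))) *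
        (1 + |w.im|) * (1 + |w.im|) ^ 2 := by
        gcongr
        refine (h z w hz h0 h1).trans ?_
        gcongr
        exact hM' _ ⟨h0, h1⟩
    _ = C * M * ((1 + |w.im|) ^ (n + 3) *
        Real.exp (-((Real.pi / 2 - |z.arg|) / ℓ * |w.im|))) := by ring
    _ ≤ _ := by
      gcongr
      exact hD' _ hT0

lemma integrable_gammaKernel {ℓ : ℕ} (hℓ : 1 ≤ ℓ) {a : ℝ} (ha : 0 < a) {z : ℂ} (hz : 0 < z.re) :
    Integrable fun t : ℝ => gammaKernel ℓ z (a + t * I) := by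
  obtain ⟨C, hC, h⟩ := exists_norm_gammaKernel_mul_le hℓ ha a hz
  refine integrable_of_norm_le_div_one_add_sq (C := C) (continuous_vertical_of_differentiableAt
    fun w hw => differentiableAt_gammaKernel hℓ hz (hw ▸ ha)).aestronglyMeasurable fun t => ?_
  have := h (a + t * I) (by simp) (by simp)
  simp only [add_im, ofReal_im, mul_im, ofReal_re, I_im, mul_one, I_re, mul_zero, add_zero,
    zero_add] at this
  refine le_trans (le_mul_of_one_le_right (norm_nonneg _) ?_) this
  linarith [abs_nonneg t]

lemma exp_neg_mul_pow_eq_integral {ℓ : ℕ} (hℓ : 1 ≤ ℓ) {a : ℝ} (ha : 0 < a) {z : ℂ}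
    (hz : 0 < z.re) {x : ℝ} (hx : 0 < x) :
    exp (-(z * (x : ℂ) ^ ℓ)) = (1 / (2 * Real.pi)) *
      ∫ t : ℝ, (x : ℂ) ^ (-((a : ℂ) + t * I)) * gammaKernel ℓ z (a + t * I) := by
  have hm : ∀ t : ℝ, mellin (fun x : ℝ => exp (-(z * (x : ℂ) ^ ℓ))) ((a : ℂ) + t * I) =
      gammaKernel ℓ z (a + t * I) := fun t => mellin_exp_neg_mul_pow hℓ hz (by simpa)
  have h := mellinInv_mellin_eq a (fun x : ℝ => exp (-(z * (x : ℂ) ^ ℓ))) hx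
    (mellinConvergent_exp_neg_mul_pow hℓ hz (by simpa))
    (by
      rw [VerticalIntegrable]
      simp_rw [hm]
      exact integrable_gammaKernel hℓ ha hz) (by fun_prop)
  rw [← h, mellinInv]
  simp_rw [hm, smul_eq_mul]
  simp

lemma ofReal_cpow_eq_exp {x : ℝ} (hx : 0 < x) (s : ℂ) : (x : ℂ) ^ s = exp (Real.log x * s) := by
  rw [cpow_def_of_ne_zero (by exact_mod_cast hx.ne'), ofReal_log hx.le]

/-- Integrating the Mellin inversion formula against a measure. -/
lemma integral_mul_exp_neg_mul_pow {X : Type*} [MeasurableSpace X] {ν : Measure X} [SFinite ν]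
    {y : X → ℝ} (hy : Measurable y) (hy0 : ∀ x, 0 < y x) {u : X → ℂ} {ℓ : ℕ} (hℓ : 1 ≤ ℓ)
    {a : ℝ} (ha : 0 < a) {z : ℂ} (hz : 0 < z.re)
    (hu : Integrable (fun x => u x * (y x : ℂ) ^ (-(a : ℂ))) ν) :
    Integrable (fun x => u x * exp (-(z * (y x : ℂ) ^ ℓ))) ν ∧
    Integrable (fun t : ℝ => gammaKernel ℓ z (a + t * I) *
      ∫ x, u x * (y x : ℂ) ^ (-((a : ℂ) + t * I)) ∂ν) ∧
    ∫ x, u x * exp (-(z * (y x : ℂ) ^ ℓ)) ∂ν = (1 / (2 * Real.pi)) *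
      ∫ t : ℝ, gammaKernel ℓ z (a + t * I) * ∫ x, u x * (y x : ℂ) ^ (-((a : ℂ) + t * I)) ∂ν := by
  set F : X → ℝ → ℂ := fun x t =>
    u x * (y x : ℂ) ^ (-((a : ℂ) + t * I)) * gammaKernel ℓ z (a + t * I) with hF
  have hFi : Integrable (Function.uncurry F) (ν.prod volume) := by
    have h1 := hu.mul_prod (integrable_gammaKernel hℓ ha hz)
    have h2 := h1.bdd_mul (f := fun p : X × ℝ => exp ((-(Real.log (y p.1) * p.2) : ℝ) * I))
      (c := 1) (by
        refine Measurable.aestronglyMeasurable ?_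
        have : Measurable fun p : X × ℝ => -(Real.log (y p.1) * p.2) :=
          ((Real.measurable_log.comp (hy.comp measurable_fst)).mul measurable_snd).neg
        exact ((measurable_ofReal.comp this).mul_const I).cexp)
      (Filter.Eventually.of_forall fun p => (norm_exp_ofReal_mul_I _).le)
    refine h2.congr (Filter.Eventually.of_forall fun p => ?_)
    simp only [Function.uncurry, hF]
    rw [ofReal_cpow_eq_exp (hy0 p.1), ofReal_cpow_eq_exp (hy0 p.1)]
    have : exp (Real.log (y p.1) * (-((a : ℂ) + p.2 * I))) =
        exp (Real.log (y p.1) * -(a : ℂ)) * exp ((-(Real.log (y p.1) * p.2) : ℝ) * I) := by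
      rw [← Complex.exp_add]
      congr 1
      push_cast
      ring
    rw [this]
    ring
  have hpt : ∀ x, u x * exp (-(z * (y x : ℂ) ^ ℓ)) = (1 / (2 * Real.pi)) * ∫ t : ℝ, F x t := by
    intro x
    rw [exp_neg_mul_pow_eq_integral hℓ ha hz (hy0 x), mul_left_comm, ← integral_const_mul]
    simp only [hF, mul_assoc]
  have hpt' : ∀ t : ℝ, gammaKernel ℓ z (a + t * I) *
      ∫ x, u x * (y x : ℂ) ^ (-((a : ℂ) + t * I)) ∂ν = ∫ x, F x t ∂ν := by
    intro t
    rw [mul_comm, ← integral_mul_const]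
  simp_rw [hpt, hpt']
  refine ⟨hFi.integral_prod_left.const_mul _, hFi.integral_prod_right, ?_⟩
  rw [integral_const_mul, integral_integral_swap hFi]

lemma rpow_mul_cpow_eq {x : ℝ} (hx : 0 < x) (p ε : ℝ) (w : ℂ) :
    ((x ^ (-p) : ℝ) : ℂ) * ((x ^ ε : ℝ) : ℂ) ^ (-w) = (x : ℂ) ^ (-(p + ε * w)) := by
  rw [ofReal_cpow_eq_exp (Real.rpow_pos_of_pos hx _), Real.log_rpow hx, ofReal_cpow hx.le,
    ofReal_cpow_eq_exp hx, ofReal_cpow_eq_exp hx, ← Complex.exp_add]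
  congr 1
  push_cast
  ring

lemma tsum_vonMangoldt_mul_exp {ℓ : ℕ} (hℓ : 1 ≤ ℓ) {a p ε : ℝ} (ha : 0 < a)
    (hp : 1 < p + ε * a) {z : ℂ} (hz : 0 < z.re) :
    (Summable fun n : ℕ => ‖((ArithmeticFunction.vonMangoldt n * ((max n 1 : ℕ) : ℝ) ^ (-p) : ℝ) : ℂ) *
      exp (-(z * ((((max n 1 : ℕ) : ℝ) ^ ε : ℝ) : ℂ) ^ ℓ))‖) ∧
    Integrable (fun t : ℝ => gammaKernel ℓ z (a + t * I) *
      LSeries (fun n => (ArithmeticFunction.vonMangoldt n : ℂ)) (p + ε * (a + t * I))) ∧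
    ∑' n : ℕ, ((ArithmeticFunction.vonMangoldt n * ((max n 1 : ℕ) : ℝ) ^ (-p) : ℝ) : ℂ) *
      exp (-(z * ((((max n 1 : ℕ) : ℝ) ^ ε : ℝ) : ℂ) ^ ℓ)) = (1 / (2 * Real.pi)) *
      ∫ t : ℝ, gammaKernel ℓ z (a + t * I) *
        LSeries (fun n => (ArithmeticFunction.vonMangoldt n : ℂ)) (p + ε * (a + t * I)) := by
  have hpos : ∀ n : ℕ, (0 : ℝ) < (max n 1 : ℕ) := fun n => by
    exact_mod_cast lt_of_lt_of_le one_pos (le_max_right n 1)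
  have hterm : ∀ (w : ℂ) (n : ℕ),
      ((ArithmeticFunction.vonMangoldt n * ((max n 1 : ℕ) : ℝ) ^ (-p) : ℝ) : ℂ) *
      ((((max n 1 : ℕ) : ℝ) ^ ε : ℝ) : ℂ) ^ (-w) =
      LSeries.term (fun n => (ArithmeticFunction.vonMangoldt n : ℂ)) (p + ε * w) n := by
    intro w n
    rw [ofReal_mul, mul_assoc, rpow_mul_cpow_eq (hpos n), LSeries.term_def]
    rcases Nat.eq_zero_or_pos n with rfl | hn
    · simp
    · rw [if_neg hn.ne', max_eq_left hn, cpow_neg, div_eq_mul_inv]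
      simp
  have hsum : ∀ w : ℂ, w.re = a →
      Integrable (fun n : ℕ => ((ArithmeticFunction.vonMangoldt n * ((max n 1 : ℕ) : ℝ) ^ (-p) : ℝ) : ℂ) *
      ((((max n 1 : ℕ) : ℝ) ^ ε : ℝ) : ℂ) ^ (-w)) Measure.count := by
    intro w hw
    rw [integrable_count_iff]
    simp_rw [hterm]
    refine (ArithmeticFunction.LSeriesSummable_vonMangoldt (s := p + ε * w) ?_).norm
    simpa [hw] using hp
  obtain ⟨h1, h2, h3⟩ := integral_mul_exp_neg_mul_pow (ν := (Measure.count : Measure ℕ))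
    (y := fun n : ℕ => ((max n 1 : ℕ) : ℝ) ^ ε) (measurable_of_countable _)
    (fun n => Real.rpow_pos_of_pos (hpos n) _)
    (u := fun n : ℕ => ((ArithmeticFunction.vonMangoldt n * ((max n 1 : ℕ) : ℝ) ^ (-p) : ℝ) : ℂ))
    hℓ ha hz (hsum a (by simp))
  have hL : ∀ t : ℝ, ∫ n : ℕ, ((ArithmeticFunction.vonMangoldt n * ((max n 1 : ℕ) : ℝ) ^ (-p) : ℝ) : ℂ) *
      ((((max n 1 : ℕ) : ℝ) ^ ε : ℝ) : ℂ) ^ (-((a : ℂ) + t * I)) ∂Measure.count =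
      LSeries (fun n => (ArithmeticFunction.vonMangoldt n : ℂ)) (p + ε * (a + t * I)) := by
    intro t
    rw [integral_countable (hsum _ (by simp)), LSeries]
    refine tsum_congr fun n => ?_
    rw [hterm]
    simp [Measure.real]
  simp_rw [hL] at h2 h3
  refine ⟨integrable_count_iff.1 h1, h2, ?_⟩
  rw [← h3, integral_countable h1]
  refine tsum_congr fun n => ?_
  simp [Measure.real]

lemma integral_Ioi_one_mul_exp {ℓ : ℕ} (hℓ : 1 ≤ ℓ) {a p ε : ℝ} (ha : 0 < a)
    (hp : 1 < p + ε * a) {z : ℂ} (hz : 0 < z.re) :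
    IntegrableOn (fun x : ℝ => ((x ^ (-p) : ℝ) : ℂ) * exp (-(z * ((x ^ ε : ℝ) : ℂ) ^ ℓ)))
      (Set.Ioi 1) ∧
    Integrable (fun t : ℝ => gammaKernel ℓ z (a + t * I) * (1 / (p + ε * (a + t * I) - 1))) ∧
    ∫ x in Set.Ioi (1 : ℝ), ((x ^ (-p) : ℝ) : ℂ) * exp (-(z * ((x ^ ε : ℝ) : ℂ) ^ ℓ)) =
      (1 / (2 * Real.pi)) *
      ∫ t : ℝ, gammaKernel ℓ z (a + t * I) * (1 / (p + ε * (a + t * I) - 1)) := by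
  have hpos : ∀ x : ℝ, 0 < max x 1 := fun x => lt_of_lt_of_le one_pos (le_max_right x 1)
  have hmax : ∀ x ∈ Set.Ioi (1 : ℝ), max x 1 = x := fun x hx => max_eq_left (le_of_lt hx)
  have hcongr : ∀ w : ℂ, Set.EqOn (fun x : ℝ => (((max x 1) ^ (-p) : ℝ) : ℂ) *
      (((max x 1) ^ ε : ℝ) : ℂ) ^ (-w)) (fun x : ℝ => (x : ℂ) ^ (-(p + ε * w))) (Set.Ioi 1) := by
    intro w x hx
    simp only
    rw [rpow_mul_cpow_eq (hpos x), hmax x hx]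
  have hu : IntegrableOn (fun x : ℝ => (((max x 1) ^ (-p) : ℝ) : ℂ) *
      (((max x 1) ^ ε : ℝ) : ℂ) ^ (-(a : ℂ))) (Set.Ioi 1) := by
    refine IntegrableOn.congr_fun ?_ (hcongr a).symm measurableSet_Ioi
    refine integrableOn_Ioi_cpow_of_lt ?_ one_pos
    simp
    linarith
  obtain ⟨h1, h2, h3⟩ := integral_mul_exp_neg_mul_pow (ν := volume.restrict (Set.Ioi (1 : ℝ)))
    (y := fun x : ℝ => (max x 1) ^ ε) ((measurable_id.max measurable_const).pow_const _)
    (fun x => Real.rpow_pos_of_pos (hpos x) _)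
    (u := fun x : ℝ => (((max x 1) ^ (-p) : ℝ) : ℂ)) hℓ ha hz hu
  have hL : ∀ t : ℝ, ∫ x in Set.Ioi (1 : ℝ), (((max x 1) ^ (-p) : ℝ) : ℂ) *
      (((max x 1) ^ ε : ℝ) : ℂ) ^ (-((a : ℂ) + t * I)) = 1 / (p + ε * (a + t * I) - 1) := by
    intro t
    rw [setIntegral_congr_fun measurableSet_Ioi (hcongr _), integral_Ioi_cpow_of_lt (by
      simp; linarith) one_pos, ofReal_one, one_cpow, ← neg_div_neg_eq, neg_neg]
    congr 1
    ring
  have hg : Set.EqOn (fun x : ℝ => (((max x 1) ^ (-p) : ℝ) : ℂ) *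
      exp (-(z * (((max x 1) ^ ε : ℝ) : ℂ) ^ ℓ)))
      (fun x : ℝ => ((x ^ (-p) : ℝ) : ℂ) * exp (-(z * ((x ^ ε : ℝ) : ℂ) ^ ℓ))) (Set.Ioi 1) := by
    intro x hx
    simp only
    rw [hmax x hx]
  simp_rw [hL] at h2 h3
  refine ⟨IntegrableOn.congr_fun h1 hg measurableSet_Ioi, h2, ?_⟩
  rw [← h3, setIntegral_congr_fun measurableSet_Ioi hg]

lemma tsum_sub_integral_eq {ℓ : ℕ} (hℓ : 1 ≤ ℓ) {a p ε : ℝ} (ha : 0 < a)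
    (hp : 1 < p + ε * a) {z : ℂ} (hz : 0 < z.re) :
    ∑' n : ℕ, ((ArithmeticFunction.vonMangoldt n * ((max n 1 : ℕ) : ℝ) ^ (-p) : ℝ) : ℂ) *
      exp (-(z * ((((max n 1 : ℕ) : ℝ) ^ ε : ℝ) : ℂ) ^ ℓ)) -
    ∫ x in Set.Ioi (1 : ℝ), ((x ^ (-p) : ℝ) : ℂ) * exp (-(z * ((x ^ ε : ℝ) : ℂ) ^ ℓ)) =
    (1 / (2 * Real.pi)) * ∫ t : ℝ, gammaKernel ℓ z (a + t * I) *
      negZetaLogDeriv (p + ε * (a + t * I)) := by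
  obtain ⟨-, h1, h2⟩ := tsum_vonMangoldt_mul_exp hℓ ha hp hz
  obtain ⟨-, h3, h4⟩ := integral_Ioi_one_mul_exp hℓ ha hp hz
  rw [h2, h4, ← mul_sub, ← integral_sub h1 h3]
  congr 1
  refine integral_congr_ae (Filter.Eventually.of_forall fun t => ?_)
  simp only
  rw [negZetaLogDeriv_eq (by simpa using hp), mul_sub]

lemma norm_exp_neg_sub_one_le {w : ℂ} (hw : 0 ≤ w.re) : ‖exp (-w) - 1‖ ≤ 2 * ‖w‖ := by
  rcases le_total ‖w‖ 1 with h | h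
  · simpa using norm_exp_sub_one_le (x := -w) (by simpa using h)
  · have h1 : ‖exp (-w)‖ ≤ 1 := by
      rw [norm_exp]
      exact Real.exp_le_one_iff.2 (by simpa using hw)
    have := norm_sub_le (exp (-w)) 1
    rw [norm_one] at this
    linarith

lemma norm_exp_neg_mul_sub_one_le {ℓ : ℕ} (hℓ : 1 ≤ ℓ) {z : ℂ} (hz : 0 < z.re) (hz5 : ‖z‖ ≤ 5)
    {x : ℝ} (hx : 1 ≤ x) : ‖exp (-(z * ((x ^ (-1 : ℝ) : ℝ) : ℂ) ^ ℓ)) - 1‖ ≤ 10 * x⁻¹ := by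
  have hx0 : 0 < x := by linarith
  rw [Real.rpow_neg_one, ← ofReal_pow]
  refine (norm_exp_neg_sub_one_le ?_).trans ?_
  · rw [re_mul_ofReal]
    positivity
  · rw [norm_mul, norm_real, Real.norm_of_nonneg (by positivity)]
    have : x⁻¹ ^ ℓ ≤ x⁻¹ := pow_le_of_le_one (by positivity) (inv_le_one_of_one_le₀ hx) (by omega)
    calc 2 * (‖z‖ * x⁻¹ ^ ℓ) ≤ 2 * (5 * x⁻¹) := by gcongr
      _ = _ := by ring

lemma exists_norm_reflected_le (hRH : RiemannHypothesis) {ℓ : ℕ} (hℓ : 1 ≤ ℓ) :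
    ∃ C > 0, ∀ c : ℝ, 1 / 2 < c → c ≤ 1 → ∀ z : ℂ, 0 < z.re → ‖z‖ ≤ 5 →
    ‖∑' n : ℕ, ((ArithmeticFunction.vonMangoldt n * ((max n 1 : ℕ) : ℝ) ^ (-(2 * c)) : ℝ) : ℂ) *
      exp (-(z * ((((max n 1 : ℕ) : ℝ) ^ (-1 : ℝ) : ℝ) : ℂ) ^ ℓ)) -
    ∫ x in Set.Ioi (1 : ℝ), ((x ^ (-(2 * c)) : ℝ) : ℂ) *
      exp (-(z * ((x ^ (-1 : ℝ) : ℝ) : ℂ) ^ ℓ))‖ ≤ C := by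
  have hpos : ∀ n : ℕ, (1 : ℝ) ≤ (max n 1 : ℕ) := fun n => by exact_mod_cast le_max_right n 1
  have hcont : ContinuousOn (fun x : ℝ => ‖negZetaLogDeriv x‖) (Set.Icc 1 2) := fun x hx =>
    ((differentiableAt_negZetaLogDeriv hRH (s := x) (by
      rw [ofReal_re]; linarith [hx.1])).continuousAt.comp
      continuous_ofReal.continuousAt).norm.continuousWithinAt
  obtain ⟨M, hM⟩ := isCompact_Icc.bddAbove_image hcont
  have hterm : ∀ (s : ℝ) (n : ℕ),
      ((ArithmeticFunction.vonMangoldt n * ((max n 1 : ℕ) : ℝ) ^ (-s) : ℝ) : ℂ) =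
      LSeries.term (fun n => (ArithmeticFunction.vonMangoldt n : ℂ)) s n := by
    intro s n
    rw [LSeries.term_def]
    rcases Nat.eq_zero_or_pos n with rfl | hn
    · simp
    · rw [if_neg hn.ne', max_eq_left hn, Real.rpow_neg (Nat.cast_nonneg _), ← div_eq_mul_inv,
        ofReal_div, ofReal_cpow (Nat.cast_nonneg _)]
      simp
  have hsum : ∀ s : ℝ, 1 < s → Summable fun n : ℕ =>
      ArithmeticFunction.vonMangoldt n * ((max n 1 : ℕ) : ℝ) ^ (-s) := by
    intro s hs
    rw [← summable_ofReal]
    simp_rw [hterm]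
    exact ArithmeticFunction.LSeriesSummable_vonMangoldt (by simpa)
  refine ⟨max M 0 + 10 * (∑' n : ℕ, ArithmeticFunction.vonMangoldt n *
    ((max n 1 : ℕ) : ℝ) ^ (-2 : ℝ)) + 10, ?_, fun c hc hc1 z hz hz5 => ?_⟩
  · have : 0 ≤ ∑' n : ℕ, ArithmeticFunction.vonMangoldt n * ((max n 1 : ℕ) : ℝ) ^ (-2 : ℝ) :=
      tsum_nonneg fun n => mul_nonneg ArithmeticFunction.vonMangoldt_nonneg (by positivity)
    have := le_max_right M 0
    linarith
  obtain ⟨h1, -, -⟩ := tsum_vonMangoldt_mul_exp hℓ (a := c - 1 / 2) (p := 2 * c) (ε := -1)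
    (by linarith) (by linarith) hz
  obtain ⟨h3, -, -⟩ := integral_Ioi_one_mul_exp hℓ (a := c - 1 / 2) (p := 2 * c) (ε := -1)
    (by linarith) (by linarith) hz
  have hA : Summable fun n : ℕ =>
      ((ArithmeticFunction.vonMangoldt n * ((max n 1 : ℕ) : ℝ) ^ (-(2 * c)) : ℝ) : ℂ) :=
    summable_ofReal.2 (hsum _ (by linarith))
  have hI : IntegrableOn (fun x : ℝ => ((x ^ (-(2 * c)) : ℝ) : ℂ)) (Set.Ioi 1) :=
    (integrableOn_Ioi_rpow_of_lt (by linarith) one_pos).ofReal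
  have hf : negZetaLogDeriv ((2 * c : ℝ) : ℂ) =
      (∑' n : ℕ, ((ArithmeticFunction.vonMangoldt n * ((max n 1 : ℕ) : ℝ) ^ (-(2 * c)) : ℝ) : ℂ)) -
      ∫ x in Set.Ioi (1 : ℝ), ((x ^ (-(2 * c)) : ℝ) : ℂ) := by
    rw [negZetaLogDeriv_eq (by rw [ofReal_re]; linarith), LSeries]
    simp_rw [← hterm]
    rw [integral_complex_ofReal, integral_Ioi_rpow_of_lt (by linarith) one_pos, Real.one_rpow,
      show -1 / (-(2 * c) + 1) = 1 / (2 * c - 1) by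
        rw [← neg_div_neg_eq]; congr 1 <;> ring]
    push_cast
    rfl
  have hsplit : ∑' n : ℕ, ((ArithmeticFunction.vonMangoldt n * ((max n 1 : ℕ) : ℝ) ^ (-(2 * c)) : ℝ) : ℂ) *
      exp (-(z * ((((max n 1 : ℕ) : ℝ) ^ (-1 : ℝ) : ℝ) : ℂ) ^ ℓ)) -
    ∫ x in Set.Ioi (1 : ℝ), ((x ^ (-(2 * c)) : ℝ) : ℂ) *
      exp (-(z * ((x ^ (-1 : ℝ) : ℝ) : ℂ) ^ ℓ)) = negZetaLogDeriv ((2 * c : ℝ) : ℂ) +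
      (∑' n : ℕ, ((ArithmeticFunction.vonMangoldt n * ((max n 1 : ℕ) : ℝ) ^ (-(2 * c)) : ℝ) : ℂ) *
      (exp (-(z * ((((max n 1 : ℕ) : ℝ) ^ (-1 : ℝ) : ℝ) : ℂ) ^ ℓ)) - 1)) -
      ∫ x in Set.Ioi (1 : ℝ), ((x ^ (-(2 * c)) : ℝ) : ℂ) *
      (exp (-(z * ((x ^ (-1 : ℝ) : ℝ) : ℂ) ^ ℓ)) - 1) := by
    simp_rw [mul_sub, mul_one]
    rw [h1.of_norm.tsum_sub hA, integral_sub h3 hI, hf]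
    ring
  have hb1 : ‖∑' n : ℕ, ((ArithmeticFunction.vonMangoldt n * ((max n 1 : ℕ) : ℝ) ^ (-(2 * c)) : ℝ) : ℂ) *
      (exp (-(z * ((((max n 1 : ℕ) : ℝ) ^ (-1 : ℝ) : ℝ) : ℂ) ^ ℓ)) - 1)‖ ≤
      10 * (∑' n : ℕ, ArithmeticFunction.vonMangoldt n * ((max n 1 : ℕ) : ℝ) ^ (-2 : ℝ)) := by
    rw [← tsum_mul_left]
    refine tsum_of_norm_bounded ((hsum 2 (by norm_num)).mul_left 10).hasSum fun n => ?_
    rw [norm_mul, norm_real, Real.norm_of_nonneg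
      (mul_nonneg ArithmeticFunction.vonMangoldt_nonneg (by positivity))]
    have hle : ((max n 1 : ℕ) : ℝ) ^ (-(2 * c)) ≤ ((max n 1 : ℕ) : ℝ) ^ (-1 : ℝ) :=
      Real.rpow_le_rpow_of_exponent_le (hpos n) (by linarith)
    calc _ ≤ ArithmeticFunction.vonMangoldt n * ((max n 1 : ℕ) : ℝ) ^ (-1 : ℝ) *
          (10 * ((max n 1 : ℕ) : ℝ)⁻¹) := by
          gcongr
          exact norm_exp_neg_mul_sub_one_le hℓ hz hz5 (hpos n)
      _ = _ := by
          have h0 : (0 : ℝ) < (max n 1 : ℕ) := by linarith [hpos n]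
          rw [show (-2 : ℝ) = -1 + -1 by norm_num, Real.rpow_add h0, Real.rpow_neg_one]
          ring
  have hb2 : ‖∫ x in Set.Ioi (1 : ℝ), ((x ^ (-(2 * c)) : ℝ) : ℂ) *
      (exp (-(z * ((x ^ (-1 : ℝ) : ℝ) : ℂ) ^ ℓ)) - 1)‖ ≤ 10 := by
    have hi := (integrableOn_Ioi_rpow_of_lt (a := -2) (by norm_num) one_pos).const_mul 10
    refine (norm_integral_le_of_norm_le hi ?_).trans_eq ?_
    · refine (ae_restrict_iff' measurableSet_Ioi).2 (Filter.Eventually.of_forall fun x hx => ?_)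
      have hx : 1 < x := hx
      rw [norm_mul, norm_real, Real.norm_of_nonneg (by positivity)]
      have hle : x ^ (-(2 * c)) ≤ x ^ (-1 : ℝ) :=
        Real.rpow_le_rpow_of_exponent_le hx.le (by linarith)
      calc _ ≤ x ^ (-1 : ℝ) * (10 * x⁻¹) := by
            gcongr
            exact norm_exp_neg_mul_sub_one_le hℓ hz hz5 hx.le
        _ = _ := by
          have h0 : (0 : ℝ) < x := by linarith
          rw [show (-2 : ℝ) = -1 + -1 by norm_num, Real.rpow_add h0, Real.rpow_neg_one]
          ring
    · rw [integral_const_mul, integral_Ioi_rpow_of_lt (by norm_num) one_pos]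
      norm_num
  have hb3 : ‖negZetaLogDeriv ((2 * c : ℝ) : ℂ)‖ ≤ max M 0 :=
    (hM ⟨2 * c, ⟨by linarith, by linarith⟩, rfl⟩).trans (le_max_left _ _)
  rw [hsplit]
  refine (norm_sub_le _ _).trans (add_le_add ((norm_add_le _ _).trans (add_le_add hb3 hb1)) hb2)

lemma exists_norm_gammaKernel_mul_negZetaLogDeriv_le (hRH : RiemannHypothesis) {ℓ : ℕ}
    (hℓ : 1 ≤ ℓ) {z : ℂ} (hz : 0 < z.re) {a₀ b₀ : ℝ} (ha₀ : 0 < a₀) (hb₀ : 1 / 2 < b₀)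
    (hb₁ : b₀ ≤ 1) (a₁ : ℝ) :
    ∃ C > 0, ∀ w s : ℂ, a₀ ≤ w.re → w.re ≤ a₁ → b₀ ≤ s.re → s.re ≤ 4 → |s.im| = |w.im| →
      ‖gammaKernel ℓ z w * negZetaLogDeriv s‖ ≤ C / (1 + w.im ^ 2) := by
  obtain ⟨C, hC, h⟩ := exists_norm_gammaKernel_mul_le hℓ ha₀ a₁ hz
  obtain ⟨K, hK, h'⟩ := exists_crude_bounds hRH hb₀ hb₁
  refine ⟨K * C, by positivity, fun w s h1 h2 h3 h4 h5 => ?_⟩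
  have hs := (h' s h3 h4).2
  rw [h5] at hs
  rw [norm_mul]
  calc ‖gammaKernel ℓ z w‖ * ‖negZetaLogDeriv s‖ ≤ ‖gammaKernel ℓ z w‖ * (K * (1 + |w.im|)) := by
        gcongr
    _ = K * (‖gammaKernel ℓ z w‖ * (1 + |w.im|)) := by ring
    _ ≤ K * (C / (1 + w.im ^ 2)) := mul_le_mul_of_nonneg_left (h w h1 h2) hK.le
    _ = _ := by ring

lemma negZetaLogDeriv_conj {s : ℂ} (hs : 1 / 2 < s.re) :
    negZetaLogDeriv (starRingEnd ℂ s) = starRingEnd ℂ (negZetaLogDeriv s) := by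
  have hd : deriv zetaMulSubOne (starRingEnd ℂ s) = starRingEnd ℂ (deriv zetaMulSubOne s) := by
    have h1 : (starRingEnd ℂ ∘ zetaMulSubOne ∘ starRingEnd ℂ) =ᶠ[nhds (starRingEnd ℂ s)]
        zetaMulSubOne := by
      have : {w : ℂ | 0 < w.re} ∈ nhds (starRingEnd ℂ s) :=
        (isOpen_lt continuous_const continuous_re).mem_nhds (by
          simp only [Set.mem_ofPred_eq, conj_re]; linarith)
      filter_upwards [this] with w hw
      simp only [Function.comp_apply]
      rw [zetaMulSubOne_conj hw, conj_conj]
    rw [← h1.deriv_eq, deriv_conj_conj]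
    simp only [Function.comp_apply, conj_conj]
  rw [negZetaLogDeriv, negZetaLogDeriv, hd, zetaMulSubOne_conj (by linarith), map_neg, map_div₀]

/-- The smoothed explicit formula: up to `O(1)`, the error in the exponential sum is an integral
against the real part of the logarithmic derivative of zeta alone. -/
lemma exists_norm_tsum_vonMangoldt_sub_le (hRH : RiemannHypothesis) {ℓ : ℕ} (hℓ : 1 ≤ ℓ) :
    ∃ C > 0, ∀ c : ℝ, 1 / 2 < c → c ≤ 1 → ∀ z : ℂ, 0 < z.re → ‖z‖ ≤ 5 →
    ‖(∑' n : ℕ, (ArithmeticFunction.vonMangoldt n : ℂ) * exp (-(z * (n : ℂ) ^ ℓ))) -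
      gammaKernel ℓ z 1 - (1 / Real.pi) *
        ∫ t : ℝ, gammaKernel ℓ z (c + t * I) * ((negZetaLogDeriv (c + t * I)).re : ℂ)‖ ≤ C := by
  obtain ⟨C, hC, hB⟩ := exists_norm_reflected_le hRH hℓ
  refine ⟨1 + C, by positivity, fun c hc hc1 z hz hz5 => ?_⟩
  have hB := hB c hc hc1 z hz hz5
  have hA := tsum_sub_integral_eq hℓ (a := 2) (p := 0) (ε := 1) two_pos (by norm_num) hz
  rw [tsum_sub_integral_eq hℓ (a := c - 1 / 2) (p := 2 * c) (ε := -1) (by linarith)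
    (by linarith) hz] at hB
  obtain ⟨D, hD, hbd⟩ := exists_norm_gammaKernel_mul_negZetaLogDeriv_le hRH hℓ hz
    (a₀ := c - 1 / 2) (by linarith) hc hc1 2
  have hshiftA : ∫ t : ℝ, gammaKernel ℓ z (c + t * I) * negZetaLogDeriv (c + t * I) =
      ∫ t : ℝ, gammaKernel ℓ z ((2 : ℝ) + t * I) * negZetaLogDeriv ((2 : ℝ) + t * I) :=
    integral_vertical_eq (F := fun w => gammaKernel ℓ z w * negZetaLogDeriv w) (by linarith)
      (fun w h1 _ => (differentiableAt_gammaKernel hℓ hz (by linarith)).mul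
        (differentiableAt_negZetaLogDeriv hRH (by linarith)))
      (fun w h1 h2 => hbd w w (by linarith) h2 h1 (by linarith) rfl)
  have hshiftB := integral_vertical_eq (a := c - 1 / 2) (b := c) (C := D)
      (F := fun w => gammaKernel ℓ z w * negZetaLogDeriv (2 * c - w)) (by linarith)
      (fun w h1 h2 => (differentiableAt_gammaKernel hℓ hz (by linarith)).mul
        (DifferentiableAt.comp (g := negZetaLogDeriv) w
          (differentiableAt_negZetaLogDeriv hRH (by simp; linarith)) (by fun_prop)))
      (fun w h1 h2 => hbd w _ h1 (by linarith) (by simp; linarith) (by simp; linarith)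
        (by simp))
  have hintA : Integrable fun t : ℝ =>
      gammaKernel ℓ z (c + t * I) * negZetaLogDeriv (c + t * I) := by
    refine integrable_of_norm_le_div_one_add_sq (C := D) (continuous_vertical_of_differentiableAt
      (F := fun w => gammaKernel ℓ z w * negZetaLogDeriv w)
      fun w hw => (differentiableAt_gammaKernel hℓ hz (by linarith)).mul
        (differentiableAt_negZetaLogDeriv hRH (by linarith))).aestronglyMeasurable fun t => ?_
    simpa using hbd (c + t * I) (c + t * I) (by simp) (by simp; linarith) (by simp)
      (by simp; linarith) rfl
  have hintB : Integrable fun t : ℝ =>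
      gammaKernel ℓ z (c + t * I) * negZetaLogDeriv (2 * c - (c + t * I)) := by
    refine integrable_of_norm_le_div_one_add_sq (C := D) (continuous_vertical_of_differentiableAt
      (F := fun w => gammaKernel ℓ z w * negZetaLogDeriv (2 * c - w))
      fun w hw => (differentiableAt_gammaKernel hℓ hz (by linarith)).mul
        (DifferentiableAt.comp (g := negZetaLogDeriv) w
          (differentiableAt_negZetaLogDeriv hRH (by simp; linarith))
          (by fun_prop))).aestronglyMeasurable fun t => ?_
    simpa using hbd (c + t * I) (2 * c - (c + t * I)) (by simp) (by simp; linarith)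
      (by simp; linarith) (by simp; linarith) (by simp)
  have hsum : (1 / Real.pi : ℂ) *
      ∫ t : ℝ, gammaKernel ℓ z (c + t * I) * ((negZetaLogDeriv (c + t * I)).re : ℂ) =
      1 / (2 * Real.pi) * (∫ t : ℝ, gammaKernel ℓ z (c + t * I) * negZetaLogDeriv (c + t * I)) +
      1 / (2 * Real.pi) *
        ∫ t : ℝ, gammaKernel ℓ z (c + t * I) * negZetaLogDeriv (2 * c - (c + t * I)) := by
    rw [← mul_add, ← integral_add hintA hintB, ← integral_const_mul, ← integral_const_mul]
    refine integral_congr_ae (Filter.Eventually.of_forall fun t => ?_)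
    have e : (2 * c - (c + t * I) : ℂ) = starRingEnd ℂ (c + t * I) := by
      simp only [map_add, map_mul, conj_ofReal, conj_I]
      ring
    simp only
    rw [e, negZetaLogDeriv_conj (by simpa using hc), ← mul_add, add_conj]
    push_cast
    ring
  have hK1 : gammaKernel ℓ z 1 = (∫ x in Set.Ioc (0 : ℝ) 1, exp (-(z * (x : ℂ) ^ ℓ))) +
      ∫ x in Set.Ioi (1 : ℝ), exp (-(z * (x : ℂ) ^ ℓ)) := by
    have hconv := mellinConvergent_exp_neg_mul_pow hℓ hz (w := 1) (by simp)
    have hmel := mellin_exp_neg_mul_pow hℓ hz (w := 1) (by simp)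
    simp only [MellinConvergent, mellin, sub_self, cpow_zero, one_smul] at hconv hmel
    rw [← hmel, ← Set.Ioc_union_Ioi_eq_Ioi zero_le_one, setIntegral_union
      (Set.Ioc_disjoint_Ioi le_rfl) measurableSet_Ioi
      (hconv.mono_set Set.Ioc_subset_Ioi_self)
      (hconv.mono_set (Set.Ioi_subset_Ioi zero_le_one))]
  have hsmall : ‖∫ x in Set.Ioc (0 : ℝ) 1, exp (-(z * (x : ℂ) ^ ℓ))‖ ≤ 1 := by
    have := norm_setIntegral_le_of_norm_le_const (μ := volume) (s := Set.Ioc (0 : ℝ) 1)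
      (f := fun x : ℝ => exp (-(z * (x : ℂ) ^ ℓ))) (C := 1) (by simp) (fun x hx => by
        rw [norm_exp]
        refine Real.exp_le_one_iff.2 ?_
        rw [neg_re, ← ofReal_pow, re_mul_ofReal]
        have := hx.1.le
        have : 0 ≤ z.re * x ^ ℓ := by positivity
        linarith)
    simpa using this
  have hA' : (∑' n : ℕ, (ArithmeticFunction.vonMangoldt n : ℂ) * exp (-(z * (n : ℂ) ^ ℓ))) -
      ∫ x in Set.Ioi (1 : ℝ), exp (-(z * (x : ℂ) ^ ℓ)) =
      1 / (2 * Real.pi) *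
        ∫ t : ℝ, gammaKernel ℓ z (c + t * I) * negZetaLogDeriv (c + t * I) := by
    rw [hshiftA]
    convert hA using 2
    · refine tsum_congr fun n => ?_
      rcases Nat.eq_zero_or_pos n with rfl | hn
      · simp
      · rw [max_eq_left (show 1 ≤ n from hn)]
        simp
    · simp
    · simp
  have hB' : 1 / (2 * Real.pi) *
        ∫ t : ℝ, gammaKernel ℓ z (c + t * I) * negZetaLogDeriv (2 * c - (c + t * I)) =
      1 / (2 * Real.pi) * ∫ t : ℝ, gammaKernel ℓ z ((c - 1 / 2 : ℝ) + t * I) *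
        negZetaLogDeriv ((2 * c : ℝ) + (-1 : ℝ) * ((c - 1 / 2 : ℝ) + t * I)) := by
    rw [← hshiftB]
    congr 2
    ext t
    congr 2
    push_cast
    ring
  rw [← hB'] at hB
  rw [hK1, hsum, ← hA', show ∀ a b d e : ℂ, a - (b + d) - (a - d + e) = -(b + e) by
    intros; ring, norm_neg]
  exact (norm_add_le _ _).trans (add_le_add hsmall hB)

lemma integral_gaussian_mul_exp (u₀ x : ℝ) :
    ∫ u : ℝ, (Real.exp (-(u - u₀) ^ 2) : ℂ) * exp (-(x * u * I)) =
      Real.sqrt Real.pi * exp (-(x * u₀ * I)) * Real.exp (-(x ^ 2 / 4)) := by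
  have h := fourierIntegral_gaussian (b := 1) (by simp) (-(x : ℂ))
  have hshift := integral_sub_right_eq_self (μ := volume)
    (fun u : ℝ => (Real.exp (-u ^ 2) : ℂ) * exp (-(x * u * I)) * exp (-(x * u₀ * I))) u₀
  calc ∫ u : ℝ, (Real.exp (-(u - u₀) ^ 2) : ℂ) * exp (-(x * u * I))
      = ∫ u : ℝ, (Real.exp (-(u - u₀) ^ 2) : ℂ) * exp (-(x * ((u - u₀ : ℝ) : ℂ) * I)) *
          exp (-(x * u₀ * I)) := by
        refine integral_congr_ae (Filter.Eventually.of_forall fun u => ?_)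
        simp only
        rw [mul_assoc (Real.exp _ : ℂ) (exp _), ← Complex.exp_add]
        congr 2
        push_cast
        ring
    _ = _ := by
        rw [hshift, integral_mul_const]
        have : ∫ u : ℝ, (Real.exp (-u ^ 2) : ℂ) * exp (-(x * u * I)) =
            ∫ u : ℝ, exp (I * (-x : ℂ) * u) * exp (-1 * (u : ℂ) ^ 2) := by
          refine integral_congr_ae (Filter.Eventually.of_forall fun u => ?_)
          simp only
          rw [mul_comm, ofReal_exp]
          congr 2
          · ring
          · push_cast; ring
        rw [this, h]
        have hpi : (Real.pi / 1 : ℂ) ^ (1 / 2 : ℂ) = Real.sqrt Real.pi := by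
          rw [div_one, Real.sqrt_eq_rpow, ofReal_cpow Real.pi_pos.le]
          norm_num
        rw [hpi, ofReal_exp]
        push_cast
        ring_nf

lemma lintegral_gaussian_mul_enorm_fourier_sq_le {b : ℝ → ℂ} (hb : Integrable b) (u₀ : ℝ) :
    ∫⁻ u : ℝ, ENNReal.ofReal (Real.exp (-(u - u₀) ^ 2)) *
        ‖∫ t : ℝ, b t * exp (-(t * u * I))‖ₑ ^ 2 ≤
      ENNReal.ofReal (Real.sqrt Real.pi) * ∫⁻ t : ℝ, ∫⁻ s : ℝ,
        ‖b t‖ₑ * ‖b s‖ₑ * ENNReal.ofReal (Real.exp (-((t - s) ^ 2 / 4))) := by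
  set B : ℝ → ℂ := fun u => ∫ t : ℝ, b t * exp (-(t * u * I)) with hB
  set g : ℝ → ℝ := fun u => Real.exp (-(u - u₀) ^ 2) with hg
  have hgi : Integrable g := by
    have := (integrable_exp_neg_mul_sq (b := 1) one_pos).comp_sub_right u₀
    simpa [hg] using this
  have hbb : Integrable (fun p : ℝ × ℝ => b p.1 * starRingEnd ℂ (b p.2)) (volume.prod volume) :=
    hb.mul_prod (RCLike.conjCLE.toContinuousLinearMap.integrable_comp hb)
  have hB2 : ∀ u, ((‖B u‖ ^ 2 : ℝ) : ℂ) = ∫ p : ℝ × ℝ,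
      b p.1 * starRingEnd ℂ (b p.2) * exp (-((p.1 - p.2) * u * I)) := by
    intro u
    have h1 : starRingEnd ℂ (B u) = ∫ t : ℝ, starRingEnd ℂ (b t) * exp (t * u * I) := by
      rw [hB, ← integral_conj]
      refine integral_congr_ae (Filter.Eventually.of_forall fun t => ?_)
      simp [← exp_conj]
    have h2 := integral_prod_mul (μ := volume) (ν := volume)
      (fun t : ℝ => b t * exp (-(t * u * I))) (fun t : ℝ => starRingEnd ℂ (b t) * exp (t * u * I))
    rw [ofReal_pow, ← mul_conj', h1, hB]
    simp only
    rw [← h2]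
    refine integral_congr_ae (Filter.Eventually.of_forall fun p => ?_)
    simp only
    rw [show (-((p.1 - p.2) * u * I) : ℂ) = -(p.1 * u * I) + p.2 * u * I by ring, exp_add]
    ring
  have hInt : Integrable (fun q : ℝ × (ℝ × ℝ) => (g q.1 : ℂ) *
      (b q.2.1 * starRingEnd ℂ (b q.2.2) * exp (-((q.2.1 - q.2.2) * q.1 * I))))
      (volume.prod (volume.prod volume)) := by
    have h0 := hgi.ofReal (𝕜 := ℂ).mul_prod hbb
    refine h0.mono ?_ (Filter.Eventually.of_forall fun q => ?_)
    · have h1 : Continuous fun q : ℝ × (ℝ × ℝ) => exp (-((q.2.1 - q.2.2) * q.1 * I) : ℂ) := by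
        fun_prop
      refine (h0.aestronglyMeasurable.mul h1.aestronglyMeasurable).congr
        (Filter.Eventually.of_forall fun q => ?_)
      simp only [Pi.mul_apply]
      simp [mul_assoc]
    · have : ‖exp (-((q.2.1 - q.2.2) * q.1 * I) : ℂ)‖ = 1 := by
        rw [norm_exp]; simp
      simp only [norm_mul, this, mul_one]
      exact le_rfl
  have hmain : (∫ u, ((g u * ‖B u‖ ^ 2 : ℝ) : ℂ)) = ∫ p : ℝ × ℝ,
      b p.1 * starRingEnd ℂ (b p.2) *
        (Real.sqrt Real.pi * exp (-(((p.1 - p.2 : ℝ) : ℂ) * u₀ * I)) *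
          Real.exp (-((p.1 - p.2) ^ 2 / 4))) := by
    have e1 : ∀ u, ((g u * ‖B u‖ ^ 2 : ℝ) : ℂ) = ∫ p : ℝ × ℝ, (g u : ℂ) *
        (b p.1 * starRingEnd ℂ (b p.2) * exp (-((p.1 - p.2) * u * I))) := by
      intro u
      rw [ofReal_mul, hB2, integral_const_mul]
    simp_rw [e1]
    rw [integral_integral_swap hInt]
    refine integral_congr_ae (Filter.Eventually.of_forall fun p => ?_)
    simp only
    rw [← integral_gaussian_mul_exp, ← integral_const_mul]
    refine integral_congr_ae (Filter.Eventually.of_forall fun u => ?_)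
    simp only [hg]
    push_cast
    ring
  have hBi : Integrable fun u => g u * ‖B u‖ ^ 2 := by
    have := hInt.integral_prod_left
    refine (this.norm).congr (Filter.Eventually.of_forall fun u => ?_)
    simp only
    rw [integral_const_mul, ← Measure.volume_eq_prod, ← hB2, ← ofReal_mul, Complex.norm_real,
      Real.norm_eq_abs,
      abs_of_nonneg (by positivity)]
  calc ∫⁻ u : ℝ, ENNReal.ofReal (g u) * ‖B u‖ₑ ^ 2
      = ∫⁻ u : ℝ, ENNReal.ofReal (g u * ‖B u‖ ^ 2) := by
        refine lintegral_congr fun u => ?_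
        rw [ENNReal.ofReal_mul (Real.exp_pos _).le, ENNReal.ofReal_pow (norm_nonneg _),
          ofReal_norm]
    _ = ENNReal.ofReal (∫ u, g u * ‖B u‖ ^ 2) := by
        rw [ofReal_integral_eq_lintegral_ofReal hBi
          (Filter.Eventually.of_forall fun u => by positivity)]
    _ ≤ ‖∫ u, ((g u * ‖B u‖ ^ 2 : ℝ) : ℂ)‖ₑ := by
        rw [integral_complex_ofReal, ← ofReal_norm, Complex.norm_real]
        exact ENNReal.ofReal_le_ofReal (le_abs_self _)
    _ ≤ ∫⁻ p : ℝ × ℝ, ENNReal.ofReal (Real.sqrt Real.pi) *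
        (‖b p.1‖ₑ * ‖b p.2‖ₑ * ENNReal.ofReal (Real.exp (-((p.1 - p.2) ^ 2 / 4)))) := by
        rw [hmain]
        refine (enorm_integral_le_lintegral_enorm _).trans (lintegral_mono fun p => ?_)
        have h1 : ‖exp (-(((p.1 - p.2 : ℝ) : ℂ) * u₀ * I))‖ₑ = 1 := by
          rw [← ofReal_norm, norm_exp]; simp
        have h2 : ‖starRingEnd ℂ (b p.2)‖ₑ = ‖b p.2‖ₑ := by
          rw [← ofReal_norm, ← ofReal_norm, RCLike.norm_conj]
        have h3 : ∀ x : ℝ, 0 ≤ x → ‖(x : ℂ)‖ₑ = ENNReal.ofReal x := by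
          intro x hx
          rw [← ofReal_norm, Complex.norm_real, Real.norm_eq_abs, abs_of_nonneg hx]
        simp only [enorm_mul, h1, h2, mul_one]
        rw [h3 _ (Real.sqrt_nonneg _), h3 _ (Real.exp_pos _).le]
        exact le_of_eq (by ring)
    _ = _ := by
        have hm : AEMeasurable (fun p : ℝ × ℝ => ‖b p.1‖ₑ * ‖b p.2‖ₑ *
            ENNReal.ofReal (Real.exp (-((p.1 - p.2) ^ 2 / 4)))) (volume.prod volume) := by
          refine ((hb.aestronglyMeasurable.enorm.comp_fst).mul
            (hb.aestronglyMeasurable.enorm.comp_snd)).mul ?_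
          fun_prop
        rw [lintegral_const_mul' _ _ ENNReal.ofReal_ne_top, Measure.volume_eq_prod, lintegral_prod _ hm]

lemma measurable_smoothKernel_sub :
    Measurable fun p : ℝ × ℝ => ENNReal.ofReal (smoothKernel (p.2 - p.1)) :=
  (continuous_smoothKernel.measurable.comp (measurable_snd.sub measurable_fst)).ennreal_ofReal

lemma lintegral_lintegral_mul_smoothKernel_le {m : ℝ → ℂ} (hm : Measurable m) {b : ℝ → ℂ}
    {F d W : ℝ → ENNReal} (hd : Measurable d) (hW : Measurable W) {Q : ENNReal} (hQ : Q ≠ ⊤)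
    (hmF : ∀ t, ∫⁻ s, ‖m s‖ₑ * ENNReal.ofReal (smoothKernel (s - t)) ≤ F t)
    (hdW : ∀ t, d t ^ 2 * F t ≤ W t) (hWQ : ∀ s t, |s - t| ≤ 1 → W t ≤ Q * W s)
    (hb : ∀ t, ‖b t‖ₑ ≤ d t * ‖m t‖ₑ) :
    ∫⁻ t : ℝ, ∫⁻ s : ℝ, ‖b t‖ₑ * ‖b s‖ₑ * ENNReal.ofReal (smoothKernel (s - t)) ≤
      2 * (Q * 100 * ∫⁻ t, W t * F t) := by
  have hme : Measurable fun t => ‖m t‖ₑ := hm.enorm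
  have hχ := measurable_smoothKernel_sub
  have hχ1 : ∀ t, Measurable fun s => ENNReal.ofReal (smoothKernel (s - t)) := fun t =>
    (continuous_smoothKernel.measurable.comp (measurable_id.sub measurable_const)).ennreal_ofReal
  have hmχ : ∀ t, Measurable fun s => ‖m s‖ₑ * ENNReal.ofReal (smoothKernel (s - t)) := fun t =>
    hme.mul (hχ1 t)
  have hχs : ∀ s t, smoothKernel (s - t) = smoothKernel (t - s) := fun s t => by
    rw [← smoothKernel_neg, neg_sub]
  have hmeas : Measurable fun p : ℝ × ℝ => d p.1 ^ 2 * ‖m p.1‖ₑ *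
      (‖m p.2‖ₑ * ENNReal.ofReal (smoothKernel (p.2 - p.1))) :=
    (((hd.comp measurable_fst).pow_const 2).mul (hme.comp measurable_fst)).mul
      ((hme.comp measurable_snd).mul hχ)
  have hfirst : ∫⁻ t : ℝ, ∫⁻ s : ℝ, d t ^ 2 * ‖m t‖ₑ *
      (‖m s‖ₑ * ENNReal.ofReal (smoothKernel (s - t))) ≤ Q * 100 * ∫⁻ t, W t * F t := by
    have hWavg : ∀ t, W t ≤ Q * 100 * ∫⁻ s, W s * ENNReal.ofReal (smoothKernel (s - t)) := by
      intro t
      have h1 : ∀ s ∈ Set.Icc t (t + 1), W t ≤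
          Q * 100 * (W s * ENNReal.ofReal (smoothKernel (s - t))) := by
        intro s hs
        have habs : |s - t| ≤ 1 := abs_le.2 ⟨by linarith [hs.1], by linarith [hs.2]⟩
        have hk : (1 : ENNReal) ≤ 100 * ENNReal.ofReal (smoothKernel (s - t)) := by
          rw [show (100 : ENNReal) = ENNReal.ofReal 100 by simp,
            ← ENNReal.ofReal_mul (by norm_num), ← ENNReal.ofReal_one]
          refine ENNReal.ofReal_le_ofReal ?_
          have h2 : (s - t) ^ 2 ≤ 1 := by
            rw [← sq_abs]; exact pow_le_one₀ (abs_nonneg _) habs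
          rw [smoothKernel, ← div_eq_mul_inv, le_div_iff₀ (by positivity), one_mul]
          nlinarith [sq_nonneg (s - t)]
        calc W t ≤ Q * W s * 1 := by rw [mul_one]; exact hWQ s t habs
          _ ≤ Q * W s * (100 * ENNReal.ofReal (smoothKernel (s - t))) := by gcongr
          _ = _ := by ring
      calc W t = ∫⁻ _ in Set.Icc t (t + 1), W t := by simp
        _ ≤ ∫⁻ s in Set.Icc t (t + 1), Q * 100 * (W s * ENNReal.ofReal (smoothKernel (s - t))) :=
          setLIntegral_mono' measurableSet_Icc h1
        _ ≤ ∫⁻ s, Q * 100 * (W s * ENNReal.ofReal (smoothKernel (s - t))) :=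
          setLIntegral_le_lintegral _ _
        _ = _ := lintegral_const_mul _ (hW.mul (hχ1 t))
    calc _ ≤ ∫⁻ t : ℝ, ‖m t‖ₑ * W t := by
          refine lintegral_mono fun t => ?_
          simp only
          rw [lintegral_const_mul _ (hmχ t)]
          calc _ ≤ d t ^ 2 * ‖m t‖ₑ * F t := by gcongr; exact hmF t
            _ = ‖m t‖ₑ * (d t ^ 2 * F t) := by ring
            _ ≤ _ := by gcongr; exact hdW t
      _ ≤ ∫⁻ t : ℝ, ∫⁻ s : ℝ, Q * 100 *
          (W s * (‖m t‖ₑ * ENNReal.ofReal (smoothKernel (s - t)))) := by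
          refine lintegral_mono fun t => ?_
          calc _ ≤ ‖m t‖ₑ * (Q * 100 * ∫⁻ s, W s * ENNReal.ofReal (smoothKernel (s - t))) := by
                gcongr; exact hWavg t
            _ = (‖m t‖ₑ * (Q * 100)) * ∫⁻ s, W s * ENNReal.ofReal (smoothKernel (s - t)) := by
                ring
            _ = ∫⁻ s, (‖m t‖ₑ * (Q * 100)) *
                (W s * ENNReal.ofReal (smoothKernel (s - t))) :=
              (lintegral_const_mul _ (hW.mul (hχ1 t))).symm
            _ = _ := lintegral_congr fun s => by ring
      _ = ∫⁻ s : ℝ, ∫⁻ t : ℝ, Q * 100 *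
          (W s * (‖m t‖ₑ * ENNReal.ofReal (smoothKernel (s - t)))) := by
          refine lintegral_lintegral_swap (Measurable.aemeasurable ?_)
          exact ((hW.comp measurable_snd).mul ((hme.comp measurable_fst).mul hχ)).const_mul _
      _ ≤ ∫⁻ s : ℝ, Q * 100 * (W s * F s) := by
          refine lintegral_mono fun s => ?_
          have : ∀ t, Q * 100 * (W s * (‖m t‖ₑ * ENNReal.ofReal (smoothKernel (s - t)))) =
              Q * 100 * W s * (‖m t‖ₑ * ENNReal.ofReal (smoothKernel (t - s))) := fun t => by
            rw [hχs s t]; ring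
          simp_rw [this]
          rw [lintegral_const_mul _ (hmχ s), mul_assoc]
          gcongr
          exact hmF s
      _ ≤ _ := by
          rw [lintegral_const_mul' _ _ (ENNReal.mul_ne_top hQ (by simp))]
  calc _ ≤ ∫⁻ t : ℝ, ∫⁻ s : ℝ, (d t ^ 2 * ‖m t‖ₑ *
        (‖m s‖ₑ * ENNReal.ofReal (smoothKernel (s - t))) + d s ^ 2 * ‖m s‖ₑ *
        (‖m t‖ₑ * ENNReal.ofReal (smoothKernel (t - s)))) := by
        refine lintegral_mono fun t => lintegral_mono fun s => ?_
        have hdd : d t * d s ≤ d t ^ 2 + d s ^ 2 := by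
          rcases le_total (d t) (d s) with h | h
          · calc d t * d s ≤ d s * d s := by gcongr
              _ ≤ _ := by rw [sq (d s)]; exact le_add_self
          · calc d t * d s ≤ d t * d t := by gcongr
              _ ≤ _ := by rw [sq (d t)]; exact le_self_add
        calc _ ≤ (d t * ‖m t‖ₑ) * (d s * ‖m s‖ₑ) * ENNReal.ofReal (smoothKernel (s - t)) := by
              gcongr
              · exact hb t
              · exact hb s
          _ = (d t * d s) * (‖m t‖ₑ * ‖m s‖ₑ * ENNReal.ofReal (smoothKernel (s - t))) := by ring
          _ ≤ (d t ^ 2 + d s ^ 2) *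
              (‖m t‖ₑ * ‖m s‖ₑ * ENNReal.ofReal (smoothKernel (s - t))) := by gcongr
          _ = _ := by rw [hχs t s]; ring
    _ = (∫⁻ t : ℝ, ∫⁻ s : ℝ, d t ^ 2 * ‖m t‖ₑ *
          (‖m s‖ₑ * ENNReal.ofReal (smoothKernel (s - t)))) +
        ∫⁻ t : ℝ, ∫⁻ s : ℝ, d s ^ 2 * ‖m s‖ₑ *
          (‖m t‖ₑ * ENNReal.ofReal (smoothKernel (t - s))) := by
        rw [← lintegral_add_left hmeas.lintegral_prod_right']
        refine lintegral_congr fun t => ?_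
        exact lintegral_add_left (hmeas.comp measurable_prodMk_left) _
    _ ≤ _ := by
        rw [two_mul]
        refine add_le_add hfirst (le_of_eq_of_le ?_ hfirst)
        exact lintegral_lintegral_swap (Measurable.aemeasurable (hmeas.comp measurable_swap))

lemma exists_lintegral_one_add_abs_rpow_mul_exp_le {κ : ℝ} (hκ : 0 < κ) :
    ∃ C > 0, ∀ p : ℝ, κ ≤ p + 1 → p ≤ 1 → ∀ ψ : ℝ, 0 < ψ → ψ ≤ 1 →
      ∫⁻ t : ℝ, ENNReal.ofReal ((1 + |t|) ^ p * Real.exp (-(ψ * |t|))) ≤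
        ENNReal.ofReal (C * ψ ^ (-(p + 1))) := by
  obtain ⟨C, hC, hΓ⟩ := exists_norm_Gamma_le (a₀ := min κ (1 / 2)) (a₁ := 2)
    (lt_min hκ (by norm_num)) (min_le_right _ _) (by norm_num)
  refine ⟨2 * (Real.exp 1 * C), by positivity, fun p hp hp1 ψ hψ hψ1 => ?_⟩
  have hp0 : 0 < p + 1 := hκ.trans_le hp
  have hΓp : Real.Gamma (p + 1) ≤ C := by
    have := hΓ ((p + 1 : ℝ) : ℂ) (by simpa using Or.inl hp) (by rw [ofReal_re]; linarith)
    rw [Complex.Gamma_ofReal, Complex.norm_real, Real.norm_eq_abs] at this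
    refine (le_abs_self _).trans (this.trans_eq ?_)
    simp
  set h : ℝ → ENNReal := Set.indicator (Set.Ioi 0) fun x =>
    ENNReal.ofReal (Real.exp 1 * (x ^ p * Real.exp (-(ψ * x)))) with hh
  have hInt : ∫⁻ x, h x ≤ ENNReal.ofReal (Real.exp 1 * C * ψ ^ (-(p + 1))) := by
    have e := Real.integral_rpow_mul_exp_neg_mul_Ioi hp0 hψ
    rw [add_sub_cancel_right] at e
    have hpos : 0 < (1 / ψ) ^ (p + 1) * Real.Gamma (p + 1) :=
      mul_pos (by positivity) (Real.Gamma_pos_of_pos hp0)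
    have hi : IntegrableOn (fun x => x ^ p * Real.exp (-(ψ * x))) (Set.Ioi 0) :=
      Integrable.of_integral_ne_zero (by rw [e]; exact hpos.ne')
    rw [hh, lintegral_indicator measurableSet_Ioi, ← ofReal_integral_eq_lintegral_ofReal
      (hi.const_mul _) ((ae_restrict_iff' measurableSet_Ioi).2
        (Filter.Eventually.of_forall fun x (hx : 0 < x) => by positivity)),
      integral_const_mul, e]
    refine ENNReal.ofReal_le_ofReal ?_
    rw [one_div, Real.inv_rpow hψ.le, ← Real.rpow_neg hψ.le, mul_comm (ψ ^ _), mul_assoc]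
    gcongr
  have hle : ∀ t : ℝ, ENNReal.ofReal ((1 + |t|) ^ p * Real.exp (-(ψ * |t|))) ≤
      h (1 + t) + h (1 - t) := by
    have key : ∀ x : ℝ, 0 ≤ x →
        ENNReal.ofReal ((1 + x) ^ p * Real.exp (-(ψ * x))) ≤ h (1 + x) := by
      intro x hx
      rw [hh, Set.indicator_of_mem (show 1 + x ∈ Set.Ioi (0 : ℝ) from by
        simp only [Set.mem_Ioi]; linarith)]
      refine ENNReal.ofReal_le_ofReal ?_
      rw [mul_left_comm, ← Real.exp_add]
      gcongr
      linarith
    intro t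
    rcases abs_cases t with ⟨ht, ht'⟩ | ⟨ht, ht'⟩
    · rw [ht]
      exact (key t ht').trans le_self_add
    · rw [ht, sub_eq_add_neg]
      exact (key (-t) (by linarith)).trans le_add_self
  have hm : Measurable h := by
    refine Measurable.indicator ?_ measurableSet_Ioi
    fun_prop
  calc _ ≤ ∫⁻ t : ℝ, (h (1 + t) + h (1 - t)) := lintegral_mono hle
    _ = (∫⁻ t, h t) + ∫⁻ t, h t := by
      rw [lintegral_add_left (show Measurable fun t => h (1 + t) from
          hm.comp (measurable_const_add 1)),
        lintegral_add_left_eq_self h 1, lintegral_sub_left_eq_self h 1]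
    _ ≤ _ := by
      rw [← two_mul, show 2 * (Real.exp 1 * C) * ψ ^ (-(p + 1)) =
        2 * (Real.exp 1 * C * ψ ^ (-(p + 1))) by ring, ENNReal.ofReal_mul zero_le_two,
        ENNReal.ofReal_ofNat]
      gcongr

lemma exp_neg_sq_div_four_le (x : ℝ) : Real.exp (-(x ^ 2 / 4)) ≤ 81 * smoothKernel x := by
  have h1 : x ^ 2 / 8 + 1 ≤ Real.exp (x ^ 2 / 8) := Real.add_one_le_exp _
  have h2 : Real.exp (x ^ 2 / 4) = Real.exp (x ^ 2 / 8) ^ 2 := by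
    rw [← Real.exp_nat_mul]; congr 1; push_cast; ring
  have h3 : (x ^ 2 / 8 + 1) ^ 2 ≤ Real.exp (x ^ 2 / 8) ^ 2 := by gcongr
  rw [smoothKernel, Real.exp_neg, h2, ← div_eq_mul_inv, inv_eq_one_div,
    div_le_div_iff₀ (by positivity) (by positivity)]
  nlinarith [sq_nonneg (x ^ 2), sq_nonneg x]

lemma one_add_abs_rpow_le {p : ℝ} (hp : |p| ≤ 1) {s t : ℝ} (hst : |s - t| ≤ 1) :
    (1 + |t|) ^ p ≤ 2 * (1 + |s|) ^ p := by
  have hts : |t| ≤ |s| + 1 := by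
    have := abs_sub_abs_le_abs_sub t s
    rw [abs_sub_comm t s] at this; linarith
  have hst' : |s| ≤ |t| + 1 := by
    have := abs_sub_abs_le_abs_sub s t
    linarith
  have h1 : (1 + |t|) / (1 + |s|) ≤ 2 := by
    rw [div_le_iff₀ (by positivity)]; linarith [abs_nonneg s]
  have h2 : 1 / 2 ≤ (1 + |t|) / (1 + |s|) := by
    rw [le_div_iff₀ (by positivity)]; linarith [abs_nonneg t]
  have h3 : ((1 + |t|) / (1 + |s|)) ^ p ≤ 2 := by
    rcases le_total 0 p with h | h
    · calc _ ≤ (2 : ℝ) ^ p := by gcongr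
        _ ≤ 2 ^ (1 : ℝ) := Real.rpow_le_rpow_of_exponent_le one_le_two (abs_le.1 hp).2
        _ = 2 := Real.rpow_one 2
    · calc _ ≤ (1 / 2 : ℝ) ^ p := Real.rpow_le_rpow_of_nonpos (by norm_num) h2 h
        _ = 2 ^ (-p) := by rw [one_div, Real.inv_rpow zero_le_two, Real.rpow_neg zero_le_two]
        _ ≤ 2 ^ (1 : ℝ) :=
          Real.rpow_le_rpow_of_exponent_le one_le_two (by linarith [(abs_le.1 hp).1])
        _ = 2 := Real.rpow_one 2
  rwa [Real.div_rpow (by positivity) (by positivity), div_le_iff₀ (by positivity)] at h3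

lemma integrable_of_norm_le_mul_exp {b : ℝ → ℂ} (hb : Continuous b) {A ψ : ℝ} (hA : 0 ≤ A)
    (hψ : 0 < ψ) (n : ℕ) (h : ∀ t, ‖b t‖ ≤ A * ((1 + |t|) ^ n * Real.exp (-(ψ * |t|)))) :
    Integrable b := by
  obtain ⟨C, hC, hCb⟩ := exists_pow_mul_exp_neg_le (n + 2) hψ
  refine integrable_of_norm_le_div_one_add_sq (C := A * C) hb.aestronglyMeasurable fun t => ?_
  rw [le_div_iff₀ (by positivity)]
  calc ‖b t‖ * (1 + t ^ 2)
      ≤ A * ((1 + |t|) ^ n * Real.exp (-(ψ * |t|))) * (1 + |t|) ^ 2 := by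
        gcongr
        · exact h t
        · nlinarith [sq_abs t, abs_nonneg t]
    _ = A * ((1 + |t|) ^ (n + 2) * Real.exp (-(ψ * |t|))) := by ring
    _ ≤ A * C := by gcongr; exact hCb _ (abs_nonneg t)

lemma continuous_re_negZetaLogDeriv (hRH : RiemannHypothesis) {c : ℝ} (hc : 1 / 2 < c) :
    Continuous fun t : ℝ => (negZetaLogDeriv (c + t * I)).re :=
  continuous_re.comp (continuous_vertical_of_differentiableAt fun w hw =>
    differentiableAt_negZetaLogDeriv hRH (by rw [hw]; exact hc))

lemma exists_abs_re_negZetaLogDeriv_le (hRH : RiemannHypothesis) {c : ℝ} (hc : 1 / 2 < c)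
    (hc1 : c ≤ 1) :
    ∃ K > 0, ∀ t : ℝ, |(negZetaLogDeriv (c + t * I)).re| ≤ K * (1 + |t|) := by
  obtain ⟨K, hK, h⟩ := exists_crude_bounds hRH hc hc1
  refine ⟨K, hK, fun t => (abs_re_le_norm _).trans ?_⟩
  simpa using (h (c + t * I) (by simp) (by simp; linarith)).2

lemma one_add_abs_rpow_half_le {p : ℝ} (hp1 : p ≤ 1) (t : ℝ) :
    (1 + |t|) ^ (p / 2) ≤ 1 + |t| := by
  calc (1 + |t|) ^ (p / 2) ≤ (1 + |t|) ^ (1 : ℝ) :=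
        Real.rpow_le_rpow_of_exponent_le (by linarith [abs_nonneg t]) (by linarith)
    _ = _ := Real.rpow_one _

lemma exists_lintegral_gaussian_mul_enorm_sq_le (hRH : RiemannHypothesis) {κ : ℝ} (hκ : 0 < κ) :
    ∃ C > 0, ∀ c : ℝ, 1 / 2 < c → c ≤ 1 → ∀ A Λ ψ p : ℝ, 0 ≤ A → 0 ≤ Λ → 0 < ψ → ψ ≤ 1 →
      κ ≤ p + 1 → p ≤ 1 → (∀ t : ℝ, Real.log (|t| + 3) ≤ Λ * Real.exp (ψ * |t| / 2)) →
      ∀ b : ℝ → ℂ, Continuous b →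
      (∀ t, ‖b t‖ ≤ A * (1 + |t|) ^ (p / 2) * Real.exp (-(ψ * |t|)) *
        |(negZetaLogDeriv (c + t * I)).re|) →
      ∀ u₀ : ℝ, ∫⁻ u : ℝ, ENNReal.ofReal (Real.exp (-(u - u₀) ^ 2)) *
        ‖∫ t : ℝ, b t * exp (-(t * u * I))‖ₑ ^ 2 ≤
        ENNReal.ofReal (C * (A ^ 2 * Λ ^ 2 * ψ ^ (-(p + 1)))) := by
  obtain ⟨K, hK, hKb⟩ := exists_integral_abs_re_negZetaLogDeriv_mul_le hRH
  obtain ⟨C, hC, hCb⟩ := exists_lintegral_one_add_abs_rpow_mul_exp_le hκ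
  refine ⟨Real.sqrt Real.pi * 81 * (2 * (2 * Real.exp (3 / 2) * 100 * (K ^ 2 * C))),
    by positivity, ?_⟩
  intro c hc hc1 A Λ ψ p hA hΛ hψ hψ1 hp hp1 hlog b hb hbm u₀
  set m : ℝ → ℂ := fun t => ((negZetaLogDeriv (c + t * I)).re : ℂ) with hmdef
  have hmc : Continuous m := continuous_ofReal.comp (continuous_re_negZetaLogDeriv hRH hc)
  have hmn : ∀ t, ‖m t‖ₑ = ENNReal.ofReal |(negZetaLogDeriv (c + t * I)).re| := fun t => by
    rw [← ofReal_norm, hmdef, Complex.norm_real, Real.norm_eq_abs]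
  obtain ⟨K', hK', hmK'⟩ := exists_abs_re_negZetaLogDeriv_le hRH hc hc1
  have hbi : Integrable b := by
    refine integrable_of_norm_le_mul_exp hb (A := A * K') (by positivity) hψ 2 fun t => ?_
    calc ‖b t‖ ≤ A * (1 + |t|) * Real.exp (-(ψ * |t|)) * (K' * (1 + |t|)) := by
          refine (hbm t).trans ?_
          gcongr
          · exact one_add_abs_rpow_half_le hp1 t
          · exact hmK' t
      _ = _ := by ring
  set d : ℝ → ENNReal := fun t =>
    ENNReal.ofReal (A * (1 + |t|) ^ (p / 2) * Real.exp (-(ψ * |t|))) with hd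
  set F : ℝ → ENNReal := fun t => ENNReal.ofReal (K * Real.log (|t| + 3)) with hF
  set W : ℝ → ENNReal := fun t =>
    ENNReal.ofReal (A ^ 2 * (K * Λ) * ((1 + |t|) ^ p * Real.exp (-(3 / 2 * ψ * |t|)))) with hW
  have hpow : ∀ t : ℝ, ((1 + |t|) ^ (p / 2)) ^ 2 = (1 + |t|) ^ p := fun t => by
    rw [← Real.rpow_natCast, ← Real.rpow_mul (by positivity)]
    congr 1
    push_cast
    ring
  have hlog0 : ∀ t : ℝ, 0 ≤ Real.log (|t| + 3) := fun t => by linarith [log_abs_add_three_pos t]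
  have key := lintegral_lintegral_mul_smoothKernel_le hmc.measurable (b := b) (F := F) (d := d)
    (W := W) (by fun_prop) (by fun_prop) (Q := ENNReal.ofReal (2 * Real.exp (3 / 2)))
    ENNReal.ofReal_ne_top (fun t => by
      obtain ⟨h1, h2⟩ := hKb c hc hc1 t
      simp_rw [hmn, ← ENNReal.ofReal_mul (abs_nonneg _)]
      rw [← ofReal_integral_eq_lintegral_ofReal h1 (Filter.Eventually.of_forall fun s =>
        mul_nonneg (abs_nonneg _) (smoothKernel_pos _).le)]
      exact ENNReal.ofReal_le_ofReal h2)
    (fun t => by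
      simp only [hd, hF, hW]
      rw [← ENNReal.ofReal_pow (by positivity), ← ENNReal.ofReal_mul (by positivity)]
      refine ENNReal.ofReal_le_ofReal ?_
      calc _ ≤ (A * (1 + |t|) ^ (p / 2) * Real.exp (-(ψ * |t|))) ^ 2 *
            (K * (Λ * Real.exp (ψ * |t| / 2))) := by gcongr; exact hlog t
        _ = A ^ 2 * (K * Λ) * ((1 + |t|) ^ p *
            (Real.exp (-(ψ * |t|)) ^ 2 * Real.exp (ψ * |t| / 2))) := by
            rw [mul_pow, mul_pow, hpow]; ring
        _ ≤ _ := by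
            rw [← Real.exp_nat_mul, ← Real.exp_add]
            refine le_of_eq ?_
            congr 4
            push_cast
            ring)
    (fun s t hst => by
      simp only [hW]
      rw [← ENNReal.ofReal_mul (by positivity)]
      refine ENNReal.ofReal_le_ofReal ?_
      have hs : |s| ≤ |t| + 1 := by
        have := abs_sub_abs_le_abs_sub s t
        linarith
      have h1 := one_add_abs_rpow_le (p := p) (abs_le.2 ⟨by linarith, hp1⟩) hst
      have h2 : Real.exp (-(3 / 2 * ψ * |t|)) ≤
          Real.exp (3 / 2) * Real.exp (-(3 / 2 * ψ * |s|)) := by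
        rw [← Real.exp_add, Real.exp_le_exp]
        nlinarith
      calc _ ≤ A ^ 2 * (K * Λ) * ((2 * (1 + |s|) ^ p) *
            (Real.exp (3 / 2) * Real.exp (-(3 / 2 * ψ * |s|)))) := by gcongr
        _ = _ := by ring)
    (fun t => by
      rw [hmn, hd, ← ENNReal.ofReal_mul (by positivity), ← ofReal_norm]
      exact ENNReal.ofReal_le_ofReal (hbm t))
  have hWF : ∫⁻ t, W t * F t ≤ ENNReal.ofReal (A ^ 2 * K ^ 2 * Λ ^ 2 * (C * ψ ^ (-(p + 1)))) := by
    calc ∫⁻ t, W t * F t ≤ ∫⁻ t : ℝ, ENNReal.ofReal (A ^ 2 * K ^ 2 * Λ ^ 2) *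
          ENNReal.ofReal ((1 + |t|) ^ p * Real.exp (-(ψ * |t|))) := by
          refine lintegral_mono fun t => ?_
          simp only [hW, hF]
          rw [← ENNReal.ofReal_mul (by positivity), ← ENNReal.ofReal_mul (by positivity)]
          refine ENNReal.ofReal_le_ofReal ?_
          calc _ ≤ A ^ 2 * (K * Λ) * ((1 + |t|) ^ p * Real.exp (-(3 / 2 * ψ * |t|))) *
                (K * (Λ * Real.exp (ψ * |t| / 2))) := by gcongr; exact hlog t
            _ = A ^ 2 * K ^ 2 * Λ ^ 2 * ((1 + |t|) ^ p *
                (Real.exp (-(3 / 2 * ψ * |t|)) * Real.exp (ψ * |t| / 2))) := by ring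
            _ ≤ _ := by
                rw [← Real.exp_add]
                refine le_of_eq ?_
                congr 3
                ring
      _ ≤ _ := by
          rw [lintegral_const_mul' _ _ ENNReal.ofReal_ne_top,
            ENNReal.ofReal_mul (p := A ^ 2 * K ^ 2 * Λ ^ 2) (by positivity)]
          gcongr
          exact hCb p hp hp1 ψ hψ hψ1
  calc _ ≤ _ := lintegral_gaussian_mul_enorm_fourier_sq_le hbi u₀
    _ ≤ ENNReal.ofReal (Real.sqrt Real.pi) * ∫⁻ t : ℝ, ∫⁻ s : ℝ, 81 *
        (‖b t‖ₑ * ‖b s‖ₑ * ENNReal.ofReal (smoothKernel (s - t))) := by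
        refine mul_le_mul_right (lintegral_mono fun t => lintegral_mono fun s => ?_) _
        simp only
        rw [mul_left_comm]
        refine mul_le_mul_right ?_ _
        rw [show (81 : ENNReal) = ENNReal.ofReal 81 by simp, ← ENNReal.ofReal_mul (by norm_num),
          show (t - s) ^ 2 = (s - t) ^ 2 by ring]
        exact ENNReal.ofReal_le_ofReal (exp_neg_sq_div_four_le _)
    _ = ENNReal.ofReal (Real.sqrt Real.pi) * (81 * ∫⁻ t : ℝ, ∫⁻ s : ℝ,
        (‖b t‖ₑ * ‖b s‖ₑ * ENNReal.ofReal (smoothKernel (s - t)))) := by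
        simp_rw [lintegral_const_mul' (81 : ENNReal) _ (by simp)]
    _ ≤ ENNReal.ofReal (Real.sqrt Real.pi) * (81 * (2 *
        (ENNReal.ofReal (2 * Real.exp (3 / 2)) * 100 *
          ENNReal.ofReal (A ^ 2 * K ^ 2 * Λ ^ 2 * (C * ψ ^ (-(p + 1))))))) := by
        gcongr
        refine key.trans ?_
        gcongr
    _ = _ := by
        rw [show (81 : ENNReal) = ENNReal.ofReal 81 by simp,
          show (2 : ENNReal) = ENNReal.ofReal 2 by simp,
          show (100 : ENNReal) = ENNReal.ofReal 100 by simp]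
        rw [← ENNReal.ofReal_mul (by positivity), ← ENNReal.ofReal_mul (by positivity),
          ← ENNReal.ofReal_mul (by positivity), ← ENNReal.ofReal_mul (by positivity),
          ← ENNReal.ofReal_mul (by positivity)]
        congr 1
        ring

lemma ENNReal.add_sq_le (a b : ENNReal) : (a + b) ^ 2 ≤ 4 * (a ^ 2 + b ^ 2) := by
  rcases le_total a b with h | h
  · calc (a + b) ^ 2 ≤ (b + b) ^ 2 := by gcongr
      _ = 4 * b ^ 2 := by ring
      _ ≤ _ := by gcongr; exact le_add_self
  · calc (a + b) ^ 2 ≤ (a + a) ^ 2 := by gcongr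
      _ = 4 * a ^ 2 := by ring
      _ ≤ _ := by gcongr; exact le_self_add

lemma sq_setLIntegral_Ioc_le {f : ℝ → ENNReal} (hf : Measurable f) (a b : ℝ) :
    (∫⁻ x in Set.Ioc a b, f x) ^ 2 ≤ ENNReal.ofReal (b - a) * ∫⁻ x in Set.Ioc a b, f x ^ 2 := by
  have h := ENNReal.lintegral_mul_le_Lp_mul_Lq (volume.restrict (Set.Ioc a b))
    (f := f) (g := fun _ => 1) Real.HolderConjugate.two_two hf.aemeasurable aemeasurable_const
  simp only [Pi.mul_apply, mul_one, ENNReal.one_rpow, lintegral_const, one_mul,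
    Measure.restrict_apply MeasurableSet.univ, Set.univ_inter, Real.volume_Ioc] at h
  calc _ ≤ _ := pow_le_pow_left' h 2
    _ = _ := by
      rw [mul_pow, ← ENNReal.rpow_natCast, ← ENNReal.rpow_natCast, ← ENNReal.rpow_mul,
        ← ENNReal.rpow_mul]
      norm_num
      rw [mul_comm]

lemma integral_mul_exp_mul_eq_add {b : ℝ → ℂ} (hb : Continuous b) {v M κ : ℝ} (hv : 0 ≤ v)
    (hκ : 0 < κ) (hM : 0 ≤ M) (n : ℕ)
    (hbv : ∀ w ∈ Set.Icc 0 v, ∀ t, ‖b t‖ * Real.exp (w * t) ≤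
      M * ((1 + |t|) ^ n * Real.exp (-(κ * |t|)))) (u : ℝ) :
    ∫ t : ℝ, b t * Real.exp (v * t) * exp (-(t * u * I)) =
      (∫ t : ℝ, b t * exp (-(t * u * I))) + ∫ w in Set.Ioc 0 v, ∫ t : ℝ,
        b t * t * Real.exp (w * t) * exp (-(t * u * I)) := by
  have hexp : ∀ t : ℝ, ‖exp (-(t * u * I))‖ = 1 := fun t => by rw [norm_exp]; simp
  have hInt : ∀ w ∈ Set.Icc 0 v, Integrable fun t : ℝ =>
      b t * Real.exp (w * t) * exp (-(t * u * I)) := fun w hw => by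
    refine integrable_of_norm_le_mul_exp (by fun_prop) hM hκ n fun t => ?_
    rw [norm_mul, norm_mul, hexp, mul_one, Complex.norm_real, Real.norm_eq_abs,
      abs_of_pos (Real.exp_pos _)]
    exact hbv w hw t
  have hdom : Integrable fun t : ℝ =>
      ((M * ((1 + |t|) ^ (n + 1) * Real.exp (-(κ * |t|))) : ℝ) : ℂ) := by
    refine integrable_of_norm_le_mul_exp (by fun_prop) hM hκ (n + 1) fun t => ?_
    rw [Complex.norm_real, Real.norm_eq_abs, abs_of_nonneg (by positivity)]
  have hprod : Integrable (fun q : ℝ × ℝ =>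
      b q.2 * q.2 * Real.exp (q.1 * q.2) * exp (-(q.2 * u * I)))
      ((volume.restrict (Set.Ioc 0 v)).prod volume) := by
    have h1 : Integrable (fun _ : ℝ => (1 : ℂ)) (volume.restrict (Set.Ioc 0 v)) := by simp
    refine (h1.mul_prod hdom).mono (Continuous.aestronglyMeasurable (by fun_prop)) ?_
    have hae : ∀ᵐ q : ℝ × ℝ ∂((volume.restrict (Set.Ioc 0 v)).prod volume),
        q.1 ∈ Set.Ioc 0 v := by
      refine Measure.quasiMeasurePreserving_fst.ae ?_
      exact ae_restrict_mem measurableSet_Ioc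
    filter_upwards [hae] with q hq
    rw [norm_mul, hexp, mul_one, one_mul, Complex.norm_real, Real.norm_eq_abs,
      abs_of_nonneg (by positivity)]
    rw [norm_mul, norm_mul, Complex.norm_real, Complex.norm_real, Real.norm_eq_abs,
      Real.norm_eq_abs, abs_of_pos (Real.exp_pos _)]
    calc ‖b q.2‖ * |q.2| * Real.exp (q.1 * q.2) =
          |q.2| * (‖b q.2‖ * Real.exp (q.1 * q.2)) := by ring
      _ ≤ (1 + |q.2|) * (M * ((1 + |q.2|) ^ n * Real.exp (-(κ * |q.2|)))) := by
          refine mul_le_mul (by linarith) (hbv q.1 ⟨hq.1.le, hq.2⟩ q.2) ?_ ?_ <;> positivity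
      _ = _ := by ring
  rw [integral_integral_swap (f := fun (w t : ℝ) =>
    b t * t * Real.exp (w * t) * exp (-(t * u * I))) hprod]
  have h0 : Integrable fun t : ℝ => b t * exp (-(t * u * I)) := by
    simpa using hInt 0 ⟨le_rfl, hv⟩
  rw [← integral_add h0 hprod.integral_prod_right]
  refine integral_congr_ae (Filter.Eventually.of_forall fun t => ?_)
  have hFTC : ∫ w in Set.Ioc 0 v, (t : ℂ) * Real.exp (w * t) = Real.exp (v * t) - 1 := by
    rw [← intervalIntegral.integral_of_le hv, intervalIntegral.integral_eq_sub_of_hasDerivAt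
      (f := fun w : ℝ => (Real.exp (w * t) : ℂ))]
    · simp
    · intro w _
      exact (((hasDerivAt_id w).mul_const t).exp.ofReal_comp).congr_deriv (by
        push_cast
        simp only [id, one_mul]
        ring)
    · exact Continuous.intervalIntegrable (by fun_prop) _ _
  simp only
  have : ∀ w : ℝ, b t * t * Real.exp (w * t) * exp (-(t * u * I)) =
      (b t * exp (-(t * u * I))) * ((t : ℂ) * Real.exp (w * t)) := fun w => by ring
  simp_rw [this]
  rw [integral_const_mul, hFTC]
  ring

lemma lintegral_mul_add_setLIntegral_le {g f : ℝ → ENNReal} {h : ℝ → ℝ → ENNReal}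
    (hg : Measurable g) (hgtop : ∀ u, g u ≠ ⊤) (hh : Measurable fun q : ℝ × ℝ => h q.1 q.2)
    {Δ : ℝ} {X Y : ENNReal} (hX : ∫⁻ u, g u * f u ≤ X)
    (hY : ∀ w ∈ Set.Ioc 0 Δ, ∫⁻ u, g u * h u w ≤ Y) :
    ∫⁻ u, g u * (4 * (f u + ENNReal.ofReal Δ * ∫⁻ w in Set.Ioc 0 Δ, h u w)) ≤
      4 * (X + ENNReal.ofReal Δ * (Y * ENNReal.ofReal Δ)) := by
  have hgh : Measurable fun q : ℝ × ℝ => g q.1 * h q.1 q.2 := (hg.comp measurable_fst).mul hh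
  have hsecond : ∫⁻ u : ℝ, ∫⁻ w in Set.Ioc 0 Δ, g u * h u w ≤ Y * ENNReal.ofReal Δ := by
    rw [lintegral_lintegral_swap hgh.aemeasurable]
    calc _ ≤ ∫⁻ _ in Set.Ioc 0 Δ, Y := setLIntegral_mono' measurableSet_Ioc hY
      _ = _ := by simp
  have hexpand : ∀ u : ℝ, g u * (4 * (f u + ENNReal.ofReal Δ * ∫⁻ w in Set.Ioc 0 Δ, h u w)) =
      4 * (g u * f u + ENNReal.ofReal Δ * ∫⁻ w in Set.Ioc 0 Δ, g u * h u w) := by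
    intro u
    rw [lintegral_const_mul' _ _ (hgtop u)]
    ring
  simp_rw [hexpand]
  have hm : Measurable fun u => ENNReal.ofReal Δ * ∫⁻ w in Set.Ioc 0 Δ, g u * h u w :=
    hgh.lintegral_prod_right'.const_mul _
  rw [lintegral_const_mul' _ _ (by simp), lintegral_add_right _ hm,
    lintegral_const_mul' _ _ ENNReal.ofReal_ne_top]
  gcongr

lemma exists_lintegral_gaussian_mul_sup_le (hRH : RiemannHypothesis) {κ : ℝ} (hκ : 0 < κ) :
    ∃ C > 0, ∀ c : ℝ, 1 / 2 < c → c ≤ 1 → ∀ A Λ ψ p Δ : ℝ, 0 ≤ A → 0 ≤ Λ → 0 < ψ → ψ ≤ 1 →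
      κ ≤ p + 1 → p ≤ 1 → 0 ≤ Δ →
      (∀ t : ℝ, Real.log (|t| + 3) ≤ Λ * Real.exp (ψ * |t| / 2)) →
      ∀ b : ℝ → ℂ, Continuous b →
      (∀ v ∈ Set.Icc 0 Δ, ∀ t, ‖b t‖ * Real.exp (v * t) ≤
        A * (1 + |t|) ^ (p / 2) * Real.exp (-(2 * ψ * |t|)) *
          |(negZetaLogDeriv (c + t * I)).re|) →
      ∀ u₀ : ℝ, ∃ G : ℝ → ENNReal,
        (∀ v ∈ Set.Icc 0 Δ, ∀ u : ℝ,
          ‖∫ t : ℝ, b t * Real.exp (v * t) * exp (-(t * u * I))‖ₑ ^ 2 ≤ G u) ∧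
        ∫⁻ u : ℝ, ENNReal.ofReal (Real.exp (-(u - u₀) ^ 2)) * G u ≤
          ENNReal.ofReal (C * (A ^ 2 * Λ ^ 2 * ψ ^ (-(p + 1)) * (1 + (Δ / ψ) ^ 2))) := by
  obtain ⟨C, hC, hmain⟩ := exists_lintegral_gaussian_mul_enorm_sq_le hRH hκ
  refine ⟨4 * C, by positivity, ?_⟩
  intro c hc hc1 A Λ ψ p Δ hA hΛ hψ hψ1 hp hp1 hΔ hlog b hb hbv u₀
  obtain ⟨K, hK, hmK⟩ := exists_abs_re_negZetaLogDeriv_le hRH hc hc1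
  set B' : ℝ → ℝ → ℂ := fun u w =>
    ∫ t : ℝ, b t * t * Real.exp (w * t) * exp (-(t * u * I)) with hB'
  have hB'm : Measurable fun q : ℝ × ℝ => ‖B' q.1 q.2‖ₑ := by
    have : StronglyMeasurable fun q : ℝ × ℝ => ∫ t : ℝ,
        b t * t * Real.exp (q.2 * t) * exp (-(t * q.1 * I)) := by
      refine StronglyMeasurable.integral_prod_right (f := fun (q : ℝ × ℝ) (t : ℝ) =>
        b t * t * Real.exp (q.2 * t) * exp (-(t * q.1 * I))) ?_
      refine Continuous.stronglyMeasurable ?_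
      unfold Function.uncurry
      fun_prop
    exact this.measurable.enorm
  have hgm : Measurable fun u : ℝ => ENNReal.ofReal (Real.exp (-(u - u₀) ^ 2)) := by fun_prop
  set X : ℝ := C * (A ^ 2 * Λ ^ 2 * ψ ^ (-(p + 1))) with hX
  have hX0 : 0 ≤ X := by positivity
  have hzero : (0 : ℝ) ∈ Set.Icc 0 Δ := ⟨le_rfl, hΔ⟩
  have hB0 : ∫⁻ u : ℝ, ENNReal.ofReal (Real.exp (-(u - u₀) ^ 2)) *
      ‖∫ t : ℝ, b t * exp (-(t * u * I))‖ₑ ^ 2 ≤ ENNReal.ofReal X := by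
    refine hmain c hc hc1 A Λ ψ p hA hΛ hψ hψ1 hp hp1 hlog b hb (fun t => ?_) u₀
    have := hbv 0 hzero t
    rw [zero_mul, Real.exp_zero, mul_one] at this
    refine this.trans ?_
    gcongr
    linarith
  have hB1 : ∀ w ∈ Set.Icc 0 Δ, ∫⁻ u : ℝ, ENNReal.ofReal (Real.exp (-(u - u₀) ^ 2)) *
      ‖B' u w‖ₑ ^ 2 ≤ ENNReal.ofReal (X / ψ ^ 2) := by
    intro w hw
    refine (hmain c hc hc1 (A / ψ) Λ ψ p (by positivity) hΛ hψ hψ1 hp hp1 hlog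
      (fun t => b t * t * Real.exp (w * t)) (by fun_prop) (fun t => ?_) u₀).trans ?_
    · rw [norm_mul, norm_mul, Complex.norm_real, Complex.norm_real, Real.norm_eq_abs,
        Real.norm_eq_abs, abs_of_pos (Real.exp_pos _)]
      have ht : |t| * Real.exp (-(ψ * |t|)) ≤ 1 / ψ := by
        rw [le_div_iff₀ hψ, Real.exp_neg, ← div_eq_mul_inv, div_mul_eq_mul_div,
          div_le_one (Real.exp_pos _)]
        linarith [Real.add_one_le_exp (ψ * |t|)]
      calc ‖b t‖ * |t| * Real.exp (w * t) = |t| * (‖b t‖ * Real.exp (w * t)) := by ring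
        _ ≤ |t| * (A * (1 + |t|) ^ (p / 2) * Real.exp (-(2 * ψ * |t|)) *
            |(negZetaLogDeriv (c + t * I)).re|) :=
            mul_le_mul_of_nonneg_left (hbv w hw t) (abs_nonneg t)
        _ = (|t| * Real.exp (-(ψ * |t|))) * (A * (1 + |t|) ^ (p / 2) * Real.exp (-(ψ * |t|)) *
            |(negZetaLogDeriv (c + t * I)).re|) := by
            rw [show -(2 * ψ * |t|) = -(ψ * |t|) + -(ψ * |t|) by ring, Real.exp_add]; ring
        _ ≤ 1 / ψ * (A * (1 + |t|) ^ (p / 2) * Real.exp (-(ψ * |t|)) *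
            |(negZetaLogDeriv (c + t * I)).re|) := by gcongr
        _ = _ := by ring
    · refine ENNReal.ofReal_le_ofReal (le_of_eq ?_)
      rw [hX]
      ring
  refine ⟨fun u => 4 * (‖∫ t : ℝ, b t * exp (-(t * u * I))‖ₑ ^ 2 +
    ENNReal.ofReal Δ * ∫⁻ w in Set.Ioc 0 Δ, ‖B' u w‖ₑ ^ 2), fun v hv u => ?_, ?_⟩
  · have hcrude : ∀ w ∈ Set.Icc 0 v, ∀ t, ‖b t‖ * Real.exp (w * t) ≤
        A * K * ((1 + |t|) ^ 2 * Real.exp (-(2 * ψ * |t|))) := by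
      intro w hw t
      calc _ ≤ A * (1 + |t|) * Real.exp (-(2 * ψ * |t|)) * (K * (1 + |t|)) := by
            refine (hbv w ⟨hw.1, hw.2.trans hv.2⟩ t).trans ?_
            gcongr
            · exact one_add_abs_rpow_half_le hp1 t
            · exact hmK t
        _ = _ := by ring
    rw [integral_mul_exp_mul_eq_add hb hv.1 (by positivity : 0 < 2 * ψ)
      (by positivity : 0 ≤ A * K) 2 hcrude u]
    refine (pow_le_pow_left' (enorm_add_le _ _) 2).trans ((ENNReal.add_sq_le _ _).trans ?_)
    refine mul_le_mul_right (add_le_add le_rfl ?_) _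
    calc _ ≤ (∫⁻ w in Set.Ioc 0 Δ, ‖B' u w‖ₑ) ^ 2 := by
          refine pow_le_pow_left' ((enorm_integral_le_lintegral_enorm _).trans ?_) 2
          exact lintegral_mono_set (Set.Ioc_subset_Ioc_right hv.2)
      _ ≤ _ := by
          have hu : Measurable fun w => ‖B' u w‖ₑ :=
            Measurable.of_uncurry_left (f := fun u w => ‖B' u w‖ₑ) hB'm
          exact (sq_setLIntegral_Ioc_le hu 0 Δ).trans_eq (by rw [sub_zero])
  · refine (lintegral_mul_add_setLIntegral_le hgm (fun _ => ENNReal.ofReal_ne_top)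
      (h := fun u w => ‖B' u w‖ₑ ^ 2) (hB'm.pow_const 2) hB0
      (fun w hw => hB1 w ⟨hw.1.le, hw.2⟩)).trans_eq ?_
    rw [← ENNReal.ofReal_mul (by positivity), ← ENNReal.ofReal_mul hΔ,
      ← ENNReal.ofReal_add hX0 (by positivity),
      show (4 : ENNReal) = ENNReal.ofReal 4 by simp, ← ENNReal.ofReal_mul (by positivity)]
    congr 1
    rw [hX]
    field_simp

lemma gammaKernel_eq_mul_exp (ℓ : ℕ) {z z₀ : ℂ} (hz : z ≠ 0) (hz₀ : z₀ ≠ 0) (w : ℂ) :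
    gammaKernel ℓ z w = gammaKernel ℓ z₀ w * exp (-(w / ℓ) * (log z - log z₀)) := by
  rw [gammaKernel, gammaKernel, cpow_def_of_ne_zero hz, cpow_def_of_ne_zero hz₀,
    show log z * -(w / ℓ) = log z₀ * -(w / ℓ) + -(w / ℓ) * (log z - log z₀) by ring, exp_add]
  ring

/-- The integral, along the line of real part `c`, of the Mellin kernel of `exp (-(z * x ^ ℓ))`
against the real part of `-ζ'/ζ` (with its pole at `1` removed). -/
noncomputable def verticalTerm (ℓ : ℕ) (c : ℝ) (z : ℂ) : ℂ :=
  ∫ t : ℝ, gammaKernel ℓ z (c + t * I) * ((negZetaLogDeriv (c + t * I)).re : ℂ)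

lemma gammaKernel_vertical_eq (ℓ : ℕ) {z z₀ : ℂ} (hz : z ≠ 0) (hz₀ : z₀ ≠ 0) (c t : ℝ) :
    gammaKernel ℓ z (c + t * I) = exp (-(c / ℓ) * (log z - log z₀)) *
      (gammaKernel ℓ z₀ (c + t * I) * Real.exp ((z.arg - z₀.arg) / ℓ * t) *
        exp (-(t * (Real.log (‖z‖ / ‖z₀‖) / ℓ : ℝ) * I))) := by
  have e : exp (-((c + t * I) / ℓ) * (log z - log z₀)) =
      exp (-(c / ℓ) * (log z - log z₀)) * (Real.exp ((z.arg - z₀.arg) / ℓ * t) *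
        exp (-(t * (Real.log (‖z‖ / ‖z₀‖) / ℓ : ℝ) * I))) := by
    rw [ofReal_exp, ← exp_add, ← exp_add]
    congr 1
    rw [Real.log_div (norm_ne_zero_iff.2 hz) (norm_ne_zero_iff.2 hz₀), Complex.log, Complex.log]
    push_cast
    linear_combination (-(z.arg - z₀.arg) / ℓ * t : ℂ) * I_sq
  rw [gammaKernel_eq_mul_exp ℓ hz hz₀, e]
  ring

lemma exists_verticalTerm_sector_bound (hRH : RiemannHypothesis) {ℓ : ℕ} (hℓ : 1 ≤ ℓ) :
    ∃ C > 0, ∀ c : ℝ, 1 / 2 < c → c ≤ 1 → ∀ z₀ : ℂ, 0 < z₀.re → ∀ Δ ψ Λ : ℝ, 0 ≤ Δ → 0 ≤ Λ →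
      ψ = (Real.pi / 2 + z₀.arg) / (2 * ℓ) → z₀.arg + ℓ * Δ ≤ 0 →
      (∀ t : ℝ, Real.log (|t| + 3) ≤ Λ * Real.exp (ψ * |t| / 2)) →
      ∃ G : ℝ → ENNReal,
        (∀ z : ℂ, 0 < z.re → z₀.arg ≤ z.arg → z.arg ≤ z₀.arg + ℓ * Δ →
          ‖verticalTerm ℓ c z‖ₑ ^ 2 ≤ ENNReal.ofReal ((‖z‖ / ‖z₀‖) ^ (-(2 * c / ℓ))) *
            G (Real.log (‖z‖ / ‖z₀‖) / ℓ)) ∧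
        ∫⁻ u : ℝ, ENNReal.ofReal (Real.exp (-u ^ 2)) * G u ≤
          ENNReal.ofReal (C * (Λ ^ 2 * (‖z₀‖ * ψ) ^ (-(2 * c / ℓ)) * (1 + (Δ / ψ) ^ 2))) := by
  have hℓ0 : (0 : ℝ) < ℓ := by exact_mod_cast hℓ
  have hℓ1 : (1 : ℝ) ≤ ℓ := by exact_mod_cast hℓ
  obtain ⟨C₁, hC₁, hsup⟩ := exists_lintegral_gaussian_mul_sup_le hRH (κ := 1 / ℓ) (by positivity)
  obtain ⟨C₂, hC₂, hker⟩ := exists_norm_gammaKernel_le hℓ (a₀ := 1 / 2) (by norm_num) 1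
  refine ⟨C₁ * C₂ ^ 2, by positivity, ?_⟩
  intro c hc hc1 z₀ hz₀ Δ ψ Λ hΔ hΛ hψdef harg hlog
  have hz₀0 : z₀ ≠ 0 := fun h => by simp [h] at hz₀
  have hn₀ : 0 < ‖z₀‖ := norm_pos_iff.2 hz₀0
  have hargl : -(Real.pi / 2) < z₀.arg := (abs_lt.1 (abs_arg_lt_pi_div_two_iff.2 (Or.inl hz₀))).1
  have hargneg : z₀.arg ≤ 0 := by nlinarith
  have hψ : 0 < ψ := by rw [hψdef]; apply div_pos <;> linarith
  have hψ1 : ψ ≤ 1 := by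
    rw [hψdef, div_le_one (by positivity)]
    linarith [Real.pi_lt_four]
  set σ : ℝ := c / ℓ with hσ
  have hσ1 : σ ≤ 1 := by rw [hσ, div_le_one hℓ0]; linarith
  have hκ : 1 / (ℓ : ℝ) ≤ 2 * σ := by
    rw [hσ, ← mul_div_assoc]
    gcongr
    linarith
  set b : ℝ → ℂ := fun t => gammaKernel ℓ z₀ (c + t * I) *
    ((negZetaLogDeriv (c + t * I)).re : ℂ) with hb
  have hbc : Continuous b := (continuous_vertical_of_differentiableAt fun w hw =>
    differentiableAt_gammaKernel hℓ hz₀ (by rw [hw]; linarith)).mul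
      (continuous_ofReal.comp (continuous_re_negZetaLogDeriv hRH hc))
  have hbv : ∀ v ∈ Set.Icc 0 Δ, ∀ t : ℝ, ‖b t‖ * Real.exp (v * t) ≤
      C₂ * ‖z₀‖ ^ (-σ) * (1 + |t|) ^ ((2 * σ - 1) / 2) * Real.exp (-(2 * ψ * |t|)) *
        |(negZetaLogDeriv (c + t * I)).re| := by
    intro v hv t
    set θ : ℝ := z₀.arg + ℓ * v with hθ
    have hv' : ℓ * v ≤ ℓ * Δ := by gcongr; exact hv.2
    have hv0 : 0 ≤ ℓ * v := mul_nonneg hℓ0.le hv.1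
    have hθ0 : θ ≤ 0 := by linarith
    have hθl : z₀.arg ≤ θ := by linarith
    have hθmem : θ ∈ Set.Ioc (-Real.pi) Real.pi := ⟨by linarith, by linarith [Real.pi_pos]⟩
    set z : ℂ := ‖z₀‖ * (Complex.cos θ + Complex.sin θ * I) with hz
    have hzarg : z.arg = θ := arg_mul_cos_add_sin_mul_I hn₀ hθmem
    have hznorm : ‖z‖ = ‖z₀‖ := by
      rw [hz, norm_mul, norm_cos_add_sin_mul_I]; simp
    have hz0 : z ≠ 0 := norm_pos_iff.1 (hznorm ▸ hn₀)
    have hzre : 0 < z.re := by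
      refine (abs_arg_lt_pi_div_two_iff.1 ?_).resolve_right hz0
      rw [hzarg, abs_of_nonpos hθ0]
      linarith
    have hw : (c + t * I : ℂ).re = c ∧ (c + t * I : ℂ).im = t := by simp
    have h1 := hker z (c + t * I) hzre (by rw [hw.1]; linarith) (by rw [hw.1]; exact hc1)
    rw [hw.1, hw.2, hznorm, hzarg, abs_of_nonpos hθ0] at h1
    have h2 : ‖gammaKernel ℓ z (c + t * I)‖ =
        ‖gammaKernel ℓ z₀ (c + t * I)‖ * Real.exp (v * t) := by
      have e1 : ‖exp (-(c / ℓ) * (log z - log z₀))‖ = 1 := by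
        rw [norm_exp, show (-(c / ℓ) * (log z - log z₀) : ℂ) =
          (-(c / ℓ) : ℝ) * (log z - log z₀) by push_cast; ring, re_ofReal_mul, sub_re, log_re,
          log_re, hznorm]
        simp
      have e2 : ‖exp (-(t * (Real.log (‖z‖ / ‖z₀‖) / ℓ : ℝ) * I))‖ = 1 := by
        rw [norm_exp]; simp
      have e3 : (z.arg - z₀.arg) / ℓ * t = v * t := by
        rw [hzarg, hθ]; field_simp; ring
      rw [gammaKernel_vertical_eq ℓ hz0 hz₀0, norm_mul, norm_mul, norm_mul, e1, e2, e3,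
        Complex.norm_real, Real.norm_eq_abs, abs_of_pos (Real.exp_pos _)]
      ring
    have h3 : Real.exp (-((Real.pi / 2 - -θ) / ℓ * |t|)) ≤ Real.exp (-(2 * ψ * |t|)) := by
      rw [Real.exp_le_exp, neg_le_neg_iff]
      gcongr
      rw [hψdef, ← mul_div_assoc, mul_div_mul_left _ _ two_ne_zero]
      gcongr
      linarith
    calc ‖b t‖ * Real.exp (v * t) = ‖gammaKernel ℓ z (c + t * I)‖ *
          |(negZetaLogDeriv (c + t * I)).re| := by
          rw [h2, hb, norm_mul, Complex.norm_real, Real.norm_eq_abs]; ring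
      _ ≤ _ := by
          refine mul_le_mul_of_nonneg_right (h1.trans ?_) (abs_nonneg _)
          rw [show (2 * σ - 1) / 2 = σ - 1 / 2 by ring]
          gcongr
  obtain ⟨G, hG1, hG2⟩ := hsup c hc hc1 (C₂ * ‖z₀‖ ^ (-σ)) Λ ψ (2 * σ - 1) Δ (by positivity) hΛ hψ
    hψ1 (by linarith) (by linarith) hΔ hlog b hbc hbv 0
  refine ⟨G, fun z hz hzl hzu => ?_, ?_⟩
  · have hz0 : z ≠ 0 := fun h => by simp [h] at hz
    have hn : 0 < ‖z‖ := norm_pos_iff.2 hz0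
    have hv : (z.arg - z₀.arg) / ℓ ∈ Set.Icc 0 Δ := by
      refine ⟨div_nonneg (by linarith) hℓ0.le, ?_⟩
      rw [div_le_iff₀ hℓ0]
      linarith
    have e : verticalTerm ℓ c z = exp (-(c / ℓ) * (log z - log z₀)) *
        ∫ t : ℝ, b t * Real.exp ((z.arg - z₀.arg) / ℓ * t) *
          exp (-(t * (Real.log (‖z‖ / ‖z₀‖) / ℓ : ℝ) * I)) := by
      rw [verticalTerm, ← integral_const_mul]
      refine integral_congr_ae (Filter.Eventually.of_forall fun t => ?_)
      simp only
      rw [gammaKernel_vertical_eq ℓ hz0 hz₀0, hb]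
      ring
    have e1 : ‖exp (-(c / ℓ) * (log z - log z₀))‖ₑ ^ 2 =
        ENNReal.ofReal ((‖z‖ / ‖z₀‖) ^ (-(2 * c / ℓ))) := by
      rw [← ofReal_norm, ← ENNReal.ofReal_pow (norm_nonneg _), norm_exp,
        show (-(c / ℓ) * (log z - log z₀) : ℂ) =
          (-(c / ℓ) : ℝ) * (log z - log z₀) by push_cast; ring, re_ofReal_mul, sub_re, log_re,
        log_re, Real.rpow_def_of_pos (by positivity), Real.log_div hn.ne' hn₀.ne',
        ← Real.exp_nat_mul]
      congr 2
      push_cast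
      ring
    rw [e, enorm_mul, mul_pow, e1]
    gcongr
    exact hG1 _ hv _
  · simp only [sub_zero] at hG2
    refine hG2.trans_eq ?_
    congr 1
    rw [Real.mul_rpow hn₀.le hψ.le, mul_pow, ← Real.rpow_natCast (‖z₀‖ ^ (-σ)),
      ← Real.rpow_mul hn₀.le]
    rw [show -σ * ((2 : ℕ) : ℝ) = -(2 * c / ℓ) by rw [hσ]; push_cast; ring,
      show -(2 * σ - 1 + 1) = -(2 * c / ℓ) by rw [hσ]; ring]
    ring

lemma half_le_arctan {x : ℝ} (hx : 0 ≤ x) (hx1 : x ≤ 1) : x / 2 ≤ Real.arctan x := by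
  have h : x / Real.sqrt (1 + x ^ 2) ≤ Real.arctan x := by
    rw [← Real.sin_arctan]
    exact Real.sin_le (Real.arctan_nonneg.2 hx)
  refine le_trans ?_ h
  have : Real.sqrt (1 + x ^ 2) ≤ 2 := Real.sqrt_le_iff.2 ⟨by norm_num, by nlinarith⟩
  exact div_le_div_of_nonneg_left hx (by positivity) this

/-- The point `y - 2πiα` of the complex plane. -/
noncomputable def zPoint (y α : ℝ) : ℂ := y - 2 * Real.pi * I * α

lemma zPoint_re (y α : ℝ) : (zPoint y α).re = y := by simp [zPoint]

lemma zPoint_im (y α : ℝ) : (zPoint y α).im = -(2 * Real.pi * α) := by simp [zPoint]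

lemma zPoint_ne_zero {y : ℝ} (hy : 0 < y) (α : ℝ) : zPoint y α ≠ 0 := fun h => by
  have := zPoint_re y α
  rw [h, zero_re] at this
  exact hy.ne this

lemma sq_norm_zPoint (y α : ℝ) : ‖zPoint y α‖ ^ 2 = y ^ 2 + (2 * Real.pi * α) ^ 2 := by
  rw [← normSq_eq_norm_sq, normSq_apply, zPoint_re, zPoint_im]
  ring

lemma arg_zPoint {y : ℝ} (hy : 0 < y) (α : ℝ) :
    (zPoint y α).arg = -Real.arctan (2 * Real.pi * α / y) := by
  have h := abs_lt.1 (abs_arg_lt_pi_div_two_iff.2 (Or.inl ((zPoint_re y α).symm ▸ hy)))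
  rw [← Real.arctan_neg, ← Real.arctan_tan h.1 h.2, tan_arg, zPoint_re, zPoint_im, neg_div]

lemma hasDerivAt_log_norm_zPoint {y : ℝ} (hy : 0 < y) {r : ℝ} (hr : 0 < r) (k α : ℝ) :
    HasDerivAt (fun α => Real.log (‖zPoint y α‖ / r) / k)
      (4 * Real.pi ^ 2 * α / (‖zPoint y α‖ ^ 2 * k)) α := by
  have h1 : HasDerivAt (fun α : ℝ => y ^ 2 + (2 * Real.pi * α) ^ 2) (8 * Real.pi ^ 2 * α) α := by
    refine ((((hasDerivAt_id α).const_mul (2 * Real.pi)).pow 2).const_add (y ^ 2)).congr_deriv ?_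
    simp only [id]
    push_cast
    ring
  have hpos : 0 < y ^ 2 + (2 * Real.pi * α) ^ 2 := by positivity
  have h2 := (((h1.log hpos.ne').div_const 2).sub_const (Real.log r)).div_const k
  have h3 : (fun α => Real.log (‖zPoint y α‖ / r) / k) =
      fun α => (Real.log (y ^ 2 + (2 * Real.pi * α) ^ 2) / 2 - Real.log r) / k := by
    ext β
    rw [Real.log_div (norm_ne_zero_iff.2 (zPoint_ne_zero hy β)) hr.ne', ← sq_norm_zPoint,
      Real.log_pow]
    push_cast
    ring
  rw [h3, sq_norm_zPoint]
  refine h2.congr_deriv ?_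
  rw [div_div, div_div]
  rw [show 4 * Real.pi ^ 2 * α = 8 * Real.pi ^ 2 * α / 2 by ring, div_div]
  congr 1
  ring

lemma setLIntegral_comp_log_norm_zPoint_le {y η k : ℝ} (hy : 0 < y) (hη : 0 < η) (hyη : y ≤ 2 * η)
    (hk : 1 ≤ k) (G : ℝ → ENNReal) :
    ∫⁻ α in Set.Ioc η (2 * η), G (Real.log (‖zPoint y α‖ / ‖zPoint y (2 * η)‖) / k) ≤
      ENNReal.ofReal (5 * k * η * Real.exp 1) *
        ∫⁻ u : ℝ, ENNReal.ofReal (Real.exp (-u ^ 2)) * G u := by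
  have hk0 : 0 < k := by linarith
  set r := ‖zPoint y (2 * η)‖ with hr
  have hr0 : 0 < r := norm_pos_iff.2 (zPoint_ne_zero hy _)
  set u : ℝ → ℝ := fun α => Real.log (‖zPoint y α‖ / r) / k with hu
  set u' : ℝ → ℝ := fun α => 4 * Real.pi ^ 2 * α / (‖zPoint y α‖ ^ 2 * k) with hu'
  have hπ : 3 < Real.pi := Real.pi_gt_three
  have hn : ∀ α, 0 < ‖zPoint y α‖ := fun α => norm_pos_iff.2 (zPoint_ne_zero hy _)
  have hinj : Set.InjOn u (Set.Ioc η (2 * η)) := by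
    intro α hα β hβ h
    have h1 : Real.log (‖zPoint y α‖ / r) = Real.log (‖zPoint y β‖ / r) := by
      simpa [hu, div_left_inj' hk0.ne'] using h
    have h2 : ‖zPoint y α‖ = ‖zPoint y β‖ := by
      have := Real.log_injOn_pos (Set.mem_Ioi.2 (div_pos (hn α) hr0))
        (Set.mem_Ioi.2 (div_pos (hn β) hr0)) h1
      exact (div_left_inj' hr0.ne').1 this
    have h3 : (2 * Real.pi * α) ^ 2 = (2 * Real.pi * β) ^ 2 := by
      have := sq_norm_zPoint y α
      rw [h2, sq_norm_zPoint] at this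
      linarith
    have hα0 : 0 < α := hη.trans hα.1
    have hβ0 : 0 < β := hη.trans hβ.1
    have h4 := (pow_left_inj₀ (by positivity) (by positivity) two_ne_zero).1 h3
    exact mul_left_cancel₀ (by positivity) h4
  have hcv := lintegral_image_eq_lintegral_abs_deriv_mul (s := Set.Ioc η (2 * η)) (f := u)
    (f' := u') measurableSet_Ioc
    (fun α _ => (hasDerivAt_log_norm_zPoint hy hr0 k α).hasDerivWithinAt) hinj
    (fun x => ENNReal.ofReal (Real.exp (-x ^ 2)) * G x)
  calc _ ≤ ∫⁻ α in Set.Ioc η (2 * η), ENNReal.ofReal (5 * k * η * Real.exp 1) *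
        (ENNReal.ofReal |u' α| * (ENNReal.ofReal (Real.exp (-u α ^ 2)) * G (u α))) := by
        refine setLIntegral_mono' measurableSet_Ioc fun α hα => ?_
        have hα0 : 0 < α := hη.trans hα.1
        have h1 : 1 ≤ 5 * k * η * |u' α| := by
          rw [hu', abs_of_nonneg (by positivity), ← mul_div_assoc, le_div_iff₀
            (by have := hn α; positivity), one_mul, sq_norm_zPoint]
          have h2 : y ^ 2 ≤ 4 * η ^ 2 := by nlinarith
          have h3 : y ^ 2 + (2 * Real.pi * α) ^ 2 ≤ 20 * Real.pi ^ 2 * (η * α) := by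
            have h4 : α ^ 2 ≤ 2 * (η * α) := by nlinarith [hα.2]
            have h5 : η ^ 2 ≤ η * α := by nlinarith [hα.1]
            have h6 : 4 * (η * α) ≤ 12 * Real.pi ^ 2 * (η * α) := by
              have : 0 < η * α := by positivity
              have : 4 ≤ 12 * Real.pi ^ 2 := by nlinarith
              gcongr
            nlinarith [mul_le_mul_of_nonneg_left h4 (by positivity : 0 ≤ 4 * Real.pi ^ 2)]
          calc _ ≤ 20 * Real.pi ^ 2 * (η * α) * k := by gcongr
            _ = _ := by ring
        have h2 : 1 ≤ Real.exp 1 * Real.exp (-u α ^ 2) := by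
          rw [← Real.exp_add, Real.one_le_exp_iff]
          have hρ1 : ‖zPoint y α‖ / r ≤ 1 := by
            rw [div_le_one hr0, hr]
            refine le_of_sq_le_sq ?_ (norm_nonneg _)
            rw [sq_norm_zPoint, sq_norm_zPoint]
            gcongr
            exact hα.2
          have hρ2 : 1 / 2 ≤ ‖zPoint y α‖ / r := by
            rw [le_div_iff₀ hr0, hr]
            refine le_of_sq_le_sq ?_ (norm_nonneg _)
            rw [mul_pow, sq_norm_zPoint, sq_norm_zPoint]
            have : (2 * Real.pi * η) ^ 2 ≤ (2 * Real.pi * α) ^ 2 := by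
              gcongr
              exact hα.1.le
            nlinarith [sq_nonneg y]
          have hlog0 : Real.log (‖zPoint y α‖ / r) ≤ 0 :=
            Real.log_nonpos (by positivity) hρ1
          have hlog1 : -1 ≤ Real.log (‖zPoint y α‖ / r) := by
            have h3 := Real.log_le_log (by norm_num) hρ2
            rw [one_div, Real.log_inv] at h3
            linarith [Real.log_two_lt_d9]
          have hu0 : u α ≤ 0 := div_nonpos_of_nonpos_of_nonneg hlog0 hk0.le
          have hu1 : -1 ≤ u α := by
            simp only [hu]
            rw [le_div_iff₀ hk0]
            linarith
          nlinarith
        have h3 : 1 ≤ ENNReal.ofReal (5 * k * η * Real.exp 1) *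
            (ENNReal.ofReal |u' α| * ENNReal.ofReal (Real.exp (-u α ^ 2))) := by
          rw [← ENNReal.ofReal_mul (abs_nonneg _), ← ENNReal.ofReal_mul (by positivity),
            ← ENNReal.ofReal_one]
          refine ENNReal.ofReal_le_ofReal ?_
          calc (1 : ℝ) = 1 * 1 := by ring
            _ ≤ (5 * k * η * |u' α|) * (Real.exp 1 * Real.exp (-u α ^ 2)) := by gcongr
            _ = _ := by ring
        calc G (u α) = 1 * G (u α) := (one_mul _).symm
          _ ≤ _ := mul_le_mul_left h3 (G (u α))
          _ = _ := by ring
    _ = ENNReal.ofReal (5 * k * η * Real.exp 1) *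
        ∫⁻ x in u '' Set.Ioc η (2 * η), ENNReal.ofReal (Real.exp (-x ^ 2)) * G x := by
        rw [lintegral_const_mul' _ _ ENNReal.ofReal_ne_top, hcv]
    _ ≤ _ := by
        gcongr
        exact Measure.restrict_le_self

lemma two_le_log_of_eight_le {N : ℝ} (hN : 8 ≤ N) : 2 ≤ Real.log N := by
  have h1 : Real.log 8 ≤ Real.log N := Real.log_le_log (by norm_num) hN
  have h2 : Real.log 8 = 3 * Real.log 2 := by
    rw [show (8 : ℝ) = 2 ^ 3 by norm_num, Real.log_pow]
    norm_num
  linarith [Real.log_two_gt_d9]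

lemma rpow_div_le_exp_two_mul {N : ℝ} (hN : 8 ≤ N) {ℓ : ℕ} (hℓ : 1 ≤ ℓ) :
    N ^ (2 * (1 / 2 + 1 / Real.log N) / ℓ) ≤ Real.exp 2 * N ^ (1 / (ℓ : ℝ)) := by
  have hL := two_le_log_of_eight_le hN
  have hℓ' : (1 : ℝ) ≤ ℓ := by exact_mod_cast hℓ
  have hN0 : 0 < N := by linarith
  rw [show 2 * (1 / 2 + 1 / Real.log N) / (ℓ : ℝ) = 2 / (ℓ * Real.log N) + 1 / ℓ by
    field_simp
    ring, Real.rpow_add hN0]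
  refine mul_le_mul_of_nonneg_right ?_ (by positivity)
  rw [Real.rpow_def_of_pos hN0, Real.exp_le_exp]
  calc Real.log N * (2 / (ℓ * Real.log N)) = 2 / ℓ := by field_simp
    _ ≤ 2 / 1 := by gcongr
    _ = 2 := by norm_num

lemma arctan_le_self {x : ℝ} (hx : 0 ≤ x) : Real.arctan x ≤ x := by
  simpa using Real.le_tan (Real.arctan_nonneg.2 hx) (Real.arctan_lt_pi_div_two x)

lemma log_abs_add_three_le_mul_exp {N : ℝ} (hN : 8 ≤ N) {ψ k : ℝ} (hψ : 0 ≤ ψ)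
    (h4 : 1 / N ≤ 4 * Real.pi * k * ψ) (hk : 1 ≤ k) (t : ℝ) :
    Real.log (|t| + 3) ≤ 8 * Real.pi * k * Real.log N * Real.exp (ψ * |t| / 2) := by
  have hL := two_le_log_of_eight_le hN
  have hN0 : 0 < N := by linarith
  have hy8 : 1 / N ≤ 1 / 8 := one_div_le_one_div_of_le (by norm_num) hN
  have hπ : 3 < Real.pi := Real.pi_gt_three
  set L := Real.log N with hLd
  set y := 1 / N with hy
  have hy0 : 0 < y := by positivity
  have ht := abs_nonneg t
  have h1 : Real.log (|t| + 3) = Real.log ((|t| + 3) * y) + L := by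
    rw [Real.log_mul (by positivity) hy0.ne', hy, one_div, Real.log_inv]
    ring
  have h2 := Real.log_le_sub_one_of_pos (by positivity : 0 < (|t| + 3) * y)
  have h3 := Real.add_one_le_exp (ψ * |t| / 2)
  have h5 : y * |t| ≤ 4 * Real.pi * k * ψ * |t| * L := by
    calc y * |t| ≤ 4 * Real.pi * k * ψ * |t| * 1 := by rw [mul_one]; gcongr
      _ ≤ _ := by gcongr; linarith
  have h6 : L ≤ 8 * Real.pi * k * L := by
    have : 1 ≤ 8 * Real.pi * k := by nlinarith
    nlinarith
  calc Real.log (|t| + 3) ≤ y * |t| + L := by rw [h1]; linarith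
    _ ≤ 8 * Real.pi * k * L * (ψ * |t| / 2 + 1) := by linarith
    _ ≤ _ := by gcongr

set_option maxHeartbeats 1000000 in
lemma exists_setLIntegral_dyadic_verticalTerm_le (hRH : RiemannHypothesis) {ℓ : ℕ} (hℓ : 1 ≤ ℓ) :
    ∃ C > 0, ∀ N : ℝ, 8 ≤ N → ∀ η : ℝ, 1 / (2 * N) ≤ η → 2 * η ≤ 1 / 2 →
      ∫⁻ α in Set.Ioc η (2 * η),
        ‖verticalTerm ℓ (1 / 2 + 1 / Real.log N) (zPoint (1 / N) α)‖ₑ ^ 2 ≤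
      ENNReal.ofReal (C * (N ^ (1 / (ℓ : ℝ)) * η * Real.log N ^ 2)) := by
  obtain ⟨K, hK, H⟩ := exists_verticalTerm_sector_bound hRH hℓ
  have hℓ' : (1 : ℝ) ≤ ℓ := by exact_mod_cast hℓ
  have hπ : 3 < Real.pi := Real.pi_gt_three
  refine ⟨4 * (5 * ℓ * Real.exp 1) *
    (K * ((8 * Real.pi * ℓ) ^ 2 * ((4 * ℓ) ^ 2 * Real.exp 2) * (1 + 8 ^ 2))), by positivity, ?_⟩
  intro N hN η hη hη1
  have hN0 : 0 < N := by linarith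
  have hL := two_le_log_of_eight_le hN
  have hNlog := rpow_div_le_exp_two_mul hN hℓ
  set Lg := Real.log N with hLg
  set c := 1 / 2 + 1 / Lg with hc
  have hL0 : 0 < Lg := by linarith
  have hc1 : 1 / 2 < c := by
    have : 0 < 1 / Lg := by positivity
    linarith
  have hc2 : c ≤ 1 := by
    have : 1 / Lg ≤ 1 / 2 := one_div_le_one_div_of_le (by norm_num) hL
    linarith
  set y := 1 / N with hy
  have hy0 : 0 < y := by positivity
  have hη0 : 0 < η := lt_of_lt_of_le (by positivity) hη
  have hyη : y ≤ 2 * η := by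
    have : 1 / (2 * N) = y / 2 := by rw [hy]; field_simp
    linarith
  have hy8 : y ≤ 1 / 8 := one_div_le_one_div_of_le (by norm_num) hN
  set w := 2 * Real.pi * (2 * η) / y with hw
  have hw0 : 0 < w := by positivity
  have hw1 : 1 ≤ w := by
    rw [hw, le_div_iff₀ hy0]
    nlinarith
  have hx1 : w⁻¹ ≤ 1 := inv_le_one_of_one_le₀ hw1
  have hxw : 4 * Real.pi * η * w⁻¹ = y := by
    rw [hw]
    field_simp
    ring
  have hxy : y / Real.pi ≤ w⁻¹ := by
    rw [div_le_iff₀ (by positivity)]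
    have : 0 < w⁻¹ := by positivity
    nlinarith [mul_le_mul_of_nonneg_left hη1 (by positivity : 0 ≤ 2 * Real.pi * w⁻¹)]
  set z₀ := zPoint y (2 * η) with hz₀
  have harg : z₀.arg = -Real.arctan w := arg_zPoint hy0 _
  have hψ : Real.arctan w⁻¹ / (2 * ℓ) = (Real.pi / 2 + z₀.arg) / (2 * ℓ) := by
    rw [harg, Real.arctan_inv_of_pos hw0]
    ring
  set ψ := Real.arctan w⁻¹ / (2 * ℓ) with hψd
  have hψx : w⁻¹ / (4 * ℓ) ≤ ψ := by
    have := half_le_arctan (by positivity) hx1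
    calc w⁻¹ / (4 * ℓ) = w⁻¹ / 2 / (2 * ℓ) := by ring
      _ ≤ _ := by rw [hψd]; gcongr
  have hψ0 : 0 < ψ := lt_of_lt_of_le (by positivity) hψx
  set Δ := (Real.arctan w - Real.arctan (2 * Real.pi * η / y)) / ℓ with hΔ
  have hw2 : 2 * Real.pi * η / y = w / 2 := by rw [hw]; ring
  have hΔ0 : 0 ≤ Δ := by
    refine div_nonneg (sub_nonneg.2 (Real.arctan_mono ?_)) (by positivity)
    rw [hw2]
    linarith
  have hΔℓ : ℓ * Δ = Real.arctan w - Real.arctan (2 * Real.pi * η / y) := by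
    rw [hΔ]
    field_simp
  have hΔx : Δ ≤ 2 * w⁻¹ / ℓ := by
    rw [hΔ]
    gcongr
    have h1 := Real.arctan_inv_of_pos hw0
    have h2 := Real.arctan_inv_of_pos (half_pos hw0)
    have h3 : 0 ≤ Real.arctan w⁻¹ := Real.arctan_nonneg.2 (by positivity)
    have h4 : Real.arctan (w / 2)⁻¹ ≤ (w / 2)⁻¹ := arctan_le_self (by positivity)
    have h5 : (w / 2)⁻¹ = 2 * w⁻¹ := by field_simp
    rw [hw2]
    linarith
  have hΔψ : Δ / ψ ≤ 8 := by
    rw [div_le_iff₀ hψ0]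
    refine hΔx.trans ?_
    calc 2 * w⁻¹ / ℓ = 8 * (w⁻¹ / (4 * ℓ)) := by ring
      _ ≤ _ := by gcongr
  have hlog := log_abs_add_three_le_mul_exp hN hψ0.le (by
    have : y / Real.pi / (4 * ℓ) ≤ ψ := le_trans (by gcongr) hψx
    rw [div_div, div_le_iff₀ (by positivity)] at this
    linarith : 1 / N ≤ 4 * Real.pi * ℓ * ψ) hℓ'
  obtain ⟨G, hG1, hG2⟩ := H c hc1 hc2 z₀ (by rw [hz₀, zPoint_re]; exact hy0) Δ ψ
    (8 * Real.pi * ℓ * Lg) hΔ0 (by positivity) hψ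
    (by
      rw [hΔℓ, harg]
      have : 0 ≤ Real.arctan (2 * Real.pi * η / y) := Real.arctan_nonneg.2 (by positivity)
      linarith) hlog
  have hz0n : 4 * Real.pi * η ≤ ‖z₀‖ := by
    have := abs_im_le_norm z₀
    rw [hz₀, zPoint_im, abs_neg, abs_of_nonneg (by positivity)] at this
    linarith
  have hz0pos : 0 < ‖z₀‖ := lt_of_lt_of_le (by positivity) hz0n
  have hp0 : 0 ≤ 2 * c / ℓ := by positivity
  have hp2 : 2 * c / ℓ ≤ 2 := by
    rw [div_le_iff₀ (by positivity)]
    nlinarith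
  have hpoint : ∀ α ∈ Set.Ioc η (2 * η), ‖verticalTerm ℓ c (zPoint y α)‖ₑ ^ 2 ≤
      ENNReal.ofReal 4 * G (Real.log (‖zPoint y α‖ / ‖z₀‖) / ℓ) := by
    intro α hα
    have hα0 : 0 < α := hη0.trans hα.1
    refine (hG1 _ (by rw [zPoint_re]; exact hy0) ?_ ?_).trans ?_
    · rw [harg, arg_zPoint hy0, neg_le_neg_iff, hw]
      refine Real.arctan_mono ?_
      have := hα.2
      gcongr
    · rw [harg, arg_zPoint hy0, hΔℓ]
      have : Real.arctan (2 * Real.pi * η / y) ≤ Real.arctan (2 * Real.pi * α / y) := by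
        refine Real.arctan_mono ?_
        have := hα.1.le
        gcongr
      linarith
    · refine mul_le_mul_left (ENNReal.ofReal_le_ofReal ?_) _
      have hρ2 : 1 / 2 ≤ ‖zPoint y α‖ / ‖z₀‖ := by
        rw [le_div_iff₀ hz0pos, hz₀]
        refine le_of_sq_le_sq ?_ (norm_nonneg _)
        rw [mul_pow, sq_norm_zPoint, sq_norm_zPoint]
        have : (2 * Real.pi * η) ^ 2 ≤ (2 * Real.pi * α) ^ 2 := by
          gcongr
          exact hα.1.le
        nlinarith [sq_nonneg y]
      calc _ ≤ (1 / 2 : ℝ) ^ (-(2 * c / ℓ)) :=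
            Real.rpow_le_rpow_of_nonpos (by norm_num) hρ2 (by linarith)
        _ = 2 ^ (2 * c / ℓ) := by
            rw [Real.rpow_neg (by norm_num), one_div, Real.inv_rpow (by norm_num), inv_inv]
        _ ≤ 2 ^ (2 : ℝ) := Real.rpow_le_rpow_of_exponent_le (by norm_num) hp2
        _ = 4 := by norm_num
  have hpow : (‖z₀‖ * ψ) ^ (-(2 * c / ℓ)) ≤
      (4 * ℓ) ^ 2 * Real.exp 2 * N ^ (1 / (ℓ : ℝ)) := by
    have h1 : y / (4 * ℓ) ≤ ‖z₀‖ * ψ := by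
      calc y / (4 * ℓ) = (4 * Real.pi * η) * (w⁻¹ / (4 * ℓ)) := by rw [← hxw]; ring
        _ ≤ _ := by gcongr
    calc _ ≤ (y / (4 * ℓ)) ^ (-(2 * c / ℓ)) :=
          Real.rpow_le_rpow_of_nonpos (by positivity) h1 (by linarith)
      _ = (4 * ℓ) ^ (2 * c / ℓ) * N ^ (2 * c / ℓ) := by
          rw [Real.rpow_neg (by positivity), ← Real.inv_rpow (by positivity), hy, inv_div,
            div_div_eq_mul_div, div_one, Real.mul_rpow (by positivity) (by positivity)]
      _ ≤ (4 * ℓ) ^ (2 : ℝ) * (Real.exp 2 * N ^ (1 / (ℓ : ℝ))) := by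
          refine mul_le_mul (Real.rpow_le_rpow_of_exponent_le (by linarith) hp2) hNlog
            (by positivity) (by positivity)
      _ = _ := by
          rw [Real.rpow_two]
          ring
  calc _ ≤ ∫⁻ α in Set.Ioc η (2 * η),
        ENNReal.ofReal 4 * G (Real.log (‖zPoint y α‖ / ‖z₀‖) / ℓ) :=
        setLIntegral_mono' measurableSet_Ioc hpoint
    _ = ENNReal.ofReal 4 * ∫⁻ α in Set.Ioc η (2 * η),
        G (Real.log (‖zPoint y α‖ / ‖z₀‖) / ℓ) := lintegral_const_mul' _ _ ENNReal.ofReal_ne_top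
    _ ≤ ENNReal.ofReal 4 * (ENNReal.ofReal (5 * ℓ * η * Real.exp 1) *
        ENNReal.ofReal (K * ((8 * Real.pi * ℓ * Lg) ^ 2 * (‖z₀‖ * ψ) ^ (-(2 * c / ℓ)) *
          (1 + (Δ / ψ) ^ 2)))) := by
        gcongr
        exact (setLIntegral_comp_log_norm_zPoint_le hy0 hη0 hyη hℓ' G).trans (by gcongr)
    _ ≤ _ := by
        rw [← ENNReal.ofReal_mul (by positivity), ← ENNReal.ofReal_mul (by norm_num)]
        refine ENNReal.ofReal_le_ofReal ?_
        calc _ ≤ 4 * (5 * ℓ * η * Real.exp 1 * (K * ((8 * Real.pi * ℓ * Lg) ^ 2 *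
              ((4 * ℓ) ^ 2 * Real.exp 2 * N ^ (1 / (ℓ : ℝ))) * (1 + 8 ^ 2)))) := by gcongr
          _ = _ := by ring

lemma exists_norm_verticalTerm_le_of_le_one_div (hRH : RiemannHypothesis) {ℓ : ℕ} (hℓ : 1 ≤ ℓ) :
    ∃ C > 0, ∀ N : ℝ, 8 ≤ N → ∀ α : ℝ, 0 ≤ α → α ≤ 1 / N →
      ‖verticalTerm ℓ (1 / 2 + 1 / Real.log N) (zPoint (1 / N) α)‖ ^ 2 ≤
        C * N ^ (1 / (ℓ : ℝ)) := by
  obtain ⟨K, hK, HK⟩ := exists_integral_abs_re_negZetaLogDeriv_mul_le hRH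
  obtain ⟨C₁, hC₁, H₁⟩ := exists_norm_gammaKernel_le hℓ (by norm_num : (0 : ℝ) < 1 / 2) 1
  have hℓ' : (1 : ℝ) ≤ ℓ := by exact_mod_cast hℓ
  have hκ : 0 < (Real.pi / 2 - Real.arctan (2 * Real.pi)) / ℓ :=
    div_pos (sub_pos.2 (Real.arctan_lt_pi_div_two _)) (by positivity)
  set κ := (Real.pi / 2 - Real.arctan (2 * Real.pi)) / ℓ with hκd
  obtain ⟨C₂, hC₂, H₂⟩ := exists_pow_mul_exp_neg_le 5 hκ
  have hlog3 : 0 < Real.log (|(0 : ℝ)| + 3) := Real.log_pos (by norm_num)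
  refine ⟨(C₁ * (81 * C₂) * (K * Real.log (|(0 : ℝ)| + 3))) ^ 2 * Real.exp 2, by positivity, ?_⟩
  intro N hN α hα hα1
  have hN0 : 0 < N := by linarith
  have hL := two_le_log_of_eight_le hN
  have hNlog := rpow_div_le_exp_two_mul hN hℓ
  set Lg := Real.log N with hLg
  set c := 1 / 2 + 1 / Lg with hc
  have hL0 : 0 < Lg := by linarith
  have hc1 : 1 / 2 < c := by
    have : 0 < 1 / Lg := by positivity
    linarith
  have hc2 : c ≤ 1 := by
    have : 1 / Lg ≤ 1 / 2 := one_div_le_one_div_of_le (by norm_num) hL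
    linarith
  have hy0 : 0 < 1 / N := by positivity
  have hcℓ : c / ℓ ≤ 1 := by
    rw [div_le_one (by positivity)]
    linarith
  obtain ⟨hi, hb⟩ := HK c hc1 hc2 0
  simp only [sub_zero] at hi hb
  set z := zPoint (1 / N) α with hz
  have harg : |z.arg| ≤ Real.arctan (2 * Real.pi) := by
    rw [hz, arg_zPoint hy0, abs_neg, abs_of_nonneg (Real.arctan_nonneg.2 (by positivity))]
    refine Real.arctan_mono ?_
    rw [div_le_iff₀ hy0]
    gcongr
  have hzn : 1 / N ≤ ‖z‖ := by
    have := re_le_norm z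
    rwa [hz, zPoint_re] at this
  have hkernel : ∀ t : ℝ, ‖gammaKernel ℓ z (c + t * I)‖ ≤
      C₁ * N ^ (c / ℓ) * (81 * C₂) * smoothKernel t := by
    intro t
    have ht := abs_nonneg t
    have h := H₁ z (c + t * I) (by rw [hz, zPoint_re]; exact hy0) (by simpa using hc1.le)
      (by simpa using hc2)
    simp only [add_re, ofReal_re, mul_re, I_re, mul_zero, ofReal_im, I_im, mul_one, sub_self,
      add_zero, add_im, mul_im, zero_add] at h
    have h1 : ‖z‖ ^ (-(c / ℓ)) ≤ N ^ (c / ℓ) := by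
      calc _ ≤ (1 / N) ^ (-(c / ℓ)) := Real.rpow_le_rpow_of_nonpos hy0 hzn
            (neg_nonpos.2 (by positivity))
        _ = _ := by rw [Real.rpow_neg hy0.le, ← Real.inv_rpow hy0.le, one_div, inv_inv]
    have h2 : (1 + |t|) ^ (c / ℓ - 1 / 2) ≤ 1 + |t| := by
      calc _ ≤ (1 + |t|) ^ (1 : ℝ) :=
            Real.rpow_le_rpow_of_exponent_le (by linarith) (by linarith)
        _ = _ := Real.rpow_one _
    have h3 : Real.exp (-((Real.pi / 2 - |z.arg|) / ℓ * |t|)) ≤ Real.exp (-(κ * |t|)) := by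
      rw [Real.exp_le_exp, neg_le_neg_iff, hκd]
      gcongr
    have h4 : (1 + |t|) * Real.exp (-(κ * |t|)) ≤ 81 * C₂ * smoothKernel t := by
      have h5 : t ^ 2 + 9 ≤ 9 * (1 + |t|) ^ 2 := by
        rw [← sq_abs t]
        nlinarith
      have h6 : (t ^ 2 + 9) ^ 2 ≤ 81 * (1 + |t|) ^ 4 := by
        calc _ ≤ (9 * (1 + |t|) ^ 2) ^ 2 := by gcongr
          _ = _ := by ring
      rw [smoothKernel, ← div_eq_mul_inv, le_div_iff₀ (by positivity)]
      calc _ ≤ (1 + |t|) * Real.exp (-(κ * |t|)) * (81 * (1 + |t|) ^ 4) := by gcongr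
        _ = 81 * ((1 + |t|) ^ 5 * Real.exp (-(κ * |t|))) := by ring
        _ ≤ _ := by gcongr; exact H₂ _ ht
    calc _ ≤ C₁ * ‖z‖ ^ (-(c / ℓ)) * (1 + |t|) ^ (c / ℓ - 1 / 2) *
          Real.exp (-((Real.pi / 2 - |z.arg|) / ℓ * |t|)) := h
      _ ≤ C₁ * N ^ (c / ℓ) * (1 + |t|) * Real.exp (-(κ * |t|)) := by gcongr
      _ = C₁ * N ^ (c / ℓ) * ((1 + |t|) * Real.exp (-(κ * |t|))) := by ring
      _ ≤ C₁ * N ^ (c / ℓ) * (81 * C₂ * smoothKernel t) := by gcongr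
      _ = _ := by ring
  have hvt : ‖verticalTerm ℓ c z‖ ≤
      C₁ * (81 * C₂) * (K * Real.log (|(0 : ℝ)| + 3)) * N ^ (c / ℓ) := by
    calc _ ≤ ∫ t : ℝ, C₁ * N ^ (c / ℓ) * (81 * C₂) *
          (|(negZetaLogDeriv (c + t * I)).re| * smoothKernel t) := by
          refine norm_integral_le_of_norm_le (hi.const_mul _) (Filter.Eventually.of_forall ?_)
          intro t
          rw [norm_mul, norm_real, Real.norm_eq_abs]
          calc _ ≤ C₁ * N ^ (c / ℓ) * (81 * C₂) * smoothKernel t *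
                |(negZetaLogDeriv (c + t * I)).re| := by
                gcongr
                exact hkernel t
            _ = _ := by ring
      _ = C₁ * N ^ (c / ℓ) * (81 * C₂) *
          ∫ t : ℝ, |(negZetaLogDeriv (c + t * I)).re| * smoothKernel t := integral_const_mul _ _
      _ ≤ C₁ * N ^ (c / ℓ) * (81 * C₂) * (K * Real.log (|(0 : ℝ)| + 3)) := by gcongr
      _ = _ := by ring
  calc _ ≤ (C₁ * (81 * C₂) * (K * Real.log (|(0 : ℝ)| + 3)) * N ^ (c / ℓ)) ^ 2 := by gcongr
    _ = (C₁ * (81 * C₂) * (K * Real.log (|(0 : ℝ)| + 3))) ^ 2 * N ^ (2 * c / ℓ) := by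
        rw [mul_pow, ← Real.rpow_mul_natCast hN0.le]
        congr 2
        push_cast
        ring
    _ ≤ (C₁ * (81 * C₂) * (K * Real.log (|(0 : ℝ)| + 3))) ^ 2 *
        (Real.exp 2 * N ^ (1 / (ℓ : ℝ))) := by gcongr
    _ = _ := by ring

lemma exists_setLIntegral_verticalTerm_le (hRH : RiemannHypothesis) {ℓ : ℕ} (hℓ : 1 ≤ ℓ) :
    ∃ C > 0, ∀ N : ℝ, 8 ≤ N → ∀ ξ : ℝ, 0 ≤ ξ → ξ ≤ 1 / 2 →
      ∫⁻ α in Set.Ioc 0 ξ,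
        ‖verticalTerm ℓ (1 / 2 + 1 / Real.log N) (zPoint (1 / N) α)‖ₑ ^ 2 ≤
      ENNReal.ofReal (C * (N ^ (1 / (ℓ : ℝ)) * ξ * Real.log N ^ 2)) := by
  obtain ⟨A, hA, HA⟩ := exists_setLIntegral_dyadic_verticalTerm_le hRH hℓ
  obtain ⟨B, hB, HB⟩ := exists_norm_verticalTerm_le_of_le_one_div hRH hℓ
  refine ⟨A + B, by positivity, ?_⟩
  intro N hN
  have hN0 : 0 < N := by linarith
  have hL := two_le_log_of_eight_le hN
  have key : ∀ k : ℕ, ∀ ξ : ℝ, 0 ≤ ξ → ξ ≤ 1 / 2 → ξ ≤ 2 ^ k / N →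
      ∫⁻ α in Set.Ioc 0 ξ,
        ‖verticalTerm ℓ (1 / 2 + 1 / Real.log N) (zPoint (1 / N) α)‖ₑ ^ 2 ≤
      ENNReal.ofReal ((A + B) * (N ^ (1 / (ℓ : ℝ)) * ξ * Real.log N ^ 2)) := by
    intro k
    induction k with
    | zero =>
      intro ξ hξ _ hξN
      rw [pow_zero] at hξN
      calc _ ≤ ∫⁻ _ in Set.Ioc 0 ξ, ENNReal.ofReal (B * N ^ (1 / (ℓ : ℝ))) := by
            refine setLIntegral_mono' measurableSet_Ioc fun α hα => ?_
            rw [← ofReal_norm, ← ENNReal.ofReal_pow (norm_nonneg _)]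
            exact ENNReal.ofReal_le_ofReal (HB N hN α hα.1.le (hα.2.trans hξN))
        _ = ENNReal.ofReal (B * N ^ (1 / (ℓ : ℝ)) * ξ) := by
            rw [setLIntegral_const, Real.volume_Ioc, sub_zero, ← ENNReal.ofReal_mul (by positivity)]
        _ ≤ _ := by
            refine ENNReal.ofReal_le_ofReal ?_
            calc _ = B * (N ^ (1 / (ℓ : ℝ)) * ξ * 1) := by ring
              _ ≤ _ := by
                gcongr
                · linarith
                · nlinarith
    | succ k ih =>
      intro ξ hξ hξ1 hξN
      rcases le_or_gt ξ (2 ^ k / N) with h | h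
      · exact ih ξ hξ hξ1 h
      have hk : 1 / N ≤ 2 ^ k / N := by
        gcongr
        exact one_le_pow₀ (by norm_num)
      have h1 := ih (ξ / 2) (by linarith) (by linarith) (by
        rw [pow_succ] at hξN
        rw [div_le_iff₀ (by norm_num)]
        calc ξ ≤ _ := hξN
          _ = _ := by ring)
      have h2 := HA N hN (ξ / 2) (by
        rw [← div_div, div_right_comm]
        linarith) (by linarith)
      rw [mul_div_cancel₀ ξ (by norm_num)] at h2
      rw [← Set.Ioc_union_Ioc_eq_Ioc (by linarith : (0 : ℝ) ≤ ξ / 2) (by linarith : ξ / 2 ≤ ξ)]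
      refine (lintegral_union_le _ _ _).trans ((add_le_add h1 h2).trans ?_)
      rw [← ENNReal.ofReal_add (by positivity) (by positivity)]
      refine ENNReal.ofReal_le_ofReal ?_
      have : 0 ≤ N ^ (1 / (ℓ : ℝ)) * ξ * Real.log N ^ 2 := by positivity
      nlinarith
  intro ξ hξ hξ1
  obtain ⟨k, hk⟩ := pow_unbounded_of_one_lt N (by norm_num : (1 : ℝ) < 2)
  refine key k ξ hξ hξ1 ?_
  rw [le_div_iff₀ hN0]
  nlinarith

lemma norm_zPoint_le {y α : ℝ} (hy : 0 < y) (hy1 : y ≤ 1) (hα : |α| ≤ 1 / 2) :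
    ‖zPoint y α‖ ≤ 5 := by
  have hπ : Real.pi < 3.15 := Real.pi_lt_d2
  have hπ0 := Real.pi_pos
  refine (norm_le_abs_re_add_abs_im _).trans ?_
  rw [zPoint_re, zPoint_im, abs_neg, abs_mul, abs_of_pos hy, abs_of_pos (by positivity)]
  nlinarith

lemma Stilde_eq_tsum_zPoint (N ℓ : ℕ) (α : ℝ) :
    Stilde N ℓ α = ∑' n : ℕ, (ArithmeticFunction.vonMangoldt n : ℂ) *
      exp (-(zPoint (1 / N) α * (n : ℂ) ^ ℓ)) := by
  refine tsum_congr fun n => ?_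
  rw [mul_assoc, ← Complex.exp_add, zPoint]
  congr 2
  push_cast
  ring

lemma conj_zPoint (y α : ℝ) : (starRingEnd ℂ) (zPoint y α) = zPoint y (-α) := by
  apply Complex.ext <;> simp [zPoint_re, zPoint_im]

lemma gammaKernel_one (N ℓ : ℕ) (α : ℝ) :
    gammaKernel ℓ (zPoint (1 / N) α) 1 =
      Gamma (1 / ℓ) / (ℓ * ((1 : ℂ) / N - 2 * Real.pi * I * α) ^ ((1 : ℂ) / ℓ)) := by
  rw [gammaKernel, cpow_neg, zPoint]
  push_cast
  rw [← div_eq_mul_inv, div_div, mul_comm (ℓ : ℂ)]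

lemma gammaKernel_one_conj (ℓ : ℕ) {z : ℂ} (hz : 0 < z.re) :
    gammaKernel ℓ ((starRingEnd ℂ) z) 1 = (starRingEnd ℂ) (gammaKernel ℓ z 1) := by
  have harg : z.arg ≠ Real.pi := fun h => by
    have := abs_lt.1 (abs_arg_lt_pi_div_two_iff.2 (Or.inl hz))
    linarith [this.2, Real.pi_pos]
  have hreal : (starRingEnd ℂ) ((1 : ℂ) / ℓ) = 1 / ℓ := by simp
  rw [gammaKernel, gammaKernel, map_div₀, map_mul, ← Gamma_conj, hreal, conj_natCast,
    conj_cpow _ _ harg, map_neg, hreal]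

lemma norm_Stilde_sub_neg {N : ℕ} (hN : 0 < N) (ℓ : ℕ) (α : ℝ) :
    ‖Stilde N ℓ (-α) - gammaKernel ℓ (zPoint (1 / N) (-α)) 1‖ =
      ‖Stilde N ℓ α - gammaKernel ℓ (zPoint (1 / N) α) 1‖ := by
  have hS : Stilde N ℓ (-α) = (starRingEnd ℂ) (Stilde N ℓ α) := by
    rw [Stilde_eq_tsum_zPoint, Stilde_eq_tsum_zPoint, conj_tsum]
    refine tsum_congr fun n => ?_
    rw [map_mul, conj_ofReal, ← exp_conj, map_neg, map_mul, map_pow, conj_natCast, conj_zPoint]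
  rw [hS, ← conj_zPoint, gammaKernel_one_conj ℓ (by rw [zPoint_re]; positivity), ← map_sub,
    RCLike.norm_conj]

lemma exists_setLIntegral_norm_Stilde_sub_le (hRH : RiemannHypothesis) {ℓ : ℕ} (hℓ : 1 ≤ ℓ) :
    ∃ C > 0, ∀ N : ℕ, 8 ≤ N → ∀ ξ : ℝ, 0 ≤ ξ → ξ ≤ 1 / 2 →
      ∫⁻ α in Set.Ioc 0 ξ,
        ENNReal.ofReal (‖Stilde N ℓ α - gammaKernel ℓ (zPoint (1 / N) α) 1‖ ^ 2) ≤
      ENNReal.ofReal (C * ((N : ℝ) ^ (1 / (ℓ : ℝ)) * ξ * Real.log N ^ 2)) := by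
  obtain ⟨C₀, hC₀, H₀⟩ := exists_norm_tsum_vonMangoldt_sub_le hRH hℓ
  obtain ⟨D, hD, HD⟩ := exists_setLIntegral_verticalTerm_le hRH hℓ
  refine ⟨D + 2 * C₀ ^ 2, by positivity, ?_⟩
  intro N hN' ξ hξ hξ1
  have hN : (8 : ℝ) ≤ N := by exact_mod_cast hN'
  have hL := two_le_log_of_eight_le hN
  have hN0 : (0 : ℝ) < N := by linarith
  set c := 1 / 2 + 1 / Real.log N with hc
  have hc1 : 1 / 2 < c := by
    have : 0 < 1 / Real.log N := by positivity
    linarith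
  have hc2 : c ≤ 1 := by
    have : 1 / Real.log N ≤ 1 / 2 := one_div_le_one_div_of_le (by norm_num) hL
    linarith
  have hy0 : 0 < 1 / (N : ℝ) := by positivity
  have hy1 : 1 / (N : ℝ) ≤ 1 := by
    rw [div_le_one hN0]
    linarith
  have hpoint : ∀ α ∈ Set.Ioc 0 ξ,
      ENNReal.ofReal (‖Stilde N ℓ α - gammaKernel ℓ (zPoint (1 / N) α) 1‖ ^ 2) ≤
        ‖verticalTerm ℓ c (zPoint (1 / N) α)‖ₑ ^ 2 + ENNReal.ofReal (2 * C₀ ^ 2) := by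
    intro α hα
    have h := H₀ c hc1 hc2 (zPoint (1 / N) α) (by rw [zPoint_re]; exact hy0)
      (norm_zPoint_le hy0 hy1 (by rw [abs_of_pos hα.1]; linarith [hα.2]))
    rw [← Stilde_eq_tsum_zPoint] at h
    change ‖_ - (1 / Real.pi : ℂ) * verticalTerm ℓ c (zPoint (1 / N) α)‖ ≤ C₀ at h
    have h1 := (norm_le_norm_sub_add (Stilde N ℓ α - gammaKernel ℓ (zPoint (1 / N) α) 1)
      ((1 / Real.pi : ℂ) * verticalTerm ℓ c (zPoint (1 / N) α)))
    have h2 : ‖(1 / Real.pi : ℂ) * verticalTerm ℓ c (zPoint (1 / N) α)‖ ≤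
        1 / 2 * ‖verticalTerm ℓ c (zPoint (1 / N) α)‖ := by
      rw [norm_mul, norm_div, norm_one, norm_real, Real.norm_eq_abs, abs_of_pos Real.pi_pos]
      gcongr
      linarith [Real.pi_gt_three]
    have h3 := norm_nonneg (Stilde N ℓ α - gammaKernel ℓ (zPoint (1 / N) α) 1)
    rw [← ofReal_norm, ← ENNReal.ofReal_pow (norm_nonneg _),
      ← ENNReal.ofReal_add (by positivity) (by positivity)]
    refine ENNReal.ofReal_le_ofReal ?_
    set V := ‖verticalTerm ℓ c (zPoint (1 / N) α)‖ with hV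
    have hV0 : 0 ≤ V := norm_nonneg _
    calc _ ≤ (1 / 2 * V + C₀) ^ 2 := by
          gcongr
          linarith
      _ ≤ V ^ 2 + 2 * C₀ ^ 2 := by nlinarith [sq_nonneg (1 / 2 * V - C₀), sq_nonneg V]
  calc _ ≤ ∫⁻ α in Set.Ioc 0 ξ,
        (‖verticalTerm ℓ c (zPoint (1 / N) α)‖ₑ ^ 2 + ENNReal.ofReal (2 * C₀ ^ 2)) :=
        setLIntegral_mono' measurableSet_Ioc hpoint
    _ = (∫⁻ α in Set.Ioc 0 ξ, ‖verticalTerm ℓ c (zPoint (1 / N) α)‖ₑ ^ 2) +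
        ENNReal.ofReal (2 * C₀ ^ 2 * ξ) := by
        rw [lintegral_add_right _ measurable_const, setLIntegral_const, Real.volume_Ioc, sub_zero,
          ← ENNReal.ofReal_mul (by positivity)]
    _ ≤ ENNReal.ofReal (D * ((N : ℝ) ^ (1 / (ℓ : ℝ)) * ξ * Real.log N ^ 2)) +
        ENNReal.ofReal (2 * C₀ ^ 2 * ξ) := by
        gcongr
        exact HD N hN ξ hξ hξ1
    _ ≤ _ := by
        rw [← ENNReal.ofReal_add (by positivity) (by positivity)]
        refine ENNReal.ofReal_le_ofReal ?_
        have h1 : 1 ≤ (N : ℝ) ^ (1 / (ℓ : ℝ)) :=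
          Real.one_le_rpow (by linarith) (by positivity)
        have h2 : 1 * ξ * 1 ≤ (N : ℝ) ^ (1 / (ℓ : ℝ)) * ξ * Real.log N ^ 2 := by
          gcongr
          nlinarith
        have h3 := mul_le_mul_of_nonneg_left h2 (by positivity : 0 ≤ 2 * C₀ ^ 2)
        linarith

/-- Assuming RH, for every integer `ℓ ≥ 1` and all sufficiently large `N`
(with `L = log N`, `z = 1/N − 2πiα`),
`∫_{−ξ}^{ξ} |S̃_ℓ(α) − Γ(1/ℓ)/(ℓ z^{1/ℓ})|² dα ≪_ℓ N^{1/ℓ} ξ L²`, uniformly for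
`0 ≤ ξ ≤ 1/2`. -/
theorem Stilde_truncated_L2_RH (hRH : RiemannHypothesis) (ℓ : ℕ) (hℓ : 1 ≤ ℓ) :
    ∃ C > (0 : ℝ), ∃ N₀ : ℕ, ∀ N : ℕ, N₀ ≤ N → ∀ ξ : ℝ, 0 ≤ ξ → ξ ≤ 1 / 2 →
      (∫ α in (-ξ)..ξ,
          ‖Stilde N ℓ α -
            Complex.Gamma (1 / ℓ) /
              (ℓ * ((1 : ℂ) / N - 2 * Real.pi * Complex.I * α) ^ ((1 : ℂ) / ℓ))‖ ^ 2) ≤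
        C * (N : ℝ) ^ (1 / (ℓ : ℝ)) * ξ * Real.log N ^ 2 := by
  obtain ⟨C, hC, H⟩ := exists_setLIntegral_norm_Stilde_sub_le hRH hℓ
  refine ⟨2 * C, by positivity, 8, ?_⟩
  intro N hN ξ hξ hξ1
  simp only [← gammaKernel_one]
  set f : ℝ → ℝ := fun α => ‖Stilde N ℓ α - gammaKernel ℓ (zPoint (1 / N) α) 1‖ ^ 2 with hf
  by_cases hi : IntervalIntegrable f volume (-ξ) ξ
  swap
  · rw [intervalIntegral.integral_undef hi]
    positivity
  have hi1 : IntervalIntegrable f volume (-ξ) 0 := hi.mono_set (by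
    rw [Set.uIcc_of_le (by linarith), Set.uIcc_of_le (by linarith)]
    exact Set.Icc_subset_Icc le_rfl hξ)
  have hi2 : IntervalIntegrable f volume 0 ξ := hi.mono_set (by
    rw [Set.uIcc_of_le (by linarith), Set.uIcc_of_le (by linarith)]
    exact Set.Icc_subset_Icc (by linarith) le_rfl)
  have hneg : ∫ α in (-ξ)..0, f α = ∫ α in (0 : ℝ)..ξ, f α := by
    rw [← neg_zero, ← intervalIntegral.integral_comp_neg, neg_zero]
    refine intervalIntegral.integral_congr fun α _ => ?_
    simp only [hf]
    rw [norm_Stilde_sub_neg (by omega)]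
  have hpos : ∫ α in (0 : ℝ)..ξ, f α ≤ C * ((N : ℝ) ^ (1 / (ℓ : ℝ)) * ξ * Real.log N ^ 2) := by
    rw [intervalIntegral.integral_of_le hξ, integral_eq_lintegral_of_nonneg_ae
      (Filter.Eventually.of_forall fun α => by positivity)
      ((intervalIntegrable_iff_integrableOn_Ioc_of_le hξ).1 hi2).aestronglyMeasurable]
    exact ENNReal.toReal_le_of_le_ofReal (by positivity) (H N hN ξ hξ hξ1)
  rw [← intervalIntegral.integral_add_adjacent_intervals hi1 hi2, hneg]
  linarith
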